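/- There exists n0 such that for every n ≥ n0 the following holds. Let 𝒟 = {D_1, …, D_n} be a collection of digraphs on a common vertex set V of size n. If δ⁰(𝒟) ≥ n/2 (i.e., every D_i has minimum out-degree and minimum in-degree at least n/2), then 𝒟 contains a transversal directed Hamilton cycle: a directed Hamilton cycle H on V together with a bijection φ : E(H) → [n] such that e ∈ E(D_{φ(e)}) for every edge e of H. -/

import Mathlib

/-- Out-degree of a vertex in a digraph given as a relation on `Fin n`. -/
noncomputable def outDeg {n : ℕ} (D : Fin n → Fin n → Prop) (v : Fin n) : ℕ :=
  Nat.card {w : Fin n // D v w}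

/-- In-degree of a vertex in a digraph given as a relation on `Fin n`. -/
noncomputable def inDeg {n : ℕ} (D : Fin n → Fin n → Prop) (v : Fin n) : ℕ :=
  Nat.card {w : Fin n // D w v}

namespace TGH
open Equiv Equiv.Perm
set_option linter.unusedSectionVars false

section Cycles
variable {α : Type*} [Fintype α] [DecidableEq α]

/-- The number of cycles of a permutation, fixed points included. -/
noncomputable def numCycles (f : Perm α) : ℕ := Nat.card (Quotient (SameCycle.setoid f))

theorem mem_of_mapsTo {g : Perm α} {Z : Set α} (h : ∀ x ∈ Z, g x ∈ Z) {x y : α} (hx : x ∈ Z)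
    (hxy : SameCycle g x y) : y ∈ Z := by
  obtain ⟨k, rfl⟩ := hxy.exists_nat_pow_eq
  clear hxy
  induction k with
  | zero => simpa
  | succ k ih => rw [pow_succ', Perm.mul_apply]; exact h _ ih

theorem sameCycle_induction {g : Perm α} {p : α → Prop} {x y : α} (hxy : SameCycle g x y)
    (hx : p x) (h : ∀ z, p z → p (g z)) : p y :=
  mem_of_mapsTo (Z := {z | p z}) h hx hxy

theorem sameCycle_mul_swap {f : Perm α} {a b : α} (h : ¬ SameCycle f a b) :
    SameCycle (f * swap a b) a b := by
  by_contra hc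
  have key : ∀ k : ℕ, SameCycle (f * swap a b) a ((f ^ (k + 1)) b) := by
    intro k
    induction k with
    | zero =>
      have : (f * swap a b) a = f b := by simp
      rw [zero_add, pow_one, ← this]
      exact (SameCycle.refl _ _).apply_right
    | succ k ih =>
      have h1 : (f ^ (k + 1)) b ≠ a := by
        intro e
        exact h (SameCycle.symm ⟨(k + 1 : ℕ), by rw [zpow_natCast]; exact e⟩)
      have h2 : (f ^ (k + 1)) b ≠ b := by
        intro e; rw [e] at ih; exact hc ih
      have : (f * swap a b) ((f ^ (k + 1)) b) = (f ^ (k + 1 + 1)) b := by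
        rw [Perm.mul_apply, swap_apply_of_ne_of_ne h1 h2, pow_succ' f (k + 1), Perm.mul_apply]
      rw [← this]
      exact ih.apply_right
  have := key (orderOf f - 1)
  rw [Nat.sub_add_cancel (orderOf_pos f), pow_orderOf_eq_one] at this
  exact hc this

theorem SameCycle.of_mul_swap {f : Perm α} {a b x y : α} (h : SameCycle (f * swap a b) a b)
    (hxy : SameCycle f x y) : SameCycle (f * swap a b) x y := by
  refine sameCycle_induction (p := fun z => SameCycle (f * swap a b) x z) hxy (SameCycle.refl _ _) ?_
  intro z hz
  have e : f z = (f * swap a b) (swap a b z) := by simp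
  rw [e]
  refine (SameCycle.trans hz ?_).apply_right
  by_cases ha : z = a
  · subst ha; simpa using h
  by_cases hb : z = b
  · subst hb; simpa using h.symm
  rw [swap_apply_of_ne_of_ne ha hb]

theorem SameCycle.merge {f : Perm α} {a b x y : α} (h : ¬ SameCycle f a b)
    (hxy : SameCycle f x y) : SameCycle (f * swap a b) x y :=
  SameCycle.of_mul_swap (sameCycle_mul_swap h) hxy

theorem numCycles_le_of {f g : Perm α} (h : ∀ x y, SameCycle f x y → SameCycle g x y) :
    numCycles g ≤ numCycles f := by
  refine Nat.card_le_card_of_surjective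
    (Quotient.map' (s₁ := SameCycle.setoid f) (s₂ := SameCycle.setoid g) id (fun x y => h x y)) ?_
  intro q
  induction q using Quotient.inductionOn with
  | h x => exact ⟨Quotient.mk _ x, rfl⟩

theorem numCycles_mul_swap_lt {f : Perm α} {a b : α} (h : ¬ SameCycle f a b) :
    numCycles (f * swap a b) < numCycles f := by
  let F : Quotient (SameCycle.setoid f) → Quotient (SameCycle.setoid (f * swap a b)) :=
    (Quotient.map' (s₁ := SameCycle.setoid f) (s₂ := SameCycle.setoid (f * swap a b)) id
      (fun x y => SameCycle.merge h))
  have hF : Function.Surjective F := by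
    intro q
    induction q using Quotient.inductionOn with
    | h x => exact ⟨Quotient.mk _ x, rfl⟩
  have hab : F (Quotient.mk _ a) = F (Quotient.mk _ b) := Quotient.sound (sameCycle_mul_swap h)
  refine lt_of_le_of_ne (Nat.card_le_card_of_surjective F hF) fun he => ?_
  have hi := (hF.bijective_of_nat_card_le he.ge).injective
  exact h (Quotient.exact (hi hab))

theorem numCycles_mul_swap_le (f : Perm α) (a b : α) :
    numCycles (f * swap a b) ≤ numCycles f + 1 := by
  classical
  by_cases h : SameCycle (f * swap a b) a b
  · exact (numCycles_le_of fun x y => SameCycle.of_mul_swap h).trans (Nat.le_succ _)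
  set g := f * swap a b with hg
  have hf : f = g * swap a b := by rw [hg, mul_assoc, swap_mul_self, mul_one]
  have hm : ∀ x y, SameCycle g x y → SameCycle f x y := by
    intro x y hxy; rw [hf]; exact SameCycle.merge h hxy
  let C : α → Quotient (SameCycle.setoid g) := fun x =>
    if SameCycle g x b then Quotient.mk _ a else Quotient.mk _ x
  have hCg : ∀ x, C (g x) = C x := by
    intro x
    simp only [C, sameCycle_apply_left]
    split_ifs
    · rfl
    · exact Quotient.sound ((SameCycle.refl g x).apply_left)
  have hab : C a = C b := by simp [C, SameCycle.refl g b]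
  have hCf : ∀ x, C (f x) = C x := by
    intro x
    rw [hf, Perm.mul_apply, hCg]
    by_cases ha : x = a
    · subst ha; simp [hab]
    by_cases hb : x = b
    · subst hb; simp [hab]
    rw [swap_apply_of_ne_of_ne ha hb]
  let F : Quotient (SameCycle.setoid g) → Option (Quotient (SameCycle.setoid f)) :=
    fun q => if q = Quotient.mk _ b then none else
      some (Quotient.map' (s₁ := SameCycle.setoid g) (s₂ := SameCycle.setoid f) id
        (fun x y => hm x y) q)
  have hF : Function.Injective F := by
    intro p q hpq
    induction p using Quotient.inductionOn with
    | h x =>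
    induction q using Quotient.inductionOn with
    | h y =>
    simp only [F] at hpq
    split_ifs at hpq with h1 h2 h2
    · rw [h1, h2]
    · have hxy : SameCycle f x y := Quotient.exact (Option.some.inj hpq)
      have hC : C x = C y := by
        refine sameCycle_induction (p := fun z => C x = C z) hxy rfl ?_
        intro z hz; rw [hCf, hz]
      have h1' : ¬ SameCycle g x b := fun hh => h1 (Quotient.sound hh)
      have h2' : ¬ SameCycle g y b := fun hh => h2 (Quotient.sound hh)
      simpa [C, h1', h2'] using hC
  have := Nat.card_le_card_of_injective F hF
  rwa [Finite.card_option] at this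

theorem numCycles_le_one_iff {f : Perm α} : numCycles f ≤ 1 ↔ ∀ x y, SameCycle f x y := by
  rw [numCycles, Finite.card_le_one_iff_subsingleton]
  constructor
  · intro h x y
    exact Quotient.exact (h.elim (Quotient.mk (SameCycle.setoid f) x) (Quotient.mk _ y))
  · intro h
    refine ⟨fun p q => ?_⟩
    induction p using Quotient.inductionOn
    induction q using Quotient.inductionOn
    exact Quotient.sound (h _ _)

theorem not_sameCycle_of_first {f : Perm α} {v₁ v₂ v₃ : α} {i : ℕ} (hi : 1 ≤ i)
    (h2 : (f ^ i) v₁ = v₂) (hlt : ∀ k, 1 ≤ k → k < i → (f ^ k) v₁ ≠ v₂)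
    (h3 : ∀ k, 1 ≤ k → k ≤ i → (f ^ k) v₁ ≠ v₃) :
    ¬ SameCycle (f * swap v₁ v₂) v₂ v₃ := by
  intro hs
  have := mem_of_mapsTo (Z := {x | ∃ k, 1 ≤ k ∧ k ≤ i ∧ (f ^ k) v₁ = x}) (g := f * swap v₁ v₂)
    ?_ ⟨i, hi, le_rfl, h2⟩ hs
  · obtain ⟨k, a, b, c⟩ := this
    exact h3 k a b c
  · rintro x ⟨k, hk1, hki, rfl⟩
    rcases hki.lt_or_eq with hlt' | rfl
    · refine ⟨k + 1, by omega, by omega, ?_⟩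
      have h1 : (f ^ k) v₁ ≠ v₁ := by
        intro e
        refine hlt (i - k) (by omega) (by omega) ?_
        have : (f ^ (i - k)) ((f ^ k) v₁) = v₂ := by
          rw [← Perm.mul_apply, ← pow_add, Nat.sub_add_cancel hki, h2]
        rwa [e] at this
      rw [Perm.mul_apply, swap_apply_of_ne_of_ne h1 (hlt k hk1 hlt'), pow_succ', Perm.mul_apply]
    · exact ⟨1, le_rfl, hk1, by simp [h2]⟩

theorem exists_first_pow {f : Perm α} {a b : α} (h : SameCycle f a b) :
    ∃ i, 1 ≤ i ∧ (f ^ i) a = b ∧ ∀ k, 1 ≤ k → k < i → (f ^ k) a ≠ b := by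
  classical
  have ex : ∃ i, 1 ≤ i ∧ (f ^ i) a = b := by
    obtain ⟨i, h1, -, h2⟩ := h.exists_pow_eq''
    exact ⟨i, h1, h2⟩
  refine ⟨Nat.find ex, (Nat.find_spec ex).1, (Nat.find_spec ex).2, ?_⟩
  intro k hk hlt e
  exact Nat.find_min ex hlt ⟨hk, e⟩

theorem not_sameCycle_or_of_sameCycle {f : Perm α} {v₁ v₂ v₃ : α}
    (h23 : v₂ ≠ v₃) (s2 : SameCycle f v₁ v₂) (s3 : SameCycle f v₁ v₃) :
    ¬ SameCycle (f * swap v₁ v₂) v₂ v₃ ∨ ¬ SameCycle (f * swap v₁ v₃) v₃ v₂ := by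
  obtain ⟨i, hi, hi2, himin⟩ := exists_first_pow s2
  obtain ⟨j, hj, hj2, hjmin⟩ := exists_first_pow s3
  rcases lt_trichotomy i j with h | h | h
  · exact Or.inl (not_sameCycle_of_first hi hi2 himin fun k hk hki => hjmin k hk (by omega))
  · subst h; exact absurd (hi2.symm.trans hj2) h23
  · exact Or.inr (not_sameCycle_of_first hj hj2 hjmin fun k hk hki => himin k hk (by omega))

theorem numCycles_four_switch_lt {f : Perm α} {v₀ v₁ v₂ v₃ : α} (h0 : ¬ SameCycle f v₀ v₁)
    (h23 : v₂ ≠ v₃) :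
    numCycles (f * swap v₀ v₁ * swap v₁ v₂ * swap v₂ v₃) < numCycles f ∨
    numCycles (f * swap v₀ v₁ * swap v₁ v₃ * swap v₃ v₂) < numCycles f := by
  have h1 := numCycles_mul_swap_lt h0
  set f₁ := f * swap v₀ v₁
  have aux : ∀ a b, ¬ SameCycle f₁ v₁ a ∨ ¬ SameCycle (f₁ * swap v₁ a) a b →
      numCycles (f₁ * swap v₁ a * swap a b) < numCycles f := by
    rintro a b (h | h)
    · have := numCycles_mul_swap_lt h
      have := numCycles_mul_swap_le (f₁ * swap v₁ a) a b
      omega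
    · have := numCycles_mul_swap_lt h
      have := numCycles_mul_swap_le f₁ v₁ a
      omega
  by_cases s2 : SameCycle f₁ v₁ v₂
  · by_cases s3 : SameCycle f₁ v₁ v₃
    · exact (not_sameCycle_or_of_sameCycle h23 s2 s3).imp
        (fun h => aux _ _ (Or.inr h)) (fun h => aux _ _ (Or.inr h))
    · exact Or.inr (aux _ _ (Or.inl s3))
  · exact Or.inl (aux _ _ (Or.inl s2))

end Cycles

open scoped Classical

section Position
variable {α : Type*} [Fintype α] [DecidableEq α]

theorem exists_pow_base (f : Perm α) (x : α) :
    ∃ k : ℕ, (f ^ k) (Quotient.mk (SameCycle.setoid f) x).out = x := by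
  have : SameCycle f (Quotient.mk (SameCycle.setoid f) x).out x :=
    Quotient.exact (Quotient.out_eq (Quotient.mk (SameCycle.setoid f) x))
  exact this.exists_nat_pow_eq

/-- The position of `x` on its cycle, counted from a chosen base point of the cycle. -/
noncomputable def pos (f : Perm α) (x : α) : ℕ := Nat.find (exists_pow_base f x)

theorem base_eq {f : Perm α} {x y : α} (h : SameCycle f x y) :
    (Quotient.mk (SameCycle.setoid f) x).out = (Quotient.mk (SameCycle.setoid f) y).out := by
  rw [Quotient.sound (s := SameCycle.setoid f) h]

theorem pow_pos_base {f : Perm α} {x y : α} (h : SameCycle f x y) :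
    (f ^ pos f y) (Quotient.mk (SameCycle.setoid f) x).out = y := by
  rw [base_eq h]; exact Nat.find_spec (exists_pow_base f y)

theorem pos_le {f : Perm α} {x y : α} (h : SameCycle f x y) {k : ℕ}
    (hk : (f ^ k) (Quotient.mk (SameCycle.setoid f) x).out = y) : pos f y ≤ k := by
  rw [base_eq h] at hk; exact Nat.find_min' _ hk

theorem pos_injOn {f : Perm α} {x y : α} (h : SameCycle f x y) (e : pos f x = pos f y) :
    x = y := by
  rw [← pow_pos_base h, ← e]; exact (pow_pos_base (SameCycle.refl f x)).symm

theorem pos_apply {f : Perm α} {x y : α} (h : SameCycle f x y) (hlt : pos f x < pos f y) :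
    pos f (f x) = pos f x + 1 := by
  have hx := pow_pos_base (SameCycle.refl f x)
  have hfx : SameCycle f x (f x) := (SameCycle.refl f x).apply_right
  have hle : pos f (f x) ≤ pos f x + 1 := by
    refine pos_le hfx ?_
    rw [pow_succ', Perm.mul_apply, hx]
  by_contra hne
  rcases Nat.eq_zero_or_pos (pos f (f x)) with h0 | h0
  · have hb := pow_pos_base hfx
    rw [h0, pow_zero, Perm.one_apply] at hb
    have := mem_of_mapsTo (g := f) (x := x) (y := y)
      (Z := {z | ∃ k ≤ pos f x, (f ^ k) (Quotient.mk (SameCycle.setoid f) x).out = z})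
      ?_ ⟨pos f x, le_rfl, hx⟩ h
    · obtain ⟨k, hk, e⟩ := this
      have := pos_le h e
      omega
    · rintro z ⟨k, hk, rfl⟩
      rcases hk.lt_or_eq with hk | rfl
      · exact ⟨k + 1, hk, by rw [pow_succ', Perm.mul_apply]⟩
      · exact ⟨0, Nat.zero_le _, by rw [pow_zero, Perm.one_apply, hx, hb]⟩
  · have hb := pow_pos_base hfx
    obtain ⟨k, hk⟩ : ∃ k, pos f (f x) = k + 1 := ⟨pos f (f x) - 1, by omega⟩
    rw [hk, pow_succ', Perm.mul_apply] at hb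
    have := pos_le (SameCycle.refl f x) (f.injective hb)
    omega

theorem exists_crossing (F : Finset (α × α)) (k : α → ℕ)
    (h1 : ∀ a a' b, (a, b) ∈ F → (a', b) ∈ F → k a = k a' → a = a')
    (h2 : ∀ a b b', (a, b) ∈ F → (a, b') ∈ F → k b = k b' → b = b')
    (hF : 2 * Fintype.card α < F.card) :
    ∃ a b a' b', (a, b) ∈ F ∧ (a', b) ∈ F ∧ (a, b') ∈ F ∧ k a' < k a ∧ k b < k b' := by
  by_contra! hc
  have hsub : F ⊆ F.filter (fun p => ∀ a', (a', p.2) ∈ F → k p.1 ≤ k a') ∪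
      F.filter (fun p => ∀ b', (p.1, b') ∈ F → k b' ≤ k p.2) := by
    rintro ⟨a, b⟩ h
    simp only [Finset.mem_union, Finset.mem_filter, h, true_and]
    by_contra! hh
    obtain ⟨⟨a', ha', hl⟩, ⟨b', hb', hl'⟩⟩ := hh
    have := hc a b a' b' h ha' hb' hl
    omega
  have c1 : (F.filter (fun p => ∀ a', (a', p.2) ∈ F → k p.1 ≤ k a')).card ≤ Fintype.card α := by
    refine Finset.card_le_card_of_injOn Prod.snd (fun _ _ => Finset.mem_univ _) ?_
    rintro ⟨a, b⟩ h ⟨a', b'⟩ h' e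
    simp only [Finset.coe_filter, Set.mem_ofPred_eq] at h h' e
    subst e
    rw [h1 a a' b h.1 h'.1 (le_antisymm (h.2 _ h'.1) (h'.2 _ h.1))]
  have c2 : (F.filter (fun p => ∀ b', (p.1, b') ∈ F → k b' ≤ k p.2)).card ≤ Fintype.card α := by
    refine Finset.card_le_card_of_injOn Prod.fst (fun _ _ => Finset.mem_univ _) ?_
    rintro ⟨a, b⟩ h ⟨a', b'⟩ h' e
    simp only [Finset.coe_filter, Set.mem_ofPred_eq] at h h' e
    subst e
    rw [h2 a b b' h.1 h'.1 (le_antisymm (h'.2 _ h.1) (h.2 _ h'.1))]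
  have := (Finset.card_le_card hsub).trans (Finset.card_union_le _ _)
  omega

theorem three_switch_apply (f : Perm α) {a b c : α} (hab : a ≠ b) (hac : a ≠ c) (hbc : b ≠ c) :
    (f * swap a b * swap b c) a = f b ∧ (f * swap a b * swap b c) b = f c ∧
    (f * swap a b * swap b c) c = f a ∧
    ∀ x, x ≠ a → x ≠ b → x ≠ c → (f * swap a b * swap b c) x = f x := by
  refine ⟨?_, ?_, ?_, ?_⟩
  · simp [swap_apply_of_ne_of_ne hab hac]
  · simp [swap_apply_of_ne_of_ne hac.symm hbc.symm]
  · simp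
  · intro x h1 h2 h3
    simp [swap_apply_of_ne_of_ne h2 h3, swap_apply_of_ne_of_ne h1 h2]

theorem numCycles_double_switch_lt {f : Perm α} {u v w u' v' w' : α} {Z : Set α}
    (huv : ¬ SameCycle f u v) (hwu : u ≠ w) (hvw : v ≠ w)
    (h1 : ¬ SameCycle f u' u) (h2 : ¬ SameCycle f u' v) (h3 : ¬ SameCycle f u' w)
    (h4 : ¬ SameCycle f u' v')
    (hZ : ∀ x ∈ Z, (f * swap u v * swap v w) x ∈ Z) (hw : w' ∈ Z) (hv : v' ∉ Z) (hu : u' ∉ Z) :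
    numCycles (f * swap u v * swap v w * swap u' v' * swap v' w') < numCycles f := by
  have a1 := numCycles_mul_swap_lt huv
  have a2 := numCycles_mul_swap_le (f * swap u v) v w
  have huv' : u ≠ v := by rintro rfl; exact huv (SameCycle.refl _ _)
  obtain ⟨-, -, -, hx⟩ := three_switch_apply f huv' hwu hvw
  set g := f * swap u v * swap v w
  have a3 : ¬ SameCycle g u' v' := by
    intro hs
    refine h4 (mem_of_mapsTo (Z := {x | SameCycle f u' x}) ?_ (SameCycle.refl _ _) hs)
    intro x hxs
    simp only [Set.mem_ofPred_eq] at hxs ⊢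
    rw [hx x (by rintro rfl; exact h1 hxs) (by rintro rfl; exact h2 hxs)
      (by rintro rfl; exact h3 hxs)]
    exact hxs.apply_right
  have a4 := numCycles_mul_swap_lt a3
  have a5 : ¬ SameCycle (g * swap u' v') v' w' := by
    intro hs
    refine hv (mem_of_mapsTo (Z := Z) ?_ hw hs.symm)
    intro x hxs
    rw [Perm.mul_apply, swap_apply_of_ne_of_ne (by rintro rfl; exact hu hxs)
      (by rintro rfl; exact hv hxs)]
    exact hZ x hxs
  have a6 := numCycles_mul_swap_lt a5
  omega

end Position

section Minimal
variable {α : Type*} [Fintype α] [DecidableEq α]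

theorem factor_three_switch {r : α → α → Prop} {f : Perm α} (hf : ∀ x, r x (f x)) {u v w : α}
    (huv : u ≠ v) (huw : u ≠ w) (hvw : v ≠ w) (h1 : r u (f v)) (h2 : r v (f w)) (h3 : r w (f u)) :
    ∀ x, r x ((f * swap u v * swap v w) x) := by
  obtain ⟨e1, e2, e3, e4⟩ := three_switch_apply f huv huw hvw
  intro x
  by_cases c1 : x = u
  · rw [c1, e1]; exact h1
  by_cases c2 : x = v
  · rw [c2, e2]; exact h2
  by_cases c3 : x = w
  · rw [c3, e3]; exact h3
  rw [e4 x c1 c2 c3]; exact hf x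

/-- The pairs `(v, w)` off the cycle of `u` for which `u, v, w` can be switched cyclically. -/
noncomputable def switchPairs (r : α → α → Prop) (f : Perm α) (u : α) : Finset (α × α) :=
  Finset.univ.filter fun p => r u (f p.1) ∧ r p.1 (f p.2) ∧ r p.2 (f u) ∧
    ¬ SameCycle f u p.1 ∧ ¬ SameCycle f u p.2 ∧ p.1 ≠ p.2

theorem not_sameCycle_mul_swap {f : Perm α} {u v w : α} (huw : ¬ SameCycle f u w)
    (hvw : ¬ SameCycle f v w) : ¬ SameCycle (f * swap u v) v w := by
  intro hs
  refine hvw (SameCycle.symm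
    (mem_of_mapsTo (Z := {x | SameCycle f w x}) ?_ (SameCycle.refl _ _) hs.symm))
  intro x hx
  simp only [Set.mem_ofPred_eq] at hx ⊢
  rw [Perm.mul_apply, swap_apply_of_ne_of_ne (by rintro rfl; exact huw hx.symm)
    (by rintro rfl; exact hvw hx.symm)]
  exact hx.apply_right

theorem sameCycle_of_mem_switchPairs {r : α → α → Prop} {f : Perm α} (hf : ∀ x, r x (f x))
    (hmin : ∀ g : Perm α, (∀ x, r x (g x)) → numCycles f ≤ numCycles g) {u : α} {p : α × α}
    (hp : p ∈ switchPairs r f u) : SameCycle f p.1 p.2 := by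
  simp only [switchPairs, Finset.mem_filter, Finset.mem_univ, true_and] at hp
  obtain ⟨h1, h2, h3, h4, h5, h6⟩ := hp
  by_contra hs
  have n1 := numCycles_mul_swap_lt h4
  have n2 := numCycles_mul_swap_lt (not_sameCycle_mul_swap h5 hs)
  have := hmin _ (factor_three_switch hf (by rintro rfl; exact h4 (SameCycle.refl _ _))
    (by rintro rfl; exact h5 (SameCycle.refl _ _)) h6 h1 h2 h3)
  omega

theorem card_switchPairs_inter_le {r : α → α → Prop} {f : Perm α} (hf : ∀ x, r x (f x))
    (hmin : ∀ g : Perm α, (∀ x, r x (g x)) → numCycles f ≤ numCycles g) {u u' : α}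
    (huu : ¬ SameCycle f u u') :
    (switchPairs r f u ∩ switchPairs r f u').card ≤ 4 * Fintype.card α := by
  set F := switchPairs r f u ∩ switchPairs r f u' with hF
  have same : ∀ p ∈ F, SameCycle f p.1 p.2 := fun p hp =>
    sameCycle_of_mem_switchPairs hf hmin (Finset.mem_inter.mp hp).1
  have prop : ∀ v w, (v, w) ∈ F → (r u (f v) ∧ r v (f w) ∧ r w (f u) ∧
    ¬ SameCycle f u v ∧ ¬ SameCycle f u w ∧ v ≠ w) ∧ (r u' (f v) ∧ r v (f w) ∧ r w (f u') ∧
    ¬ SameCycle f u' v ∧ ¬ SameCycle f u' w ∧ v ≠ w) := by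
    intro v w h
    simpa [hF, switchPairs] using h
  -- both orientations reduce to the following
  have key : ∀ v w v' w' (Z : Set α), (v, w) ∈ F → (v', w') ∈ F → v ≠ v' → v ≠ w' → w ≠ v' →
      w ≠ w' → (∀ x ∈ Z, (f * swap u v * swap v w) x ∈ Z) → w' ∈ Z → v' ∉ Z → u' ∉ Z → False := by
    intro v w v' w' Z h h' d1 d2 d3 d4 hZ hw hv hu
    obtain ⟨⟨a1, a2, a3, a4, a5, a6⟩, ⟨-, -, -, b4, b5, -⟩⟩ := prop v w h
    obtain ⟨⟨-, -, -, c4, c5, -⟩, ⟨e1, e2, e3, e4, e5, e6⟩⟩ := prop v' w' h'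
    have nuv : u ≠ v := by rintro rfl; exact a4 (SameCycle.refl _ _)
    have nuw : u ≠ w := by rintro rfl; exact a5 (SameCycle.refl _ _)
    have huv₂ : u' ≠ v' := by rintro rfl; exact e4 (SameCycle.refl _ _)
    have huw₂ : u' ≠ w' := by rintro rfl; exact e5 (SameCycle.refl _ _)
    have nuv' : u ≠ v' := by rintro rfl; exact c4 (SameCycle.refl _ _)
    have nuw' : u ≠ w' := by rintro rfl; exact c5 (SameCycle.refl _ _)
    have nu'v : u' ≠ v := by rintro rfl; exact b4 (SameCycle.refl _ _)
    have nu'w : u' ≠ w := by rintro rfl; exact b5 (SameCycle.refl _ _)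
    have nuu : u' ≠ u := by rintro rfl; exact huu (SameCycle.refl _ _)
    have n1 := numCycles_double_switch_lt (u' := u') (v' := v') a4 nuw a6 (fun h => huu h.symm)
      b4 b5 e4 hZ hw hv hu
    obtain ⟨-, -, -, hx⟩ := three_switch_apply f nuv nuw a6
    have hg := factor_three_switch hf nuv nuw a6 a1 a2 a3
    have hg2 := factor_three_switch hg huv₂ huw₂ e6
      (by rw [hx _ nuv'.symm d1.symm d3.symm]; exact e1)
      (by rw [hx _ nuw'.symm d2.symm d4.symm]; exact e2)
      (by rw [hx _ nuu nu'v nu'w]; exact e3)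
    have := hmin _ hg2
    omega
  by_contra! hlt
  let F1 := F.filter fun p => pos f p.1 < pos f p.2
  let F2 := F.filter fun p => ¬ pos f p.1 < pos f p.2
  have hsum : F1.card + F2.card = F.card := Finset.card_filter_add_card_filter_not _
  by_cases hc : 2 * Fintype.card α < F1.card
  · have c1 : ∀ a a' b, (a, b) ∈ F1 → (a', b) ∈ F1 → pos f a = pos f a' → a = a' := by
      intro a a' b ha ha' e
      exact pos_injOn ((same _ (Finset.mem_filter.mp ha).1).trans
        (same _ (Finset.mem_filter.mp ha').1).symm) e
    have c2 : ∀ a b b', (a, b) ∈ F1 → (a, b') ∈ F1 → pos f b = pos f b' → b = b' := by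
      intro a b b' ha ha' e
      exact pos_injOn ((same _ (Finset.mem_filter.mp ha).1).symm.trans
        (same _ (Finset.mem_filter.mp ha').1)) e
    obtain ⟨a, b, a', b', m1, m2, m3, l1, l2⟩ := exists_crossing F1 (pos f) c1 c2 hc
    have f1 := (Finset.mem_filter.mp m1).1
    have l3 : pos f a < pos f b := (Finset.mem_filter.mp m1).2
    have f2 := (Finset.mem_filter.mp m2).1
    have f3 := (Finset.mem_filter.mp m3).1
    have sab := same _ f1
    have sa'b := same _ f2
    have sab' := same _ f3
    obtain ⟨⟨-, -, -, p4, p5, p6⟩, ⟨-, -, -, q4, q5, -⟩⟩ := prop _ _ f3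
    obtain ⟨⟨-, -, -, p4', p5', -⟩, -⟩ := prop _ _ f2
    obtain ⟨t1, t2, t3, t4⟩ := three_switch_apply f (a := u) (b := a) (c := b')
      (by rintro rfl; exact p4 (SameCycle.refl _ _))
      (by rintro rfl; exact p5 (SameCycle.refl _ _)) p6
    refine key a b' a' b
      {y | SameCycle f u y ∨ (SameCycle f a y ∧ pos f a < pos f y ∧ pos f y ≤ pos f b')} f3 f2
      (by rintro rfl; omega) (by rintro rfl; omega) (by rintro rfl; omega)
      (by rintro rfl; omega) ?_ (Or.inr ⟨sab, l3, l2.le⟩) ?_ ?_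
    · rintro y (hy | ⟨hy, g1, g2⟩)
      · by_cases e : y = u
        · subst e
          rw [t1]
          have : pos f (f a) = pos f a + 1 := pos_apply sab l3
          exact Or.inr ⟨(SameCycle.refl f a).apply_right, by omega, by omega⟩
        · rw [t4 y e (by rintro rfl; exact p4 hy) (by rintro rfl; exact p5 hy)]
          exact Or.inl hy.apply_right
      · by_cases e : y = b'
        · subst e
          rw [t3]
          exact Or.inl (SameCycle.refl f u).apply_right
        · have hyb : SameCycle f y b' := hy.symm.trans sab'
          have hlt : pos f y < pos f b' :=
            lt_of_le_of_ne g2 fun hh => e (pos_injOn hyb hh)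
          rw [t4 y (by rintro rfl; exact p4 hy.symm) (by rintro rfl; omega) e]
          have := pos_apply hyb hlt
          exact Or.inr ⟨hy.apply_right, by omega, by omega⟩
    · rintro (h | ⟨-, h, -⟩)
      · exact p4' h
      · omega
    · rintro (h | ⟨h, -, -⟩)
      · exact huu h
      · exact q4 h.symm
  · have hc2 : 2 * Fintype.card α < (F2.map (Equiv.prodComm α α).toEmbedding).card := by
      rw [Finset.card_map]; omega
    have memF : ∀ a b, (a, b) ∈ F2.map (Equiv.prodComm α α).toEmbedding →
        (b, a) ∈ F ∧ pos f a ≤ pos f b := by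
      intro a b h
      obtain ⟨⟨x, y⟩, hp, e⟩ := Finset.mem_map.mp h
      simp only [Equiv.coe_toEmbedding, Equiv.prodComm_apply, Prod.swap_prod_mk,
        Prod.mk.injEq] at e
      obtain ⟨rfl, rfl⟩ := e
      exact ⟨(Finset.mem_filter.mp hp).1, not_lt.mp (Finset.mem_filter.mp hp).2⟩
    have c1 : ∀ a a' b, (a, b) ∈ F2.map (Equiv.prodComm α α).toEmbedding →
        (a', b) ∈ F2.map (Equiv.prodComm α α).toEmbedding → pos f a = pos f a' → a = a' := by
      intro a a' b ha ha' e
      exact pos_injOn ((same _ (memF _ _ ha).1).symm.trans (same _ (memF _ _ ha').1)) e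
    have c2 : ∀ a b b', (a, b) ∈ F2.map (Equiv.prodComm α α).toEmbedding →
        (a, b') ∈ F2.map (Equiv.prodComm α α).toEmbedding → pos f b = pos f b' → b = b' := by
      intro a b b' ha ha' e
      exact pos_injOn ((same _ (memF _ _ ha).1).trans (same _ (memF _ _ ha').1).symm) e
    obtain ⟨a, b, a', b', m1, m2, m3, l1, l2⟩ := exists_crossing _ (pos f) c1 c2 hc2
    obtain ⟨f1, l3⟩ := memF _ _ m1
    obtain ⟨f2, -⟩ := memF _ _ m2
    obtain ⟨f3, -⟩ := memF _ _ m3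
    have sba := same _ f1
    have sba' := same _ f2
    obtain ⟨⟨-, -, -, p4, p5, p6⟩, ⟨-, -, -, q4, q5, -⟩⟩ := prop _ _ f2
    obtain ⟨t1, t2, t3, t4⟩ := three_switch_apply f (a := u) (b := b) (c := a')
      (by rintro rfl; exact p4 (SameCycle.refl _ _))
      (by rintro rfl; exact p5 (SameCycle.refl _ _)) p6
    refine key b a' b' a
      {y | SameCycle f b y ∧ pos f a' < pos f y ∧ pos f y ≤ pos f b} f2 f3
      (by rintro rfl; omega) (by rintro rfl; exact (prop _ _ f1).1.2.2.2.2.2 rfl)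
      (by rintro rfl; omega) (by rintro rfl; omega) ?_ ⟨sba, l1, l3⟩ ?_ ?_
    · rintro y ⟨hy, g1, g2⟩
      by_cases e : y = b
      · subst e
        rw [t2]
        have : pos f (f a') = pos f a' + 1 := pos_apply sba'.symm (lt_of_lt_of_le l1 l3)
        exact ⟨sba'.apply_right, by omega, by omega⟩
      · have hlt : pos f y < pos f b :=
          lt_of_le_of_ne g2 fun hh => e (pos_injOn hy.symm hh)
        rw [t4 y (by rintro rfl; exact p4 hy.symm) e (by rintro rfl; omega)]
        have := pos_apply hy.symm hlt
        exact ⟨hy.apply_right, by omega, by omega⟩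
    · rintro ⟨-, -, h⟩
      omega
    · rintro ⟨h, -, -⟩
      exact q4 h.symm


end Minimal

theorem sum_card_le_of_inter_le {ι β : Type*} [Fintype β] [DecidableEq β] [DecidableEq ι]
    (T : Finset ι) (S : ι → Finset β) (c : ℕ)
    (h : ∀ i ∈ T, ∀ j ∈ T, i ≠ j → (S i ∩ S j).card ≤ c) :
    ∑ i ∈ T, (S i).card ≤ Fintype.card β + T.card ^ 2 * c := by
  have e1 : ∑ i ∈ T, (S i).card = ∑ u : β, (T.filter fun i => u ∈ S i).card := by
    simp only [Finset.card_eq_sum_ones, Finset.sum_filter]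
    rw [Finset.sum_comm]
    refine Finset.sum_congr rfl fun i _ => ?_
    rw [← Finset.sum_filter]; simp
  have e2 : ∑ p ∈ T.offDiag, (S p.1 ∩ S p.2).card =
      ∑ u : β, (T.filter fun i => u ∈ S i).offDiag.card := by
    have : ∀ u, (T.filter fun i => u ∈ S i).offDiag =
        T.offDiag.filter (fun p => u ∈ S p.1 ∩ S p.2) := by
      intro u; ext p; simp only [Finset.mem_offDiag, Finset.mem_filter, Finset.mem_inter]; tauto
    simp only [this]
    simp only [Finset.card_eq_sum_ones, Finset.sum_filter]
    rw [Finset.sum_comm]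
    refine Finset.sum_congr rfl fun i _ => ?_
    rw [← Finset.sum_filter, Finset.filter_mem_eq_inter, Finset.univ_inter]
  have e3 : ∑ p ∈ T.offDiag, (S p.1 ∩ S p.2).card ≤ T.card ^ 2 * c := by
    calc _ ≤ ∑ p ∈ T.offDiag, c := Finset.sum_le_sum fun p hp => by
          rw [Finset.mem_offDiag] at hp; exact h _ hp.1 _ hp.2.1 hp.2.2
      _ ≤ _ := by
          rw [Finset.sum_const, smul_eq_mul, Finset.offDiag_card]
          exact Nat.mul_le_mul_right _ (by rw [sq]; omega)
  have e4 : ∑ u : β, (T.filter fun i => u ∈ S i).card ≤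
      ∑ u : β, (1 + (T.filter fun i => u ∈ S i).offDiag.card) := by
    refine Finset.sum_le_sum fun u _ => ?_
    rw [Finset.offDiag_card]
    generalize (T.filter fun i => u ∈ S i).card = k
    rcases k with _ | _ | k
    · simp
    · simp
    · have : (k + 1 + 1) * (k + 1 + 1) = (k + 1 + 1) + ((k + 1 + 1) * k + (k + 1 + 1)) := by ring
      omega
  rw [Finset.sum_add_distrib, ← e2] at e4
  simp only [Finset.sum_const, Finset.card_univ, smul_eq_mul, mul_one] at e4
  omega

section Factor
variable {α : Type*} [Fintype α] [DecidableEq α]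

theorem exists_factor {r : α → α → Prop} {s γ : ℝ} (hγ : 0 < γ)
    (hout : ∀ v, s ≤ (Finset.univ.filter fun w => r v w).card)
    (hin : ∀ v, s ≤ (Finset.univ.filter fun w => r w v).card)
    (hexp : ∀ A B : Finset α, s ≤ A.card → s ≤ B.card →
      γ * (Fintype.card α : ℝ) ^ 2 ≤ ((A ×ˢ B).filter fun p => r p.1 p.2).card) :
    ∃ f : Perm α, ∀ x, r x (f x) := by
  have hall : ∀ S : Finset α, S.card ≤ (Finset.univ.filter fun b => ∃ a ∈ S, r a b).card := by
    intro S
    by_contra! hlt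
    set NS := Finset.univ.filter fun b => ∃ a ∈ S, r a b with hNS
    have hne : S.Nonempty := Finset.card_pos.mp (by omega)
    obtain ⟨x, hx⟩ := hne
    have hNpos : (0 : ℝ) < Fintype.card α := by
      have : 0 < Fintype.card α := Fintype.card_pos_iff.mpr ⟨x⟩
      exact_mod_cast this
    have c1 : s ≤ S.card := by
      have : (Finset.univ.filter fun w => r x w).card ≤ NS.card :=
        Finset.card_le_card fun w hw => by
          simp only [hNS, Finset.mem_filter, Finset.mem_univ, true_and] at hw ⊢
          exact ⟨x, hx, hw⟩
      have h2 : ((Finset.univ.filter fun w => r x w).card : ℝ) ≤ S.card := by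
        exact_mod_cast this.trans hlt.le
      exact (hout x).trans h2
    have c2 : (NSᶜ.card : ℝ) < s := by
      by_contra! hc
      have := hexp S NSᶜ c1 hc
      rw [Finset.filter_false_of_mem] at this
      · have : 0 < γ * (Fintype.card α : ℝ) ^ 2 := by positivity
        simp at *
        linarith
      · rintro ⟨a, b⟩ hab hr
        rw [Finset.mem_product] at hab
        exact (Finset.mem_compl.mp hab.2) (by simp [hNS]; exact ⟨a, hab.1, hr⟩)
    obtain ⟨w, hw⟩ : ∃ w, w ∉ NS := by
      by_contra! hc
      have : NS = Finset.univ := by ext; simp [hc]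
      rw [this] at hlt
      exact absurd (Finset.card_le_univ S) (by rw [Finset.card_univ] at hlt; omega)
    have hd : Disjoint S (Finset.univ.filter fun v => r v w) := by
      rw [Finset.disjoint_left]
      intro v hv hv'
      exact hw (by simp only [hNS, Finset.mem_filter, Finset.mem_univ, true_and] at hv' ⊢
                   exact ⟨v, hv, hv'⟩)
    have h1 := Finset.card_le_univ (S ∪ Finset.univ.filter fun v => r v w)
    rw [Finset.card_union_of_disjoint hd] at h1
    have h2 := Finset.card_compl_add_card NS
    have h3 := hin w
    have h4 : (S.card : ℝ) + (Finset.univ.filter fun v => r v w).card ≤ Fintype.card α := by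
      exact_mod_cast h1
    have h5 : (NSᶜ.card : ℝ) + NS.card = Fintype.card α := by exact_mod_cast h2
    have h6 : (NS.card : ℝ) < S.card := by exact_mod_cast hlt
    linarith
  obtain ⟨f, hf, hr⟩ := (Fintype.all_card_le_filter_rel_iff_exists_injective r).mp hall
  exact ⟨Equiv.ofBijective f (Finite.injective_iff_bijective.mp hf), hr⟩

theorem card_switchPairs_ge {r : α → α → Prop} {s γ : ℝ} {f : Perm α}
    (hout : ∀ v, s ≤ (Finset.univ.filter fun w => r v w).card)
    (hin : ∀ v, s ≤ (Finset.univ.filter fun w => r w v).card)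
    (hexp : ∀ A B : Finset α, s ≤ A.card → s ≤ B.card →
      γ * (Fintype.card α : ℝ) ^ 2 ≤ ((A ×ˢ B).filter fun p => r p.1 p.2).card) (u : α) :
    γ * (Fintype.card α : ℝ) ^ 2 - 2 * (Finset.univ.filter fun x => SameCycle f u x).card *
      Fintype.card α - Fintype.card α ≤ (switchPairs r f u).card := by
  set C := Finset.univ.filter fun x => SameCycle f u x
  set A := Finset.univ.filter fun v => r u (f v)
  set B := Finset.univ.filter fun w => r (f.symm w) (f u)
  have hA : s ≤ A.card := by
    refine (hout u).trans_eq ?_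
    have : A.map f.toEmbedding = Finset.univ.filter fun w => r u w := by
      ext w; simp [A, Finset.mem_map_equiv]
    rw [← this, Finset.card_map]
  have hB : s ≤ B.card := by
    refine (hin (f u)).trans_eq ?_
    have : (Finset.univ.filter fun w => r w (f u)).map f.toEmbedding = B := by
      ext w; simp [B, Finset.mem_map_equiv]
    rw [← this, Finset.card_map]
  have h1 := hexp A B hA hB
  set E := (A ×ˢ B).filter fun p => r p.1 p.2
  have h2 : E.card ≤ (switchPairs r f u ∪ C ×ˢ Finset.univ ∪ Finset.univ ×ˢ C ∪
      Finset.univ.image fun x => (x, x)).card := by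
    refine Finset.card_le_card_of_injOn (fun p => (p.1, f.symm p.2)) ?_ ?_
    · rintro ⟨v, w⟩ h
      simp only [E, A, B, Finset.coe_filter, Finset.mem_product, Finset.mem_filter,
        Finset.mem_univ, true_and, Set.mem_ofPred_eq] at h
      simp only [switchPairs, C, Finset.coe_union, Set.mem_union, Finset.mem_coe,
        Finset.mem_filter, Finset.mem_product, Finset.mem_univ, true_and, and_true,
        Finset.mem_image, Prod.mk.injEq, Equiv.apply_symm_apply]
      by_cases e : v = f.symm w
      · exact Or.inr ⟨v, rfl, e⟩
      · have : v ≠ f.symm w := e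
        tauto
    · rintro ⟨v, w⟩ _ ⟨v', w'⟩ _ e
      simp only [Prod.mk.injEq, EmbeddingLike.apply_eq_iff_eq] at e
      rw [e.1, e.2]
  have h3 : E.card ≤ (switchPairs r f u).card + C.card * Fintype.card α +
      Fintype.card α * C.card + Fintype.card α := by
    refine h2.trans ((Finset.card_union_le _ _).trans (Nat.add_le_add
      ((Finset.card_union_le _ _).trans (Nat.add_le_add ((Finset.card_union_le _ _).trans
        (Nat.add_le_add le_rfl ?_)) ?_)) ?_))
    · rw [Finset.card_product, Finset.card_univ]
    · rw [Finset.card_product, Finset.card_univ]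
    · exact Finset.card_image_le
  have h4 : (E.card : ℝ) ≤ (switchPairs r f u).card + C.card * Fintype.card α +
      Fintype.card α * C.card + Fintype.card α := by exact_mod_cast h3
  linarith

end Factor

theorem exists_factor_few_cycles {γ : ℝ} (hγ : 0 < γ) :
    ∃ K N₀ : ℕ, ∀ (α : Type) [Fintype α] [DecidableEq α] (r : α → α → Prop) (s : ℝ),
      N₀ ≤ Fintype.card α →
      (∀ v, s ≤ (Finset.univ.filter fun w => r v w).card) →
      (∀ v, s ≤ (Finset.univ.filter fun w => r w v).card) →
      (∀ A B : Finset α, s ≤ A.card → s ≤ B.card →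
        γ * (Fintype.card α : ℝ) ^ 2 ≤ ((A ×ˢ B).filter fun p => r p.1 p.2).card) →
      ∃ f : Perm α, (∀ x, r x (f x)) ∧ numCycles f ≤ K := by
  obtain ⟨M, hM⟩ := exists_nat_ge (4 / γ)
  obtain ⟨L, hL⟩ := exists_nat_ge (8 / γ)
  obtain ⟨N₁, hN₁⟩ := exists_nat_ge (4 / γ)
  refine ⟨M + L, N₁ + 4 * M ^ 2 + 1, fun α _ _ r s hN hout hin hexp => ?_⟩
  obtain ⟨f₀, hf₀⟩ := exists_factor hγ hout hin hexp
  obtain ⟨f, hf, hmin⟩ : ∃ f : Perm α, (∀ x, r x (f x)) ∧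
      ∀ g : Perm α, (∀ x, r x (g x)) → numCycles f ≤ numCycles g := by
    obtain ⟨f, hf, hm⟩ := Finset.exists_min_image
      (Finset.univ.filter fun f : Perm α => ∀ x, r x (f x)) numCycles ⟨f₀, by simpa using hf₀⟩
    exact ⟨f, by simpa using hf, fun g hg => hm g (by simpa using hg)⟩
  refine ⟨f, hf, ?_⟩
  by_contra! hlt
  set N := Fintype.card α with hNdef
  have hNR : (N₁ : ℝ) + 4 * M ^ 2 + 1 ≤ N := by exact_mod_cast hN
  have hN0 : (0 : ℝ) < N := by
    have : (0 : ℝ) ≤ N₁ := Nat.cast_nonneg _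
    nlinarith [sq_nonneg (M : ℝ)]
  let Q := Quotient (SameCycle.setoid f)
  let sz : Q → ℕ := fun q => (Finset.univ.filter fun x : α => (Quotient.mk _ x : Q) = q).card
  have hsum : ∑ q : Q, sz q = N := by
    have := Finset.card_eq_sum_card_fiberwise (f := fun x : α => (Quotient.mk _ x : Q))
      (s := Finset.univ) (t := Finset.univ) (fun _ _ => Finset.mem_coe.2 (Finset.mem_univ _))
    rw [hNdef, ← Finset.card_univ, this]
  let short := Finset.univ.filter fun q : Q => (sz q : ℝ) ≤ γ * N / 8
  let long := Finset.univ.filter fun q : Q => ¬ (sz q : ℝ) ≤ γ * N / 8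
  have hsl : short.card + long.card = numCycles f := by
    rw [Finset.card_filter_add_card_filter_not, Finset.card_univ, numCycles, Nat.card_eq_fintype_card]
  have hlong : long.card ≤ L := by
    have h1 : (long.card : ℝ) * (γ * N / 8) ≤ N := by
      rw [← nsmul_eq_mul, ← Finset.sum_const]
      calc ∑ q ∈ long, (γ * N / 8) ≤ ∑ q ∈ long, (sz q : ℝ) :=
            Finset.sum_le_sum fun q hq => (not_le.mp (Finset.mem_filter.mp hq).2).le
        _ ≤ ∑ q : Q, (sz q : ℝ) :=
            Finset.sum_le_sum_of_subset_of_nonneg (Finset.subset_univ _) fun _ _ _ =>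
              Nat.cast_nonneg _
        _ = N := by exact_mod_cast hsum
    have h2 : (long.card : ℝ) ≤ 8 / γ := by
      rw [le_div_iff₀ hγ]
      have : (long.card : ℝ) * γ * N ≤ 8 * N := by linarith
      exact le_of_mul_le_mul_right this hN0
    exact_mod_cast h2.trans hL
  obtain ⟨T, hTs, hTc⟩ := Finset.exists_subset_card_eq (show M ≤ short.card by omega)
  have hinter := sum_card_le_of_inter_le T (fun q : Q => switchPairs r f q.out) (4 * N) ?_
  · have hbig : ∀ q ∈ T, γ / 2 * (N : ℝ) ^ 2 ≤ (switchPairs r f q.out).card := by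
      intro q hq
      have h1 := card_switchPairs_ge (f := f) hout hin hexp q.out
      have h2 : (sz q : ℝ) ≤ γ * N / 8 := (Finset.mem_filter.mp (hTs hq)).2
      have h3 : (Finset.univ.filter fun x => SameCycle f q.out x).card = sz q := by
        congr 1
        ext x
        simp only [Finset.mem_filter, Finset.mem_univ, true_and]
        constructor
        · intro h
          exact (Quotient.sound (s := SameCycle.setoid f) h.symm).trans (Quotient.out_eq q)
        · intro h
          subst h
          exact Quotient.exact (Quotient.out_eq (Quotient.mk (SameCycle.setoid f) x))
      rw [h3, ← hNdef] at h1
      have h4 : 4 / γ ≤ N := by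
        have := sq_nonneg (M : ℝ)
        linarith
      rw [div_le_iff₀ hγ] at h4
      nlinarith
    have h1 : (M : ℝ) * (γ / 2 * (N : ℝ) ^ 2) ≤ ∑ q ∈ T, ((switchPairs r f q.out).card : ℝ) := by
      rw [← hTc, ← nsmul_eq_mul, ← Finset.sum_const]
      exact Finset.sum_le_sum hbig
    have h2 : ∑ q ∈ T, ((switchPairs r f q.out).card : ℝ) ≤ (N : ℝ) ^ 2 + M ^ 2 * (4 * N) := by
      rw [hTc, Fintype.card_prod, ← hNdef, ← sq] at hinter
      exact_mod_cast hinter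
    rw [div_le_iff₀ hγ] at hM
    have h3 : 4 * (N : ℝ) ^ 2 ≤ M * γ * (N : ℝ) ^ 2 :=
      mul_le_mul_of_nonneg_right hM (sq_nonneg _)
    have h4 : (N : ℝ) ^ 2 ≤ M ^ 2 * (4 * N) := by linarith
    have h5 : (N : ℝ) * N ≤ (4 * M ^ 2) * N := by linarith
    have h6 := le_of_mul_le_mul_right h5 hN0
    have : (0 : ℝ) ≤ N₁ := Nat.cast_nonneg _
    linarith
  · intro q hq q' hq' hne
    refine card_switchPairs_inter_le hf hmin fun hs => hne ?_
    rw [← Quotient.out_eq q, ← Quotient.out_eq q']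
    exact Quotient.sound (s := SameCycle.setoid f) hs

section Absorb
variable {α : Type} [Fintype α] [DecidableEq α]

/-- `ρ` is a cyclic permutation of `S` all of whose edges, except the one leaving `e`, are edges
of `r`: a directed path on `S` ending at `e` and starting at `ρ e`. -/
def IsPath (r : α → α → Prop) (ρ : Perm α) (S : Finset α) (e : α) : Prop :=
  e ∈ S ∧ (∀ v ∉ S, ρ v = v) ∧ (∀ v ∈ S, SameCycle ρ e v) ∧ ∀ v ∈ S, v ≠ e → r v (ρ v)

theorem IsPath.prepend {r : α → α → Prop} {ρ : Perm α} {S : Finset α} {e y : α}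
    (h : IsPath r ρ S e) (hy : y ∉ S) (hr : r y (ρ e)) :
    ∃ ρ' : Perm α, IsPath r ρ' (insert y S) e ∧ ρ' e = y ∧ ρ' y = ρ e ∧
      ∀ v ∈ S, v ≠ e → ρ' v = ρ v := by
  obtain ⟨he, hfix, hsame, hedge⟩ := h
  have hye : y ≠ e := by rintro rfl; exact hy he
  have hρy := hfix y hy
  have h1 : (ρ * swap e y) e = y := by simp [hρy]
  have h2 : (ρ * swap e y) y = ρ e := by simp
  have h3 : ∀ v, v ≠ e → v ≠ y → (ρ * swap e y) v = ρ v := by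
    intro v a b; rw [Perm.mul_apply, swap_apply_of_ne_of_ne a b]
  have hns : ¬ SameCycle ρ e y := by
    intro hs
    exact hye ((hs.symm.eq_of_left hρy).symm ▸ rfl)
  refine ⟨ρ * swap e y, ⟨Finset.mem_insert_of_mem he, ?_, ?_, ?_⟩, h1, h2, ?_⟩
  · intro v hv
    rw [Finset.mem_insert, not_or] at hv
    rw [h3 v (by rintro rfl; exact hv.2 he) hv.1, hfix v hv.2]
  · intro v hv
    rcases Finset.mem_insert.mp hv with rfl | hv
    · exact sameCycle_mul_swap hns
    · exact SameCycle.merge hns (hsame v hv)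
  · intro v hv hve
    rcases Finset.mem_insert.mp hv with rfl | hvS
    · rw [h2]; exact hr
    · rw [h3 v hve (by rintro rfl; exact hy hvS)]; exact hedge v hvS hve
  · intro v hv hve
    exact h3 v hve (by rintro rfl; exact hy hv)

/-- The number of edges `y → ρ y` with `y ∈ Ab` into which a path from `p.1` to `p.2` can be
inserted. -/
noncomputable def hits (r : α → α → Prop) (ρ : Perm α) (Ab : Finset α) (p : α × α) : ℕ :=
  (Ab.filter fun y => r y p.1 ∧ r p.2 (ρ y)).card

noncomputable def potential (r : α → α → Prop) (ρ : Perm α) (Ab : Finset α) : ℝ :=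
  ∑ p : α × α, (1 / 2 : ℝ) ^ hits r ρ Ab p

theorem exists_path_step {r : α → α → Prop} (hirr : ∀ v, ¬ r v v) {γ s : ℝ} (hγ : 0 < γ)
    {ρ : Perm α} {S Ab : Finset α} {e : α} (h : IsPath r ρ S e) (hAb : Ab ⊆ S.erase e)
    (hout : ∀ v, s + (S.card + 2) ≤ (Finset.univ.filter fun w => r v w).card)
    (hin : ∀ v, s + (S.card + 2) ≤ (Finset.univ.filter fun w => r w v).card)
    (hexp : ∀ A B : Finset α, s ≤ A.card → s ≤ B.card →
      2 * γ * (Fintype.card α : ℝ) ^ 2 ≤ ((A ×ˢ B).filter fun p => r p.1 p.2).card) :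
    ∃ (ρ' : Perm α) (S' Ab' : Finset α), IsPath r ρ' S' e ∧ Ab' ⊆ S'.erase e ∧
      S'.card = S.card + 4 ∧ potential r ρ' Ab' ≤ (1 - γ) * potential r ρ Ab := by
  have hN : 0 < Fintype.card α := Fintype.card_pos_iff.mpr ⟨e⟩
  have hNR : (0 : ℝ) < Fintype.card α := by exact_mod_cast hN
  set Φ := potential r ρ Ab with hΦ
  have hΦ0 : 0 < Φ := Finset.sum_pos (fun p _ => by positivity) ⟨(e, e), Finset.mem_univ _⟩
  have hdiff : ∀ (T U : Finset α), s + (S.card + 2) ≤ (T.card : ℝ) → U.card ≤ S.card + 2 →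
      s ≤ (T \ U).card := by
    intro T U hT hU
    have h1 := Finset.le_card_sdiff U T
    have h2 : (T.card : ℝ) ≤ (T \ U).card + U.card := by exact_mod_cast (by omega)
    have h3 : (U.card : ℝ) ≤ S.card + 2 := by exact_mod_cast hU
    linarith
  let good : α × α → Prop := fun q => r q.1 q.2 ∧ q.1 ∉ S ∧ q.2 ∉ S
  let F : α × α → ℝ := fun q => ∑ p : α × α, if good q ∧ r q.1 p.1 ∧ r p.2 q.2 then
    (1 / 2 : ℝ) ^ hits r ρ Ab p else 0
  have hF : ∑ q : α × α, 2 * γ * Φ ≤ ∑ q : α × α, F q := by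
    rw [Finset.sum_comm, Finset.sum_const, Finset.card_univ, Fintype.card_prod, nsmul_eq_mul, hΦ,
      potential, Finset.mul_sum, Finset.mul_sum]
    refine Finset.sum_le_sum fun p _ => ?_
    rw [← Finset.sum_filter, Finset.sum_const, nsmul_eq_mul]
    have hA := hdiff (Finset.univ.filter fun w => r w p.1) S (hin p.1) (by omega)
    have hB := hdiff (Finset.univ.filter fun w => r p.2 w) S (hout p.2) (by omega)
    have h1 := hexp _ _ hA hB
    have h2 : (((Finset.univ.filter fun w => r w p.1) \ S) ×ˢ
        ((Finset.univ.filter fun w => r p.2 w) \ S)).filter (fun q => r q.1 q.2) =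
        Finset.univ.filter fun q : α × α => good q ∧ r q.1 p.1 ∧ r p.2 q.2 := by
      ext q
      simp only [good, Finset.mem_filter, Finset.mem_product, Finset.mem_sdiff, Finset.mem_univ,
        true_and]
      tauto
    rw [h2] at h1
    have h3 : (0 : ℝ) < (1 / 2) ^ hits r ρ Ab p := by positivity
    push_cast
    nlinarith
  obtain ⟨⟨y, y'⟩, -, hq⟩ := Finset.exists_le_of_sum_le ⟨(e, e), Finset.mem_univ _⟩ hF
  have hgood : good (y, y') := by
    by_contra hc
    have : F (y, y') = 0 := by simp [F, hc]
    rw [this] at hq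
    have : 0 < 2 * γ * Φ := by positivity
    linarith
  obtain ⟨hyy, hyS, hy'S⟩ := hgood
  set U := insert y (insert y' S) with hU
  have hUc : U.card ≤ S.card + 2 :=
    (Finset.card_insert_le _ _).trans (Nat.succ_le_succ (Finset.card_insert_le _ _))
  have h1 := hexp _ _ (hdiff (Finset.univ.filter fun w => r y' w) U (hout y') hUc)
    (hdiff (Finset.univ.filter fun w => r w (ρ e)) U (hin (ρ e)) hUc)
  have h2 : 0 < 2 * γ * (Fintype.card α : ℝ) ^ 2 := by positivity
  obtain ⟨⟨a, b⟩, hab⟩ := Finset.card_pos.mp (show 0 < Finset.card _ by exact_mod_cast h2.trans_le h1)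
  simp only [hU, Finset.mem_filter, Finset.mem_product, Finset.mem_sdiff, Finset.mem_univ, true_and,
    Finset.mem_insert, not_or] at hab
  obtain ⟨⟨⟨ya, ha1, ha2, ha3⟩, ⟨bs, hb1, hb2, hb3⟩⟩, rab⟩ := hab
  have hne : a ≠ b := by rintro rfl; exact hirr _ rab
  have hyy' : y ≠ y' := by rintro rfl; exact hirr _ hyy
  have he := h.1
  obtain ⟨ρ1, p1, i1, -, k1⟩ := h.prepend hb3 bs
  obtain ⟨ρ2, p2, i2, -, k2⟩ := p1.prepend (y := a) (by simp [hne, ha3]) (by rw [i1]; exact rab)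
  obtain ⟨ρ3, p3, i3, -, k3⟩ := p2.prepend (y := y') (by simp [Ne.symm ha2, Ne.symm hb2, hy'S])
    (by rw [i2]; exact ya)
  have hy4 : y ∉ insert y' (insert a (insert b S)) := by simp [Ne.symm ha1, Ne.symm hb1, hyS, hyy']
  obtain ⟨ρ4, p4, i4, j4, k4⟩ := p3.prepend (y := y) hy4 (by rw [i3]; exact hyy)
  have hk : ∀ v ∈ S, v ≠ e → ρ4 v = ρ v := by
    intro v hv hve
    rw [k4 v (by simp [hv]) hve, k3 v (by simp [hv]) hve, k2 v (by simp [hv]) hve, k1 v hv hve]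
  have hyAb : y ∉ Ab := fun hc => hyS (Finset.mem_of_mem_erase (hAb hc))
  refine ⟨ρ4, _, insert y Ab, p4, ?_, ?_, ?_⟩
  · intro v hv
    rcases Finset.mem_insert.mp hv with rfl | hv
    · exact Finset.mem_erase.mpr ⟨by rintro rfl; exact hyS he, Finset.mem_insert_self _ _⟩
    · have := Finset.mem_erase.mp (hAb hv)
      exact Finset.mem_erase.mpr ⟨this.1, by simp [this.2]⟩
  · rw [Finset.card_insert_of_notMem hy4, Finset.card_insert_of_notMem
      (by simp [Ne.symm ha2, Ne.symm hb2, hy'S]), Finset.card_insert_of_notMem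
      (by simp [hne, ha3]), Finset.card_insert_of_notMem hb3]
  · have hhits : ∀ p, hits r ρ4 (insert y Ab) p =
        hits r ρ Ab p + if r y p.1 ∧ r p.2 y' then 1 else 0 := by
      intro p
      have e1 : Ab.filter (fun y => r y p.1 ∧ r p.2 (ρ4 y)) =
          Ab.filter (fun y => r y p.1 ∧ r p.2 (ρ y)) := by
        refine Finset.filter_congr fun v hv => ?_
        have := Finset.mem_erase.mp (hAb hv)
        rw [hk v this.2 this.1]
      unfold hits
      rw [Finset.filter_insert, j4, i3, e1]
      split_ifs with hc
      · rw [Finset.card_insert_of_notMem (by simp [hyAb])]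
      · rfl
    have hpot : potential r ρ4 (insert y Ab) = Φ - 1 / 2 * F (y, y') := by
      rw [hΦ, potential, potential]
      simp only [F]
      rw [Finset.mul_sum, ← Finset.sum_sub_distrib]
      refine Finset.sum_congr rfl fun p _ => ?_
      have hg : good (y, y') := ⟨hyy, hyS, hy'S⟩
      simp only [hhits, hg, true_and]
      split_ifs
      · rw [pow_succ]; ring
      · simp
    rw [hpot]
    nlinarith

theorem exists_path {r : α → α → Prop} (hirr : ∀ v, ¬ r v v) {γ s t : ℝ} (hγ : 0 < γ) (hγ1 : γ ≤ 1)
    (e : α)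
    (hout : ∀ v, s + t ≤ (Finset.univ.filter fun w => r v w).card)
    (hin : ∀ v, s + t ≤ (Finset.univ.filter fun w => r w v).card)
    (hexp : ∀ A B : Finset α, s ≤ A.card → s ≤ B.card →
      2 * γ * (Fintype.card α : ℝ) ^ 2 ≤ ((A ×ˢ B).filter fun p => r p.1 p.2).card) (m : ℕ)
    (hm : 4 * (m : ℝ) + 1 ≤ t) :
    ∃ (ρ : Perm α) (S Ab : Finset α), IsPath r ρ S e ∧ Ab ⊆ S.erase e ∧
      S.card = 4 * m + 1 ∧ potential r ρ Ab ≤ (1 - γ) ^ m * (Fintype.card α : ℝ) ^ 2 := by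
  induction m with
  | zero =>
    refine ⟨1, {e}, ∅, ⟨by simp, by simp, by simp, by simp⟩, by simp, by simp, ?_⟩
    have h0 : ∀ p, hits r 1 ∅ p = 0 := fun p => Finset.card_eq_zero.mpr (Finset.filter_empty _)
    simp [potential, h0, sq]
  | succ m ih =>
    push_cast at hm
    obtain ⟨ρ, S, Ab, h1, h2, h3, h4⟩ := ih (by linarith)
    have hS : (S.card : ℝ) + 2 ≤ t := by rw [h3]; push_cast; linarith
    obtain ⟨ρ', S', Ab', g1, g2, g3, g4⟩ := exists_path_step hirr hγ h1 h2
      (fun v => le_trans (by linarith) (hout v)) (fun v => le_trans (by linarith) (hin v)) hexp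
    refine ⟨ρ', S', Ab', g1, g2, by omega, g4.trans ?_⟩
    rw [pow_succ', mul_assoc]
    exact mul_le_mul_of_nonneg_left h4 (by linarith)

theorem hits_ge_of_potential_lt {r : α → α → Prop} {ρ : Perm α} {Ab : Finset α} {K : ℕ}
    (h : potential r ρ Ab ≤ (1 / 2) ^ K) (p : α × α) : K ≤ hits r ρ Ab p := by
  by_contra! hc
  have h1 : (1 / 2 : ℝ) ^ hits r ρ Ab p ≤ potential r ρ Ab :=
    Finset.single_le_sum (f := fun p => (1 / 2 : ℝ) ^ hits r ρ Ab p)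
      (fun p _ => by positivity) (Finset.mem_univ p)
  have h2 : (1 / 2 : ℝ) ^ K < (1 / 2) ^ hits r ρ Ab p :=
    pow_lt_pow_right_of_lt_one₀ (by norm_num) (by norm_num) hc
  linarith

theorem exists_single_cycle_of_hits {r : α → α → Prop} (c : α) (k : ℕ) :
    ∀ (f : Perm α) (Ab : Finset α), numCycles f ≤ k + 1 → (∀ v, r v (f v)) →
      (∀ y ∈ Ab, SameCycle f c y) → (∀ p, k ≤ hits r f Ab p) →
      ∃ g : Perm α, (∀ x y, SameCycle g x y) ∧ ∀ v, r v (g v) := by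
  induction k with
  | zero => exact fun f Ab h1 h2 _ _ => ⟨f, numCycles_le_one_iff.mp h1, h2⟩
  | succ k ih =>
    intro f Ab h1 h2 h3 h4
    by_cases hall : ∀ t, SameCycle f c t
    · exact ⟨f, fun x y => (hall x).symm.trans (hall y), h2⟩
    push Not at hall
    obtain ⟨t, ht⟩ := hall
    obtain ⟨y, hy⟩ := Finset.card_pos.mp (lt_of_lt_of_le (Nat.succ_pos k) (h4 (f t, t)))
    obtain ⟨hyAb, hy1, hy2⟩ := Finset.mem_filter.mp hy
    have hyt : ¬ SameCycle f y t := fun h => ht ((h3 y hyAb).trans h)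
    have hlt := numCycles_mul_swap_lt hyt
    have hz : ∀ z ∈ Ab.erase y, (f * swap y t) z = f z := by
      intro z hz
      obtain ⟨z1, z2⟩ := Finset.mem_erase.mp hz
      rw [Perm.mul_apply, swap_apply_of_ne_of_ne z1 (by rintro rfl; exact ht (h3 _ z2))]
    refine ih (f * swap y t) (Ab.erase y) (by omega) ?_ ?_ ?_
    · intro v
      by_cases c1 : v = y
      · subst c1; simpa using hy1
      by_cases c2 : v = t
      · subst c2; simpa using hy2
      rw [Perm.mul_apply, swap_apply_of_ne_of_ne c1 c2]; exact h2 v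
    · intro z hz'
      exact SameCycle.merge hyt (h3 z (Finset.mem_of_mem_erase hz'))
    · intro p
      have := h4 p
      unfold hits at this ⊢
      have e1 : (Ab.erase y).filter (fun z => r z p.1 ∧ r p.2 ((f * swap y t) z)) =
          (Ab.filter fun z => r z p.1 ∧ r p.2 (f z)).erase y := by
        ext z
        simp only [Finset.mem_filter, Finset.mem_erase]
        constructor
        · rintro ⟨hz', h⟩
          rw [hz z (Finset.mem_erase.mpr hz')] at h
          exact ⟨hz'.1, hz'.2, h⟩
        · rintro ⟨h0, h1, h⟩
          rw [hz z (Finset.mem_erase.mpr ⟨h0, h1⟩)]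
          exact ⟨⟨h0, h1⟩, h⟩
      rw [e1]
      have := Finset.pred_card_le_card_erase (s := Ab.filter fun z => r z p.1 ∧ r p.2 (f z)) (a := y)
      omega

end Absorb

section Lift
variable {α : Type} [Fintype α] [DecidableEq α]

theorem IsPath.lift {r : α → α → Prop} {ρ : Perm α} {S : Finset α} {e : α} (h : IsPath r ρ S e)
    (π : Perm {v // v ∉ S ∨ v = e}) (hπ : ∀ u : {v // v ∉ S ∨ v = e}, r u (ρ (π u))) :
    (∀ v, r v ((ρ * ofSubtype π) v)) ∧ (∀ v ∈ S, v ≠ e → (ρ * ofSubtype π) v = ρ v) ∧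
    (∀ v ∈ S, SameCycle (ρ * ofSubtype π) e v) ∧ numCycles (ρ * ofSubtype π) ≤ numCycles π := by
  obtain ⟨he, hfix, hsame, hedge⟩ := h
  set g := ρ * ofSubtype π with hg
  have h1 : ∀ v ∈ S, v ≠ e → g v = ρ v := by
    intro v hv hve
    rw [hg, Perm.mul_apply, ofSubtype_apply_of_not_mem]
    rintro (h | h)
    · exact h hv
    · exact hve h
  have h2 : ∀ u : {v // v ∉ S ∨ v = e}, g u = ρ (π u) := by
    intro u
    rw [hg, Perm.mul_apply, ofSubtype_apply_coe]
  have h3 : ∀ v ∈ S, SameCycle g (ρ e) v := by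
    have key : ∀ k : ℕ, SameCycle g (ρ e) ((ρ ^ (k + 1)) e) := by
      intro k
      induction k with
      | zero => simp; exact SameCycle.refl _ _
      | succ k ih =>
        by_cases hk : (ρ ^ (k + 1)) e = e
        · rw [pow_succ', Perm.mul_apply, hk]
        · have hS : (ρ ^ (k + 1)) e ∈ S := by
            by_contra hn
            have hs : SameCycle ρ e ((ρ ^ (k + 1)) e) := ⟨(k + 1 : ℕ), by rw [zpow_natCast]⟩
            exact hk (hs.symm.eq_of_left (hfix _ hn))
          rw [pow_succ', Perm.mul_apply, ← h1 _ hS hk]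
          exact ih.apply_right
    intro v hv
    obtain ⟨i, hi, -, hi2⟩ := (hsame v hv).exists_pow_eq''
    have := key (i - 1)
    rwa [Nat.sub_add_cancel hi, hi2] at this
  have h4 : ∀ v ∈ S, SameCycle g e v := fun v hv => (h3 e he).symm.trans (h3 v hv)
  refine ⟨?_, h1, h4, ?_⟩
  · intro v
    by_cases hv : v ∉ S ∨ v = e
    · rw [h2 ⟨v, hv⟩]; exact hπ ⟨v, hv⟩
    · push Not at hv
      rw [h1 v hv.1 hv.2]; exact hedge v hv.1 hv.2
  · have hstep : ∀ u : {v // v ∉ S ∨ v = e}, SameCycle g (u : α) (π u) := by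
      intro u
      have hu : SameCycle g (u : α) (ρ (π u)) := by
        rw [← h2]; exact (SameCycle.refl g _).apply_right
      rcases (π u).2 with hn | hn
      · rwa [hfix _ hn] at hu
      · rw [hn] at hu ⊢
        exact hu.trans (h3 e he)
    have hcomp : ∀ u w : {v // v ∉ S ∨ v = e}, SameCycle π u w → SameCycle g (u : α) w := by
      intro u w huw
      exact sameCycle_induction (p := fun w : {v // v ∉ S ∨ v = e} => SameCycle g (u : α) w) huw (SameCycle.refl _ _)
        fun z hz => hz.trans (hstep z)
    refine Nat.card_le_card_of_surjective
      (Quotient.map' (s₁ := SameCycle.setoid π) (s₂ := SameCycle.setoid g) Subtype.val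
        (fun x y => hcomp x y)) ?_
    intro q
    induction q using Quotient.inductionOn with
    | h x =>
      by_cases hx : x ∈ S
      · exact ⟨Quotient.mk _ ⟨e, Or.inr rfl⟩, Quotient.sound (s := SameCycle.setoid g) (h4 x hx)⟩
      · exact ⟨Quotient.mk _ ⟨x, Or.inl hx⟩, rfl⟩

theorem exists_factor_compl {r : α → α → Prop} (ρ : Perm α) {S : Finset α} (e : α) {γ : ℝ} (hγ : 0 < γ) {s : ℝ} {K N₀ : ℕ}
    (hK : ∀ (β : Type) [Fintype β] [DecidableEq β] (r : β → β → Prop) (s : ℝ),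
      N₀ ≤ Fintype.card β →
      (∀ v, s ≤ (Finset.univ.filter fun w => r v w).card) →
      (∀ v, s ≤ (Finset.univ.filter fun w => r w v).card) →
      (∀ A B : Finset β, s ≤ A.card → s ≤ B.card →
        γ * (Fintype.card β : ℝ) ^ 2 ≤ ((A ×ˢ B).filter fun p => r p.1 p.2).card) →
      ∃ f : Perm β, (∀ x, r x (f x)) ∧ numCycles f ≤ K)
    (hout : ∀ v, s + S.card ≤ (Finset.univ.filter fun w => r v w).card)
    (hin : ∀ v, s + S.card ≤ (Finset.univ.filter fun w => r w v).card)
    (hexp : ∀ A B : Finset α, s ≤ A.card → s ≤ B.card →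
      2 * γ * (Fintype.card α : ℝ) ^ 2 ≤ ((A ×ˢ B).filter fun p => r p.1 p.2).card)
    (hN : N₀ + S.card ≤ Fintype.card α) :
    ∃ π : Perm {v // v ∉ S ∨ v = e}, (∀ u : {v // v ∉ S ∨ v = e}, r u (ρ (π u))) ∧ numCycles π ≤ K := by
  have hcard : ∀ T : Finset α, (T.card : ℝ) - S.card ≤
      (Finset.univ.filter fun u : {v // v ∉ S ∨ v = e} => (u : α) ∈ T).card := by
    intro T
    have h1 := Finset.le_card_sdiff S T
    have h2 : (T \ S).card ≤
        (Finset.univ.filter fun u : {v // v ∉ S ∨ v = e} => (u : α) ∈ T).card := by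
      rw [← Finset.card_map (Function.Embedding.subtype _)]
      refine Finset.card_le_card fun v hv => ?_
      rw [Finset.mem_sdiff] at hv
      exact Finset.mem_map.mpr ⟨⟨v, Or.inl hv.2⟩, by simpa using hv.1, rfl⟩
    have h3 : (T.card : ℝ) ≤ S.card +
      (Finset.univ.filter fun u : {v // v ∉ S ∨ v = e} => (u : α) ∈ T).card := by
      exact_mod_cast (by omega)
    linarith
  refine hK {v // v ∉ S ∨ v = e} (fun u v => r u (ρ v)) s ?_ ?_ ?_ ?_
  · have := hcard Finset.univ
    simp only [Finset.mem_univ, Finset.filter_true, Finset.card_univ] at this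
    have h2 : (Fintype.card α : ℝ) ≤ S.card + Fintype.card {v // v ∉ S ∨ v = e} := by linarith
    have h3 : Fintype.card α ≤ S.card + Fintype.card {v // v ∉ S ∨ v = e} := by exact_mod_cast h2
    omega
  · intro u
    have h1 := hcard (Finset.univ.filter fun w => r u (ρ w))
    have h2 : (Finset.univ.filter fun w => r u (ρ w)).card =
        (Finset.univ.filter fun w => r u w).card := by
      have : (Finset.univ.filter fun w => r u (ρ w)).map ρ.toEmbedding =
          Finset.univ.filter fun w => r u w := by
        ext w; simp [Finset.mem_map_equiv]
      rw [← this, Finset.card_map]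
    simp only [Finset.mem_filter, Finset.mem_univ, true_and] at h1
    have := hout u
    rw [h2] at h1
    linarith
  · intro u
    have h1 := hcard (Finset.univ.filter fun w => r w (ρ u))
    simp only [Finset.mem_filter, Finset.mem_univ, true_and] at h1
    have := hin (ρ u)
    linarith
  · intro A B hA hB
    have h1 := hexp (A.map (Function.Embedding.subtype _))
      ((B.map (Function.Embedding.subtype _)).map ρ.toEmbedding) (by rwa [Finset.card_map])
      (by rwa [Finset.card_map, Finset.card_map])
    have h2 : (Fintype.card {v // v ∉ S ∨ v = e} : ℝ) ≤ Fintype.card α := by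
      exact_mod_cast Fintype.card_subtype_le _
    have h3 : (((A.map (Function.Embedding.subtype _)) ×ˢ
        ((B.map (Function.Embedding.subtype _)).map ρ.toEmbedding)).filter
        fun p => r p.1 p.2).card ≤ ((A ×ˢ B).filter fun p => r p.1 (ρ p.2)).card := by
      refine Finset.card_le_card_of_surjOn
        (fun p : {v // v ∉ S ∨ v = e} × {v // v ∉ S ∨ v = e} => ((p.1 : α), ρ p.2)) ?_
      rintro ⟨a, b⟩ hab
      simp only [Finset.coe_filter, Finset.mem_product, Set.mem_ofPred_eq, Finset.mem_map,
        Function.Embedding.subtype_apply, Equiv.coe_toEmbedding] at hab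
      obtain ⟨⟨⟨a', ha', rfl⟩, ⟨c, ⟨b', hb', rfl⟩, rfl⟩⟩, hr⟩ := hab
      exact ⟨(a', b'), by simp [ha', hb', hr], rfl⟩
    have h4 : (Fintype.card {v // v ∉ S ∨ v = e} : ℝ) ^ 2 ≤ (Fintype.card α : ℝ) ^ 2 :=
      pow_le_pow_left₀ (Nat.cast_nonneg _) h2 2
    have h5 : ((((A.map (Function.Embedding.subtype _)) ×ˢ
        ((B.map (Function.Embedding.subtype _)).map ρ.toEmbedding)).filter
        fun p => r p.1 p.2).card : ℝ) ≤ ((A ×ˢ B).filter fun p => r p.1 (ρ p.2)).card := by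
      exact_mod_cast h3
    have h6 : 0 ≤ γ * (Fintype.card α : ℝ) ^ 2 := by positivity
    nlinarith

end Lift

theorem exists_hamilton_of_expanding {γ ε : ℝ} (hγ : 0 < γ) (hγ1 : γ < 1) (hε : 0 < ε)
    (hε1 : ε < 1) :
    ∃ n₀ : ℕ, ∀ (α : Type) [Fintype α] [DecidableEq α] (r : α → α → Prop) (s : ℝ),
      n₀ ≤ Fintype.card α → (∀ v, ¬ r v v) →
      (∀ v, s + ε * Fintype.card α ≤ (Finset.univ.filter fun w => r v w).card) →
      (∀ v, s + ε * Fintype.card α ≤ (Finset.univ.filter fun w => r w v).card) →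
      (∀ A B : Finset α, s ≤ A.card → s ≤ B.card →
        2 * γ * (Fintype.card α : ℝ) ^ 2 ≤ ((A ×ˢ B).filter fun p => r p.1 p.2).card) →
      ∃ π : Perm α, (∀ x y, SameCycle π x y) ∧ ∀ v, r v (π v) := by
  obtain ⟨K, N₀, hK⟩ := exists_factor_few_cycles hγ
  have hlim := tendsto_pow_const_mul_const_pow_of_abs_lt_one 2
    (r := 1 - γ) (by rw [abs_lt]; constructor <;> linarith)
  have hev := hlim.eventually (ge_mem_nhds (show (0 : ℝ) < (1 / 2) ^ K * ε ^ 2 / 256 by positivity))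
  obtain ⟨M, hM⟩ := Filter.eventually_atTop.mp hev
  obtain ⟨n₁, hn₁⟩ := exists_nat_ge ((8 * M + 16) / ε + N₀ / (1 - ε))
  refine ⟨n₁, fun α _ _ r s hN hirr hout hin hexp => ?_⟩
  have hNR : (8 * M + 16) / ε + N₀ / (1 - ε) ≤ (Fintype.card α : ℝ) :=
    hn₁.trans (by exact_mod_cast hN)
  set N := (Fintype.card α : ℝ) with hNd
  have hε2 : 0 < 1 - ε := by linarith
  have q1 : 0 ≤ (N₀ : ℝ) / (1 - ε) := by positivity
  have q2 : 0 ≤ (8 * (M : ℝ) + 16) / ε := by positivity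
  have hN1 : 8 * (M : ℝ) + 16 ≤ ε * N := by
    have : (8 * (M : ℝ) + 16) / ε ≤ N := by linarith
    rw [div_le_iff₀ hε] at this; linarith
  have hN2 : (N₀ : ℝ) ≤ (1 - ε) * N := by
    have : (N₀ : ℝ) / (1 - ε) ≤ N := by linarith
    rw [div_le_iff₀ hε2] at this; linarith
  have hNpos : 0 < N := by
    have : (0 : ℝ) < 16 / ε := by positivity
    have h2 : (0 : ℝ) ≤ 8 * M / ε := by positivity
    rw [add_div] at hNR
    linarith
  obtain ⟨e⟩ : Nonempty α := by
    rw [← Fintype.card_pos_iff]; rw [hNd] at hNpos; exact_mod_cast hNpos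
  set m := ⌊ε * N / 8⌋₊ with hm
  have hm1 : (m : ℝ) ≤ ε * N / 8 := Nat.floor_le (by positivity)
  have hm2 : ε * N / 8 < m + 1 := Nat.lt_floor_add_one _
  have hMm : M ≤ m := Nat.le_floor (by linarith)
  have hm3 : (1 : ℝ) ≤ m := by
    have : (0 : ℝ) ≤ M := Nat.cast_nonneg _
    linarith
  obtain ⟨ρ, S, Ab, hP, hAb, hS, hpot⟩ := exists_path hirr hγ hγ1.le e hout hin hexp m
    (by have : (0 : ℝ) ≤ M := Nat.cast_nonneg _
        linarith)
  have hSR : (S.card : ℝ) ≤ ε * N := by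
    rw [hS]; push_cast
    have : (0 : ℝ) ≤ M := Nat.cast_nonneg _
    linarith
  obtain ⟨π, hπ, hπK⟩ := exists_factor_compl ρ e hγ hK (fun v => le_trans (by linarith) (hout v))
    (fun v => le_trans (by linarith) (hin v)) hexp
    (by have : (N₀ : ℝ) + S.card ≤ Fintype.card α := by linarith
        exact_mod_cast this)
  obtain ⟨l1, l2, l3, l4⟩ := hP.lift π hπ
  have hhits : ∀ p, K ≤ hits r ρ Ab p := by
    refine hits_ge_of_potential_lt (hpot.trans ?_)
    have h1 := hM m hMm
    have h2 : N ≤ 16 * m / ε := by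
      rw [le_div_iff₀ hε]; linarith
    have h3 : N ^ 2 ≤ (16 * m / ε) ^ 2 := pow_le_pow_left₀ hNpos.le h2 2
    have h4 : (0 : ℝ) ≤ (1 - γ) ^ m := pow_nonneg (by linarith) _
    calc (1 - γ) ^ m * N ^ 2 ≤ (1 - γ) ^ m * (16 * m / ε) ^ 2 := mul_le_mul_of_nonneg_left h3 h4
      _ = 256 / ε ^ 2 * ((m : ℝ) ^ 2 * (1 - γ) ^ m) := by field_simp; ring
      _ ≤ 256 / ε ^ 2 * ((1 / 2) ^ K * ε ^ 2 / 256) :=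
          mul_le_mul_of_nonneg_left h1 (by positivity)
      _ = (1 / 2) ^ K := by field_simp
  refine exists_single_cycle_of_hits e K (ρ * ofSubtype π) Ab (by omega) l1 ?_ ?_
  · intro y hy
    exact l3 y (Finset.mem_of_mem_erase (hAb hy))
  · intro p
    refine (hhits p).trans_eq ?_
    unfold hits
    congr 1
    refine Finset.filter_congr fun y hy => ?_
    have := Finset.mem_erase.mp (hAb hy)
    rw [l2 y this.2 this.1]

section Concentration

theorem sum_exp_perm_le (n : ℕ) : ∀ (a : Fin n → Fin n → ℝ), (∀ v w, 0 ≤ a v w ∧ a v w ≤ 1) →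
    ∀ t : ℝ, |t| ≤ 1 / 3 →
    ∑ ψ : Perm (Fin n), Real.exp (t * ∑ v, a v (ψ v)) ≤
      n.factorial * Real.exp (t * ((∑ v, ∑ w, a v w) / n) + 9 * t ^ 2 * n) := by
  induction n with
  | zero => intro a _ t _; simp
  | succ n ih =>
    intro a ha t ht
    set S := ∑ v, ∑ w, a v w with hS
    set R := ∑ w, a 0 w with hR
    let C : Fin (n + 1) → ℝ := fun p => ∑ v, a v p
    let s' : Fin (n + 1) → ℝ := fun p => S - R - C p + a 0 p
    have hSC : ∑ p, C p = S := Finset.sum_comm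
    have hs' : ∀ p, ∑ x : Fin n, ∑ y : Fin n, a x.succ (swap 0 p y.succ) = s' p := by
      intro p
      have h1 : ∀ v, ∑ y : Fin n, a v (swap 0 p y.succ) = ∑ w, a v w - a v p := by
        intro v
        rw [← Equiv.sum_comp (swap 0 p) (fun w => a v w), Fin.sum_univ_succ]
        simp
      simp only [h1, Finset.sum_sub_distrib, s', C]
      rw [hS, Fin.sum_univ_succ, Fin.sum_univ_succ (f := fun v => a v p), hR]
      ring
    let Δ : Fin (n + 1) → ℝ := fun p => a 0 p + s' p / n - S / (n + 1 : ℕ)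
    have hΔ : ∀ p, |t * Δ p| ≤ 1 ∧ Δ p ^ 2 ≤ 9 := by
      intro p
      suffices h : |Δ p| ≤ 3 by
        constructor
        · rw [abs_mul]; nlinarith [abs_nonneg t, abs_nonneg (Δ p)]
        · rw [abs_le] at h; nlinarith
      have hR1 : 0 ≤ R ∧ R ≤ n + 1 := by
        refine ⟨Finset.sum_nonneg fun w _ => (ha 0 w).1, ?_⟩
        refine (Finset.sum_le_sum fun w _ => (ha 0 w).2).trans ?_
        simp
      have hC1 : 0 ≤ C p ∧ C p ≤ n + 1 := by
        refine ⟨Finset.sum_nonneg fun w _ => (ha w p).1, ?_⟩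
        refine (Finset.sum_le_sum fun w _ => (ha w p).2).trans ?_
        simp
      have hCa : a 0 p ≤ C p :=
        Finset.single_le_sum (f := fun v => a v p) (fun v _ => (ha v p).1) (Finset.mem_univ 0)
      have hS1 : 0 ≤ S ∧ S ≤ (n + 1) * (n + 1) := by
        refine ⟨Finset.sum_nonneg fun w _ => Finset.sum_nonneg fun x _ => (ha w x).1, ?_⟩
        refine (Finset.sum_le_sum fun w _ => Finset.sum_le_sum fun x _ => (ha w x).2).trans ?_
        simp
        exact le_of_eq (by ring)
      obtain ⟨a0, a1⟩ := ha 0 p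
      rcases Nat.eq_zero_or_pos n with rfl | hn
      · have : Δ p = a 0 p - S := by simp [Δ]
        rw [this, abs_le]
        norm_num at hS1
        constructor <;> linarith
      · have hnR : (1 : ℝ) ≤ n := by exact_mod_cast hn
        have e : Δ p = a 0 p + S / (n * (n + 1)) - (R + C p - a 0 p) / n := by
          simp only [Δ, s']; push_cast; field_simp; ring
        have b1 : 0 ≤ S / (n * (n + 1)) := by
          have := hS1.1; positivity
        have b2 : S / (n * (n + 1)) ≤ 2 := by
          rw [div_le_iff₀ (by positivity)]; nlinarith
        have b3 : 0 ≤ (R + C p - a 0 p) / n := div_nonneg (by linarith) (by linarith)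
        have b4 : (R + C p - a 0 p) / n ≤ a 0 p + 3 := by
          rw [div_le_iff₀ (by linarith)]
          -- the corner entry is counted once
          have hCR : R + C p - a 0 p ≤ 2 * n + 1 := by
            have e1 : C p = a 0 p + ∑ v : Fin n, a v.succ p := Fin.sum_univ_succ _
            have e2 : ∑ v : Fin n, a v.succ p ≤ n := by
              refine (Finset.sum_le_sum fun w _ => (ha _ p).2).trans ?_
              simp
            linarith [hR1.2]
          nlinarith
        rw [e, abs_le]
        constructor <;> linarith
    have hΔ0 : ∑ p, Δ p = 0 := by
      rcases Nat.eq_zero_or_pos n with rfl | hn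
      · simp [Δ, hS]
      · have hnR : (n : ℝ) ≠ 0 := by positivity
        simp only [Δ, s', Finset.sum_sub_distrib, Finset.sum_add_distrib, ← Finset.sum_div, hSC,
          ← hR, Finset.sum_const, Finset.card_univ, Fintype.card_fin, nsmul_eq_mul]
        push_cast
        field_simp
        ring
    have hsum : ∑ p, Real.exp (t * Δ p) ≤ (n + 1) * Real.exp (9 * t ^ 2) := by
      have h1 : ∀ p, Real.exp (t * Δ p) ≤ 1 + t * Δ p + 9 * t ^ 2 := by
        intro p
        have h2 := Real.abs_exp_sub_one_sub_id_le (hΔ p).1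
        rw [abs_le] at h2
        nlinarith [h2.2, (hΔ p).2, sq_nonneg t]
      calc ∑ p, Real.exp (t * Δ p) ≤ ∑ p, (1 + t * Δ p + 9 * t ^ 2) :=
            Finset.sum_le_sum fun p _ => h1 p
        _ = (n + 1) * (9 * t ^ 2 + 1) := by
            rw [Finset.sum_add_distrib, Finset.sum_add_distrib, ← Finset.mul_sum, hΔ0]
            simp; ring
        _ ≤ _ := mul_le_mul_of_nonneg_left (Real.add_one_le_exp _) (by positivity)
    calc ∑ ψ : Perm (Fin (n + 1)), Real.exp (t * ∑ v, a v (ψ v))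
        = ∑ p : Fin (n + 1), ∑ e : Perm (Fin n),
            Real.exp (t * ∑ v, a v (decomposeFin.symm (p, e) v)) := by
          rw [← Equiv.sum_comp decomposeFin.symm, Fintype.sum_prod_type]
      _ = ∑ p : Fin (n + 1), Real.exp (t * a 0 p) * ∑ e : Perm (Fin n),
            Real.exp (t * ∑ x : Fin n, a x.succ (swap 0 p (e x).succ)) := by
          refine Finset.sum_congr rfl fun p _ => ?_
          rw [Finset.mul_sum]
          refine Finset.sum_congr rfl fun e _ => ?_
          rw [← Real.exp_add, Fin.sum_univ_succ, mul_add]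
          simp
      _ ≤ ∑ p : Fin (n + 1), Real.exp (t * a 0 p) *
            (n.factorial * Real.exp (t * (s' p / n) + 9 * t ^ 2 * n)) := by
          refine Finset.sum_le_sum fun p _ => mul_le_mul_of_nonneg_left ?_ (Real.exp_pos _).le
          have := ih (fun x y => a x.succ (swap 0 p y.succ)) (fun v w => ha _ _) t ht
          rwa [hs' p] at this
      _ = n.factorial * Real.exp (t * (S / (n + 1 : ℕ)) + 9 * t ^ 2 * n) *
            ∑ p, Real.exp (t * Δ p) := by
          rw [Finset.mul_sum]
          refine Finset.sum_congr rfl fun p _ => ?_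
          rw [mul_left_comm, ← Real.exp_add, mul_assoc (n.factorial : ℝ), ← Real.exp_add]
          congr 2
          simp only [Δ]
          ring
      _ ≤ n.factorial * Real.exp (t * (S / (n + 1 : ℕ)) + 9 * t ^ 2 * n) *
            ((n + 1) * Real.exp (9 * t ^ 2)) :=
          mul_le_mul_of_nonneg_left hsum (by positivity)
      _ = _ := by
          rw [Nat.factorial_succ]
          push_cast
          rw [mul_mul_mul_comm, ← Real.exp_add, mul_comm (n.factorial : ℝ)]
          congr 2
          ring

/-- For few `[0, 1]`-matrices, some permutation makes no transversal sum much larger than its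
average. -/
theorem exists_perm_sum_le {n : ℕ} (hn : 0 < n) {J : Type} [Fintype J]
    (a : J → Fin n → Fin n → ℝ) (ha : ∀ j v w, 0 ≤ a j v w ∧ a j v w ≤ 1) {δ : ℝ} (hδ : 0 < δ)
    (hδ1 : δ ≤ 1) (hJ : (Fintype.card J : ℝ) * Real.exp (-(δ ^ 2 / 36 * n)) < 1) :
    ∃ ψ : Perm (Fin n), ∀ j, ∑ v, a j v (ψ v) ≤ (∑ v, ∑ w, a j v w) / n + δ * n := by
  by_contra! hc
  have hfac : (0 : ℝ) < n.factorial := by exact_mod_cast n.factorial_pos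
  set t := δ / 18 with ht
  have ht0 : 0 < t := by positivity
  have h1 : (n.factorial : ℝ) ≤ ∑ ψ : Perm (Fin n), ∑ j,
      Real.exp (t * ∑ v, a j v (ψ v)) * Real.exp (-(t * ((∑ v, ∑ w, a j v w) / n + δ * n))) := by
    have : (n.factorial : ℝ) = ∑ ψ : Perm (Fin n), 1 := by
      simp [Fintype.card_perm]
    rw [this]
    refine Finset.sum_le_sum fun ψ _ => ?_
    obtain ⟨j, hj⟩ := hc ψ
    refine le_trans ?_ (Finset.single_le_sum (f := fun j => Real.exp (t * ∑ v, a j v (ψ v)) *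
      Real.exp (-(t * ((∑ v, ∑ w, a j v w) / n + δ * n)))) (fun j _ => by positivity)
      (Finset.mem_univ j))
    rw [← Real.exp_add]
    refine Real.one_le_exp ?_
    nlinarith
  rw [Finset.sum_comm] at h1
  have h2 : ∀ j, ∑ ψ : Perm (Fin n), Real.exp (t * ∑ v, a j v (ψ v)) *
      Real.exp (-(t * ((∑ v, ∑ w, a j v w) / n + δ * n))) ≤
      n.factorial * Real.exp (-(δ ^ 2 / 36 * n)) := by
    intro j
    rw [← Finset.sum_mul]
    refine (mul_le_mul_of_nonneg_right (sum_exp_perm_le n (a j) (ha j) t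
      (by rw [abs_of_pos ht0]; linarith)) (Real.exp_pos _).le).trans_eq ?_
    rw [mul_assoc, ← Real.exp_add]
    congr 2
    rw [ht]; ring
  have h3 := h1.trans (Finset.sum_le_sum fun j _ => h2 j)
  rw [Finset.sum_const, Finset.card_univ, nsmul_eq_mul] at h3
  nlinarith

end Concentration

section Dichotomy

/-- A transversal directed Hamilton cycle, as a cyclic permutation `π` with colour `ψ v` used on
the edge leaving `v`. -/
def HasTHC {n : ℕ} (D : Fin n → Fin n → Fin n → Prop) : Prop :=
  ∃ π ψ : Perm (Fin n), (∀ x y, SameCycle π x y) ∧ ∀ v, D (ψ v) v (π v)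

/-- A collection of loopless digraphs with minimum semi-degree at least `n / 2`. -/
structure DegHyp {n : ℕ} (D : Fin n → Fin n → Fin n → Prop) : Prop where
  loopless : ∀ i v, ¬ D i v v
  out : ∀ i v, (n : ℝ) / 2 ≤ (Finset.univ.filter fun w => D i v w).card
  inn : ∀ i v, (n : ℝ) / 2 ≤ (Finset.univ.filter fun w => D i w v).card

theorem DegHyp.reverse {n : ℕ} {D : Fin n → Fin n → Fin n → Prop} (h : DegHyp D) :
    DegHyp fun i v w => D i w v :=
  ⟨h.loopless, h.inn, h.out⟩

theorem HasTHC.of_reverse {n : ℕ} {D : Fin n → Fin n → Fin n → Prop}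
    (h : HasTHC fun i v w => D i w v) : HasTHC D := by
  obtain ⟨π, ψ, hc, hD⟩ := h
  refine ⟨π⁻¹, π⁻¹.trans ψ, fun x y => (hc x y).inv, fun v => ?_⟩
  simpa using hD (π⁻¹ v)

theorem eventually_mul_exp_lt {c : ℝ} (hc : 0 < c) :
    ∃ n₀ : ℕ, ∀ n : ℕ, n₀ ≤ n → ((n + n * n : ℕ) : ℝ) * Real.exp (-(c * n)) < 1 := by
  have h1 := (Real.tendsto_pow_mul_exp_neg_atTop_nhds_zero 2).comp
    (tendsto_natCast_atTop_atTop.const_mul_atTop hc)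
  have h2 := (h1.eventually (gt_mem_nhds (show (0 : ℝ) < c ^ 2 / 2 by positivity)))
  obtain ⟨n₀, h⟩ := Filter.eventually_atTop.1 h2
  refine ⟨max n₀ 1, fun n hn => ?_⟩
  have h3 := h n (le_of_max_le_left hn)
  have hn1 : (1 : ℝ) ≤ n := by exact_mod_cast le_of_max_le_right hn
  simp only [Function.comp] at h3
  have he := Real.exp_pos (-(c * n))
  have h4 : (n : ℝ) ^ 2 * Real.exp (-(c * n)) < 1 / 2 := by
    have h5 : c ^ 2 * ((n : ℝ) ^ 2 * Real.exp (-(c * n))) < c ^ 2 * (1 / 2) := by linarith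
    exact lt_of_mul_lt_mul_left h5 (by positivity)
  push_cast
  have : ((n : ℝ) + n * n) * Real.exp (-(c * n)) ≤ 2 * ((n : ℝ) ^ 2 * Real.exp (-(c * n))) := by
    rw [← mul_assoc]
    exact mul_le_mul_of_nonneg_right (by nlinarith) he.le
  linarith

theorem card_filter_prod_eq_sum {α β : Type*} [Fintype α] [Fintype β] (p : α → β → Prop) :
    (((Finset.univ : Finset (α × β)).filter fun x => p x.1 x.2).card : ℝ) =
      ∑ a, ∑ b, if p a b then (1 : ℝ) else 0 := by
  rw [← Fintype.sum_prod_type', Finset.sum_boole]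

/-- Either there is a transversal Hamilton cycle, or almost half of all pairs of a tail and a
colour send almost nothing to a common set of almost `n / 2` vertices. -/
theorem hasTHC_or_sparse {ε : ℝ} (hε : 0 < ε) (hε1 : ε < 1) :
    ∃ n₀ : ℕ, ∀ n : ℕ, n₀ ≤ n → ∀ D : Fin n → Fin n → Fin n → Prop, DegHyp D → HasTHC D ∨
      ∃ B : Finset (Fin n), (1 / 2 - ε) * n ≤ B.card ∧ (B.card : ℝ) ≤ n / 2 ∧
        (1 / 2 - ε) * (n : ℝ) ^ 2 ≤ ((Finset.univ : Finset (Fin n × Fin n)).filter fun x =>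
          ((B.filter fun w => D x.2 x.1 w).card : ℝ) ≤ ε * n).card := by
  obtain ⟨n₁, h₁⟩ := exists_hamilton_of_expanding (γ := ε ^ 2 / 40) (ε := ε / 10) (by positivity)
    (by nlinarith) (by positivity) (by linarith)
  obtain ⟨n₂, h₂⟩ := eventually_mul_exp_lt (c := (ε / 10) ^ 2 / 36) (by positivity)
  refine ⟨max (max n₁ n₂) 1, fun n hn D hD => ?_⟩
  have hn1 : n₁ ≤ n := by omega
  have hn2 : n₂ ≤ n := by omega
  have hn0 : 0 < n := by omega
  have hnR : (0 : ℝ) < n := by exact_mod_cast hn0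
  by_contra! hcon
  obtain ⟨hno, hB⟩ := hcon
  set low : Finset (Fin n) → Fin n → Fin n → Prop := fun B v i =>
    ((B.filter fun w => D i v w).card : ℝ) ≤ ε * n with hlow
  set cN : Fin n × Fin n → Finset (Fin n) := fun x => Finset.univ.filter fun w => ¬ D x.2 x.1 w
    with hcN
  set a : Fin n ⊕ (Fin n × Fin n) → Fin n → Fin n → ℝ := fun j v i =>
    Sum.elim (fun w => if D i v w then (0 : ℝ) else 1)
      (fun x => if (1 / 2 - ε) * n ≤ (cN x).card ∧ low (cN x) v i then 1 else 0) j with ha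
  obtain ⟨ψ, hψ⟩ := exists_perm_sum_le hn0 a (δ := ε / 10)
    (by
      rintro (w | x) v i <;> simp only [ha, Sum.elim_inl, Sum.elim_inr] <;> split_ifs <;> norm_num)
    (by positivity) (by linarith) (by simpa using h₂ n hn2)
  have hcNle : ∀ x, ((cN x).card : ℝ) ≤ n / 2 := by
    intro x
    have h1 := hD.out x.2 x.1
    have h2 : ((Finset.univ.filter fun w => D x.2 x.1 w).card : ℝ) + (cN x).card = n := by
      have := Finset.card_filter_add_card_filter_not (s := Finset.univ) (fun w => D x.2 x.1 w)
      rw [Finset.card_univ, Fintype.card_fin] at this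
      exact_mod_cast this
    linarith
  have hin : ∀ w, (n : ℝ) / 2 - ε / 10 * n ≤ (Finset.univ.filter fun v => D (ψ v) v w).card := by
    intro w
    have h1 := hψ (Sum.inl w)
    simp only [ha, Sum.elim_inl] at h1
    have h2 : ∑ v, ∑ i, (if D i v w then (0 : ℝ) else 1) ≤ n * (n / 2) := by
      rw [Finset.sum_comm]
      have : ∀ i, ∑ v, (if D i v w then (0 : ℝ) else 1) ≤ n / 2 := by
        intro i
        have h3 := hD.inn i w
        have h4 : ∑ v, (if D i v w then (0 : ℝ) else 1) + ∑ v, (if D i v w then (1 : ℝ) else 0)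
            = n := by
          rw [← Finset.sum_add_distrib, Finset.sum_congr rfl (g := fun _ => (1 : ℝ))]
          · simp
          · intro v _
            split_ifs <;> norm_num
        rw [Finset.sum_boole] at h4
        linarith
      refine (Finset.sum_le_sum fun i _ => this i).trans ?_
      simp
    have h3 : (∑ v, ∑ i, (if D i v w then (0 : ℝ) else 1)) / n ≤ n / 2 := by
      rw [div_le_iff₀ hnR]; linarith
    have h4 : ∑ v, (if D (ψ v) v w then (0 : ℝ) else 1) + ∑ v, (if D (ψ v) v w then (1 : ℝ) else 0)
        = n := by
      rw [← Finset.sum_add_distrib, Finset.sum_congr rfl (g := fun _ => (1 : ℝ))]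
      · simp
      · intro v _
        split_ifs <;> norm_num
    rw [Finset.sum_boole] at h4
    linarith
  have hlowψ : ∀ x, (1 / 2 - ε) * n ≤ (cN x).card →
      ((Finset.univ.filter fun v => low (cN x) v (ψ v)).card : ℝ) ≤ (1 / 2 - ε) * n + ε / 10 * n := by
    intro x hx
    have h1 := hψ (Sum.inr x)
    simp only [ha, Sum.elim_inr, hx, true_and] at h1
    rw [Finset.sum_boole, ← card_filter_prod_eq_sum] at h1
    have h2 := hB (cN x) hx (hcNle x)
    refine h1.trans (add_le_add_left ?_ _)
    rw [div_le_iff₀ hnR]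
    calc _ ≤ (1 / 2 - ε) * (n : ℝ) ^ 2 := h2.le
      _ = _ := by ring
  refine hno ?_
  obtain ⟨π, hπ, hπD⟩ := h₁ (Fin n) (fun v w => D (ψ v) v w) (n / 2 - ε / 5 * n) (by simpa using hn1)
    (fun v => hD.loopless _ v)
    (fun v => by
      have := hD.out (ψ v) v
      rw [Fintype.card_fin]
      nlinarith)
    (fun v => by
      have := hin v
      rw [Fintype.card_fin]
      nlinarith)
    (by
      intro A B hA hBc
      rw [Fintype.card_fin]
      by_contra! hlt
      have hsum : (((A ×ˢ B).filter fun p => D (ψ p.1) p.1 p.2).card : ℝ) =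
          ∑ v ∈ A, ((B.filter fun w => D (ψ v) v w).card : ℝ) := by
        rw [← Finset.sum_boole, Finset.sum_product]
        exact Finset.sum_congr rfl fun v _ => by rw [Finset.sum_boole]
      set A' := A.filter fun v => ((B.filter fun w => D (ψ v) v w).card : ℝ) ≤ ε / 4 * n with hA'
      have hAA : ((A.filter fun v => ¬ ((B.filter fun w => D (ψ v) v w).card : ℝ) ≤ ε / 4 * n).card
          : ℝ) * (ε / 4 * n) ≤ ε / 5 * n * (ε / 4 * n) := by
        calc _ ≤ ∑ v ∈ A.filter fun v => ¬ ((B.filter fun w => D (ψ v) v w).card : ℝ) ≤ ε / 4 * n,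
              ((B.filter fun w => D (ψ v) v w).card : ℝ) := by
              rw [← nsmul_eq_mul]
              refine Finset.card_nsmul_le_sum _ _ _ fun v hv => ?_
              exact (not_le.1 (Finset.mem_filter.1 hv).2).le
          _ ≤ ∑ v ∈ A, ((B.filter fun w => D (ψ v) v w).card : ℝ) :=
              Finset.sum_le_sum_of_subset_of_nonneg (Finset.filter_subset _ _)
                fun _ _ _ => by positivity
          _ ≤ _ := by rw [← hsum]; refine hlt.le.trans (le_of_eq (by ring))
      have hAA' := le_of_mul_le_mul_right hAA (by positivity)
      have hAcard : (A'.card : ℝ) + ((A.filter fun v => ¬ ((B.filter fun w => D (ψ v) v w).card : ℝ)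
          ≤ ε / 4 * n).card : ℝ) = A.card := by
        exact_mod_cast Finset.card_filter_add_card_filter_not _
      have hεn : 0 < ε * n := by positivity
      have hA'pos : 0 < (A'.card : ℝ) := by nlinarith
      obtain ⟨v₀, hv₀⟩ := Finset.card_pos.1 (by exact_mod_cast hA'pos)
      set B₀ := cN (v₀, ψ v₀) with hB₀
      have hv₀' := (Finset.mem_filter.1 hv₀).2
      have hBB : ((B.filter fun w => D (ψ v₀) v₀ w).card : ℝ) + (B ∩ B₀).card = B.card := by
        have := Finset.card_filter_add_card_filter_not (s := B) (fun w => D (ψ v₀) v₀ w)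
        have e : B ∩ B₀ = B.filter fun w => ¬ D (ψ v₀) v₀ w := by
          ext w; simp [hB₀, hcN]
        rw [e]
        exact_mod_cast this
      have hB₀B : ((B₀ \ B).card : ℝ) + (B ∩ B₀).card = B₀.card := by
        rw [Finset.inter_comm]
        exact_mod_cast Finset.card_sdiff_add_card_inter _ _
      have hB₀le := hcNle (v₀, ψ v₀)
      have hB₀ge : (1 / 2 - ε) * n ≤ B₀.card := by
        have : 0 ≤ ((B₀ \ B).card : ℝ) := by positivity
        nlinarith
      have h3 := hlowψ _ hB₀ge
      have h4 : (A'.card : ℝ) ≤ (Finset.univ.filter fun v => low B₀ v (ψ v)).card := by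
        norm_cast
        refine Finset.card_le_card fun v hv => ?_
        rw [Finset.mem_filter]
        refine ⟨Finset.mem_univ _, ?_⟩
        have hv' := (Finset.mem_filter.1 hv).2
        have h5 : ((B₀.filter fun w => D (ψ v) v w).card : ℝ) ≤
            (B.filter fun w => D (ψ v) v w).card + (B₀ \ B).card := by
          norm_cast
          refine le_trans (Finset.card_le_card ?_) (Finset.card_union_le _ _)
          intro w hw
          simp only [Finset.mem_filter, Finset.mem_union, Finset.mem_sdiff] at hw ⊢
          tauto
        simp only [hlow]
        nlinarith
      nlinarith)
  exact ⟨π, ψ, hπ, hπD⟩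

end Dichotomy

section ColourType
variable {α β : Type} [Fintype α] [DecidableEq α] [Fintype β] [DecidableEq β]

/-- Number of related pairs between two finite sets. -/
noncomputable def cnt (r : α → β → Prop) (P : Finset α) (Q : Finset β) : ℝ :=
  (((P ×ˢ Q).filter fun p => r p.1 p.2).card : ℝ)

theorem cnt_nonneg (r : α → β → Prop) (P : Finset α) (Q : Finset β) : 0 ≤ cnt r P Q := by
  unfold cnt; positivity

theorem cnt_mono {r : α → β → Prop} {P P' : Finset α} {Q Q' : Finset β} (hP : P ⊆ P')
    (hQ : Q ⊆ Q') : cnt r P Q ≤ cnt r P' Q' := by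
  unfold cnt
  exact_mod_cast Finset.card_le_card
    (Finset.filter_subset_filter _ (Finset.product_subset_product hP hQ))

theorem cnt_add_cnt_not (r : α → β → Prop) (P : Finset α) (Q : Finset β) :
    cnt r P Q + cnt (fun v w => ¬ r v w) P Q = P.card * Q.card := by
  unfold cnt
  rw [← Nat.cast_add, Finset.card_filter_add_card_filter_not, Finset.card_product]
  push_cast; rfl

theorem cnt_eq_sum (r : α → β → Prop) (P : Finset α) (Q : Finset β) :
    cnt r P Q = ∑ v ∈ P, ((Q.filter fun w => r v w).card : ℝ) := by
  unfold cnt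
  rw [← Finset.sum_boole, Finset.sum_product]
  exact Finset.sum_congr rfl fun v _ => by rw [Finset.sum_boole]

theorem cnt_swap (r : α → β → Prop) (P : Finset α) (Q : Finset β) :
    cnt (fun w v => r v w) Q P = cnt r P Q := by
  rw [cnt_eq_sum]
  unfold cnt
  rw [← Finset.sum_boole, Finset.sum_product_right]
  exact Finset.sum_congr rfl fun v _ => by rw [Finset.sum_boole]

theorem cnt_le_card_mul {r : α → β → Prop} {P : Finset α} {Q : Finset β} {c : ℝ}
    (h : ∀ v ∈ P, ((Q.filter fun w => r v w).card : ℝ) ≤ c) : cnt r P Q ≤ P.card * c := by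
  rw [cnt_eq_sum, ← nsmul_eq_mul]
  exact Finset.sum_le_card_nsmul _ _ _ h

theorem card_mul_le_cnt {r : α → β → Prop} {P : Finset α} {Q : Finset β} {c : ℝ}
    (h : ∀ v ∈ P, c ≤ ((Q.filter fun w => r v w).card : ℝ)) : P.card * c ≤ cnt r P Q := by
  rw [cnt_eq_sum, ← nsmul_eq_mul]
  exact Finset.card_nsmul_le_sum _ _ _ h

theorem cnt_union_le (r : α → β → Prop) (P P' : Finset α) (Q : Finset β) :
    cnt r (P ∪ P') Q ≤ cnt r P Q + cnt r P' Q := by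
  unfold cnt
  norm_cast
  rw [Finset.union_product, Finset.filter_union]
  exact Finset.card_union_le _ _

theorem cnt_le_card_mul_card (r : α → β → Prop) (P : Finset α) (Q : Finset β) :
    cnt r P Q ≤ P.card * Q.card := by
  linarith [cnt_add_cnt_not r P Q, cnt_nonneg (fun v w => ¬ r v w) P Q]

theorem card_add_card_compl_real (P : Finset α) :
    (P.card : ℝ) + (Pᶜ.card : ℝ) = Fintype.card α := by
  exact_mod_cast Finset.card_add_card_compl P

theorem card_le_real (P : Finset α) : (P.card : ℝ) ≤ Fintype.card α := by
  exact_mod_cast Finset.card_le_univ P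

section Low
variable {r : α → α → Prop} {θ n : ℝ} {B X : Finset α}

theorem cnt_low_le (hn : n = Fintype.card α) (hθ : 0 ≤ θ)
    (hX : ∀ v ∈ X, ((B.filter fun w => r v w).card : ℝ) ≤ θ * n) :
    cnt r X B ≤ θ * n ^ 2 := by
  have h1 := cnt_le_card_mul hX
  have h2 := card_le_real X
  have h3 : 0 ≤ n := by rw [hn]; positivity
  have h4 : (X.card : ℝ) * (θ * n) ≤ n * (θ * n) :=
    mul_le_mul_of_nonneg_right (by linarith) (by positivity)
  linarith

theorem cnt_not_low_compl_le (hn : n = Fintype.card α) (hθ : 0 ≤ θ)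
    (hout : ∀ v, n / 2 ≤ (Finset.univ.filter fun w => r v w).card)
    (hB : (1 / 2 - θ) * n ≤ B.card)
    (hX : ∀ v ∈ X, ((B.filter fun w => r v w).card : ℝ) ≤ θ * n) :
    cnt (fun v w => ¬ r v w) X Bᶜ ≤ 2 * θ * n ^ 2 := by
  have h3 : 0 ≤ n := by rw [hn]; positivity
  have h1 : ∀ v ∈ X, ((Bᶜ.filter fun w => ¬ r v w).card : ℝ) ≤ 2 * θ * n := by
    intro v hv
    have e1 : ((Bᶜ.filter fun w => r v w).card : ℝ) + (Bᶜ.filter fun w => ¬ r v w).card =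
        Bᶜ.card := by
      exact_mod_cast Finset.card_filter_add_card_filter_not (s := Bᶜ) (fun w => r v w)
    have e2 : ((Finset.univ.filter fun w => r v w).card : ℝ) ≤
        (B.filter fun w => r v w).card + (Bᶜ.filter fun w => r v w).card := by
      norm_cast
      refine le_trans (Finset.card_le_card fun w hw => ?_) (Finset.card_union_le _ _)
      simp only [Finset.mem_filter, Finset.mem_union, Finset.mem_compl] at hw ⊢
      tauto
    have e3 := hX v hv
    have e4 := hout v
    have e5 := card_add_card_compl_real B
    linarith
  refine (cnt_le_card_mul (c := 2 * θ * n) fun v hv => ?_).trans ?_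
  · convert h1 v hv
  have h4 : (X.card : ℝ) * (2 * θ * n) ≤ n * (2 * θ * n) :=
    mul_le_mul_of_nonneg_right (by linarith [card_le_real X]) (by positivity)
  exact h4.trans (le_of_eq (by ring))

theorem card_low_mul_le (hn : n = Fintype.card α) (hθ : 0 ≤ θ)
    (hin : ∀ w, n / 2 ≤ (Finset.univ.filter fun v => r v w).card)
    (hX : ∀ v ∈ X, ((B.filter fun w => r v w).card : ℝ) ≤ θ * n) :
    B.card * (n / 2) ≤ θ * n ^ 2 + cnt r Xᶜ B := by
  have h1 : B.card * (n / 2) ≤ cnt r Finset.univ B := by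
    rw [← cnt_swap]
    exact card_mul_le_cnt fun v _ => hin v
  have h2 := cnt_union_le r X Xᶜ B
  rw [Finset.union_compl] at h2
  linarith [cnt_low_le hn hθ hX]

theorem card_low_le (hn : n = Fintype.card α) (hn0 : 0 < n) (hθ : 0 ≤ θ) (hB : n / 4 ≤ B.card)
    (hin : ∀ w, n / 2 ≤ (Finset.univ.filter fun v => r v w).card)
    (hX : ∀ v ∈ X, ((B.filter fun w => r v w).card : ℝ) ≤ θ * n) :
    (X.card : ℝ) ≤ n / 2 + 4 * θ * n := by
  have h1 := card_low_mul_le hn hθ hin hX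
  have h2 := cnt_le_card_mul_card r Xᶜ B
  have h3 := card_add_card_compl_real X
  by_contra! h
  have h4 : (Xᶜ.card : ℝ) < n / 2 - 4 * θ * n := by linarith
  have h5 : (Xᶜ.card : ℝ) * B.card ≤ (n / 2 - 4 * θ * n) * B.card :=
    mul_le_mul_of_nonneg_right h4.le (by positivity)
  have h6 : (Xᶜ.card : ℝ) * B.card < (n / 2 - 4 * θ * n) * B.card :=
    mul_lt_mul_of_pos_right h4 (by linarith)
  have h7 : 4 * θ * n * (n / 4) ≤ 4 * θ * n * B.card :=
    mul_le_mul_of_nonneg_left hB (by positivity)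
  nlinarith

theorem cnt_not_compl_low_le (hn : n = Fintype.card α) (hθ : 0 ≤ θ) {s : ℝ}
    (hs : 0 ≤ s) (hin : ∀ w, n / 2 ≤ (Finset.univ.filter fun v => r v w).card)
    (hX : ∀ v ∈ X, ((B.filter fun w => r v w).card : ℝ) ≤ θ * n)
    (hXc : (1 / 2 - s) * n ≤ X.card) :
    cnt (fun v w => ¬ r v w) Xᶜ B ≤ (s + θ) * n ^ 2 := by
  have h1 := card_low_mul_le hn hθ hin hX
  have h2 := cnt_add_cnt_not r Xᶜ B
  have h3 := card_add_card_compl_real X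
  have h0 : 0 ≤ n := by rw [hn]; positivity
  have h4 : (Xᶜ.card : ℝ) ≤ (1 / 2 + s) * n := by linarith
  have h5 : (Xᶜ.card : ℝ) * B.card ≤ (1 / 2 + s) * n * B.card :=
    mul_le_mul_of_nonneg_right h4 (by positivity)
  have h6 : s * n * B.card ≤ s * n * n :=
    mul_le_mul_of_nonneg_left (by linarith [card_le_real B]) (by positivity)
  nlinarith

end Low

/-- In one colour, two sparse spots force an almost complete bipartite-like structure. -/
theorem colour_type {r : α → α → Prop} {θ s n : ℝ} (hn : n = Fintype.card α) (hn0 : 0 < n)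
    (hθ : 0 ≤ θ) (hs : 0 ≤ s) (hs1 : s ≤ 1 / 10)
    (hout : ∀ v, n / 2 ≤ (Finset.univ.filter fun w => r v w).card)
    (hin : ∀ w, n / 2 ≤ (Finset.univ.filter fun v => r v w).card)
    {A B X Y : Finset α} (hA : (1 / 2 - θ) * n ≤ A.card) (hA' : (A.card : ℝ) ≤ n / 2)
    (hB : (1 / 2 - θ) * n ≤ B.card)
    (hX : ∀ v ∈ X, ((B.filter fun w => r v w).card : ℝ) ≤ θ * n)
    (hY : ∀ w ∈ Y, ((A.filter fun v => r v w).card : ℝ) ≤ θ * n)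
    (hXc : (1 / 2 - s) * n ≤ X.card) (hYc : (1 / 2 - s) * n ≤ Y.card) :
    cnt (fun v w => ¬ r v w) A Bᶜ + cnt (fun v w => ¬ r v w) Aᶜ B ≤ (2 * s + 34 * θ) * n ^ 2 ∨
    cnt (fun v w => ¬ r v w) A B + cnt (fun v w => ¬ r v w) Aᶜ Bᶜ ≤ (2 * s + 34 * θ) * n ^ 2 := by
  have a1 := cnt_low_le hn hθ hX
  have a2 := cnt_not_low_compl_le hn hθ hout hB hX
  have a3 := cnt_not_compl_low_le hn hθ hs hin hX hXc
  have b1 := cnt_low_le (r := fun w v => r v w) hn hθ hY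
  have b2 := cnt_not_low_compl_le (r := fun w v => r v w) hn hθ hin hA hY
  rw [cnt_swap] at b1
  rw [cnt_swap (fun v w => ¬ r v w)] at b2
  have key : ∀ P Q : Finset α, ∀ P₁ Q₁ P₂ Q₂ : Finset α, P ⊆ P₁ → Q ⊆ Q₁ → P ⊆ P₂ → Q ⊆ Q₂ →
      (P.card : ℝ) * Q.card ≤ cnt r P₁ Q₁ + cnt (fun v w => ¬ r v w) P₂ Q₂ := by
    intro P Q P₁ Q₁ P₂ Q₂ h1 h2 h3 h4
    rw [← cnt_add_cnt_not r P Q]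
    exact add_le_add (cnt_mono h1 h2) (cnt_mono h3 h4)
  have f1 := key (X \ A) (B ∩ Y) X B Aᶜ Y Finset.sdiff_subset Finset.inter_subset_left
    (fun v hv => by simpa using (Finset.mem_sdiff.1 hv).2) Finset.inter_subset_right
  have f2 := key (A ∩ X) (Y \ B) A Y X Bᶜ Finset.inter_subset_left Finset.sdiff_subset
    Finset.inter_subset_right (fun v hv => by simpa using (Finset.mem_sdiff.1 hv).2)
  have hθn : 0 ≤ θ * n ^ 2 := by positivity
  have hsn : s * n ≤ 1 / 10 * n := mul_le_mul_of_nonneg_right hs1 hn0.le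
  have hYs : ((B ∩ Y).card : ℝ) + (Y \ B).card = Y.card := by
    rw [Finset.inter_comm, add_comm]
    exact_mod_cast Finset.card_sdiff_add_card_inter _ _
  have hXs : ((A ∩ X).card : ℝ) + (X \ A).card = X.card := by
    rw [Finset.inter_comm, add_comm]
    exact_mod_cast Finset.card_sdiff_add_card_inter _ _
  have hAs : ((A ∩ X).card : ℝ) + (A \ X).card = A.card := by
    rw [add_comm]
    exact_mod_cast Finset.card_sdiff_add_card_inter _ _
  have hAcs : ((Aᶜ \ X).card : ℝ) + (X \ A).card = Aᶜ.card := by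
    have : X \ A = Aᶜ ∩ X := by ext; simp [and_comm]
    rw [this]
    exact_mod_cast Finset.card_sdiff_add_card_inter _ _
  have hAA := card_add_card_compl_real A
  have cover : ∀ P Q R : Finset α, ∀ c : ℝ, ((P \ R).card : ℝ) ≤ c →
      cnt (fun v w => ¬ r v w) P Q ≤ c * n + cnt (fun v w => ¬ r v w) R Q := by
    intro P Q R c hc
    have h1 : P ⊆ (P \ R) ∪ R := by
      intro v hv; by_cases h : v ∈ R <;> simp [h, hv]
    have h2 := (cnt_mono (r := fun v w => ¬ r v w) h1 (Finset.Subset.refl Q)).trans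
      (cnt_union_le _ _ _ _)
    have h3 := cnt_le_card_mul_card (fun v w => ¬ r v w) (P \ R) Q
    have h4 : ((P \ R).card : ℝ) * Q.card ≤ c * n :=
      mul_le_mul hc (by linarith [card_le_real Q]) (by positivity) (le_trans (by positivity) hc)
    linarith
  rcases le_or_gt (n / 5) ((B ∩ Y).card : ℝ) with h | h
  · left
    have g1 : ((X \ A).card : ℝ) ≤ 15 * θ * n := by
      have : ((X \ A).card : ℝ) * (n / 5) ≤ (X \ A).card * (B ∩ Y).card :=
        mul_le_mul_of_nonneg_left h (by positivity)
      refine le_of_mul_le_mul_right ?_ (show 0 < n / 5 by positivity)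
      linarith
    have g2 := cover A Bᶜ X ((s + 15 * θ) * n) (by linarith)
    have g3 := cover Aᶜ B Xᶜ (15 * θ * n) (by
      have : Aᶜ \ Xᶜ = X \ A := by ext; simp [and_comm]
      rwa [this])
    linarith
  · right
    have g1 : ((A ∩ X).card : ℝ) ≤ 15 * θ * n := by
      have h' : n / 5 ≤ ((Y \ B).card : ℝ) := by linarith
      have : ((A ∩ X).card : ℝ) * (n / 5) ≤ (A ∩ X).card * (Y \ B).card :=
        mul_le_mul_of_nonneg_left h' (by positivity)
      refine le_of_mul_le_mul_right ?_ (show 0 < n / 5 by positivity)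
      linarith
    have g2 := cover Aᶜ Bᶜ X ((s + 16 * θ) * n) (by linarith)
    have g3 := cover A B Xᶜ (15 * θ * n) (by
      have : A \ Xᶜ = A ∩ X := by ext; simp
      rwa [this])
    linarith

end ColourType

section Structure

theorem card_filter_lt_mul_le {ι : Type*} [Fintype ι] {f : ι → ℝ} {M a b : ℝ}
    (hf : ∀ i, f i ≤ M) (hsum : Fintype.card ι * (M - a) ≤ ∑ i, f i) :
    ((Finset.univ.filter fun i => f i < M - b).card : ℝ) * b ≤ Fintype.card ι * a := by
  have h1 : ((Finset.univ.filter fun i => f i < M - b).card : ℝ) * b ≤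
      ∑ i ∈ Finset.univ.filter (fun i => f i < M - b), (M - f i) := by
    rw [← nsmul_eq_mul]
    refine Finset.card_nsmul_le_sum _ _ _ fun i hi => ?_
    have := (Finset.mem_filter.1 hi).2
    linarith
  have h2 : ∑ i ∈ Finset.univ.filter (fun i => f i < M - b), (M - f i) ≤ ∑ i, (M - f i) :=
    Finset.sum_le_sum_of_subset_of_nonneg (Finset.filter_subset _ _)
      fun i _ _ => by linarith [hf i]
  have h3 : ∑ i, (M - f i) = Fintype.card ι * M - ∑ i, f i := by
    rw [Finset.sum_sub_distrib]; simp
  linarith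

theorem card_few_bad {n : ℕ} (hn : 0 < n) {p : Fin n → Fin n → Prop} {θ s : ℝ} (hs : 0 < s)
    (hθ : θ = s ^ 2)
    (hle : ∀ i, ((Finset.univ.filter fun v => p v i).card : ℝ) ≤ n / 2 + 4 * θ * n)
    (hsum : (1 / 2 - θ) * (n : ℝ) ^ 2 ≤
      ((Finset.univ : Finset (Fin n × Fin n)).filter fun x => p x.1 x.2).card) :
    ((Finset.univ.filter fun i => ¬ (1 / 2 - s) * n ≤
      ((Finset.univ.filter fun v => p v i).card : ℝ)).card : ℝ) ≤ 5 * s * n := by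
  have hnR : (0 : ℝ) < n := by exact_mod_cast hn
  have h1 := card_filter_lt_mul_le (a := 5 * θ * n) (b := s * n) hle (by
    rw [Fintype.card_fin]
    have e : (((Finset.univ : Finset (Fin n × Fin n)).filter fun x => p x.1 x.2).card : ℝ) =
        ∑ i, ((Finset.univ.filter fun v => p v i).card : ℝ) := by
      rw [card_filter_prod_eq_sum, Finset.sum_comm]
      exact Finset.sum_congr rfl fun i _ => by rw [Finset.sum_boole]
    rw [← e]
    refine le_trans (le_of_eq (by ring)) hsum)
  rw [Fintype.card_fin] at h1
  have h2 : ((Finset.univ.filter fun i => ¬ (1 / 2 - s) * n ≤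
      ((Finset.univ.filter fun v => p v i).card : ℝ)).card : ℝ) ≤
      (Finset.univ.filter fun i => ((Finset.univ.filter fun v => p v i).card : ℝ) <
        n / 2 + 4 * θ * n - s * n).card := by
    norm_cast
    refine Finset.card_le_card fun i hi => ?_
    simp only [Finset.mem_filter, Finset.mem_univ, true_and, not_le] at hi ⊢
    have : 0 ≤ θ * n := by rw [hθ]; positivity
    linarith
  refine h2.trans ?_
  refine le_of_mul_le_mul_right (h1.trans (le_of_eq ?_)) (show 0 < s * n by positivity)
  rw [hθ]; ring

/-- A tail, a head and a colour fit together with respect to three two-colourings. -/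
def Even {V : Type} (τ h t : V → Bool) (v w i : V) : Prop := (τ v ^^ h w) = t i

theorem cnt_fit_true_le {n : ℕ} (r : Fin n → Fin n → Prop) (A B : Finset (Fin n)) :
    cnt (fun v w => (decide (v ∈ A) ^^ decide (w ∈ B)) = true ∧ ¬ r v w) Finset.univ Finset.univ ≤
      cnt (fun v w => ¬ r v w) A Bᶜ + cnt (fun v w => ¬ r v w) Aᶜ B := by
  unfold cnt
  norm_cast
  refine le_trans (Finset.card_le_card fun p hp => ?_) (Finset.card_union_le _ _)
  simp only [Finset.mem_filter, Finset.mem_product, Finset.mem_union, Finset.mem_compl] at hp ⊢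
  by_cases ha : p.1 ∈ A <;> by_cases hb : p.2 ∈ B <;> simp_all

theorem cnt_fit_false_le {n : ℕ} (r : Fin n → Fin n → Prop) (A B : Finset (Fin n)) :
    cnt (fun v w => (decide (v ∈ A) ^^ decide (w ∈ B)) = false ∧ ¬ r v w) Finset.univ Finset.univ ≤
      cnt (fun v w => ¬ r v w) A B + cnt (fun v w => ¬ r v w) Aᶜ Bᶜ := by
  unfold cnt
  norm_cast
  refine le_trans (Finset.card_le_card fun p hp => ?_) (Finset.card_union_le _ _)
  simp only [Finset.mem_filter, Finset.mem_product, Finset.mem_union, Finset.mem_compl] at hp ⊢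
  by_cases ha : p.1 ∈ A <;> by_cases hb : p.2 ∈ B <;> simp_all

/-- Either there is a transversal Hamilton cycle, or tails, heads and colours can be
two-coloured so that almost all fitting triples are present. -/
theorem hasTHC_or_structure {ε : ℝ} (hε : 0 < ε) (hε1 : ε < 1) :
    ∃ n₀ : ℕ, ∀ n : ℕ, n₀ ≤ n → ∀ D : Fin n → Fin n → Fin n → Prop, DegHyp D → HasTHC D ∨
      ∃ τ h t : Fin n → Bool,
        |((Finset.univ.filter fun v => τ v = false).card : ℝ) - n / 2| ≤ ε * n ∧
        |((Finset.univ.filter fun w => h w = false).card : ℝ) - n / 2| ≤ ε * n ∧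
        ((Finset.univ : Finset (Fin n × Fin n × Fin n)).filter fun x =>
          Even τ h t x.1 x.2.1 x.2.2 ∧ ¬ D x.2.2 x.1 x.2.1).card ≤ ε * (n : ℝ) ^ 3 := by
  set s := ε / 100 with hs
  set θ := s ^ 2 with hθ
  have hs0 : 0 < s := by positivity
  have hs1 : s ≤ 1 / 100 := by rw [hs]; linarith
  have hθ0 : 0 < θ := by positivity
  have hθs : θ ≤ s / 100 := by rw [hθ]; nlinarith
  obtain ⟨n₀, h₀⟩ := hasTHC_or_sparse (ε := θ) hθ0 (by linarith)
  refine ⟨max n₀ 1, fun n hn D hD => ?_⟩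
  have hn0 : 0 < n := by omega
  have hnR : (0 : ℝ) < n := by exact_mod_cast hn0
  have hcn : (n : ℝ) = Fintype.card (Fin n) := by simp
  rcases h₀ n (by omega) D hD with h | ⟨B, hB1, hB2, hB3⟩
  · exact Or.inl h
  rcases h₀ n (by omega) _ hD.reverse with h | ⟨A, hA1, hA2, hA3⟩
  · exact Or.inl h.of_reverse
  right
  have hθn : θ * n ≤ 1 / 100 * n := mul_le_mul_of_nonneg_right (by linarith) hnR.le
  have hsn : s * n ≤ 1 / 100 * n := mul_le_mul_of_nonneg_right hs1 hnR.le
  set X : Fin n → Finset (Fin n) := fun i => Finset.univ.filter fun v =>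
    ((B.filter fun w => D i v w).card : ℝ) ≤ θ * n with hX
  set Y : Fin n → Finset (Fin n) := fun i => Finset.univ.filter fun w =>
    ((A.filter fun v => D i v w).card : ℝ) ≤ θ * n with hY
  have hXm : ∀ i, ∀ v ∈ X i, ((B.filter fun w => D i v w).card : ℝ) ≤ θ * n :=
    fun i v hv => (Finset.mem_filter.1 hv).2
  have hYm : ∀ i, ∀ w ∈ Y i, ((A.filter fun v => D i v w).card : ℝ) ≤ θ * n :=
    fun i v hv => (Finset.mem_filter.1 hv).2
  have badX := card_few_bad hn0 hs0 hθ
    (fun i => card_low_le hcn hnR hθ0.le (by linarith) (hD.inn i) (hXm i)) hB3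
  have badY := card_few_bad hn0 hs0 hθ
    (fun i => card_low_le (r := fun w v => D i v w) hcn hnR hθ0.le (by linarith) (hD.out i)
      (hYm i)) hA3
  set t : Fin n → Bool := fun i => decide
    (cnt (fun v w => ¬ D i v w) A Bᶜ + cnt (fun v w => ¬ D i v w) Aᶜ B ≤
      (2 * s + 34 * θ) * (n : ℝ) ^ 2) with ht
  have hbad : ((Finset.univ.filter fun i => ¬ ((1 / 2 - s) * n ≤ ((X i).card : ℝ) ∧
      (1 / 2 - s) * n ≤ ((Y i).card : ℝ))).card : ℝ) ≤ 10 * s * n := by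
    refine le_trans ?_ ((add_le_add badX badY).trans (le_of_eq (by ring)))
    norm_cast
    refine le_trans (Finset.card_le_card fun i hi => ?_) (Finset.card_union_le _ _)
    simp only [Finset.mem_filter, Finset.mem_univ, true_and, Finset.mem_union, hX, hY] at hi ⊢
    tauto
  have size : ∀ C : Finset (Fin n), (1 / 2 - θ) * n ≤ C.card → (C.card : ℝ) ≤ n / 2 →
      |((Finset.univ.filter fun v => decide (v ∈ C) = false).card : ℝ) - n / 2| ≤ ε * n := by
    intro C h1 h2
    have e : (Finset.univ.filter fun v => decide (v ∈ C) = false) = Cᶜ := by ext; simp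
    have h3 := card_add_card_compl_real C
    rw [Fintype.card_fin] at h3
    rw [e, abs_le]
    have : θ * n ≤ ε * n := mul_le_mul_of_nonneg_right (by linarith) hnR.le
    constructor <;> linarith [this]
  refine ⟨fun v => decide (v ∈ A), fun w => decide (w ∈ B), t, size A hA1 hA2, size B hB1 hB2, ?_⟩
  set c : Fin n → ℝ := fun i => cnt (fun v w =>
    Even (fun v => decide (v ∈ A)) (fun w => decide (w ∈ B)) t v w i ∧ ¬ D i v w) Finset.univ Finset.univ with hc
  have hsumc : (((Finset.univ : Finset (Fin n × Fin n × Fin n)).filter fun x =>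
      Even (fun v => decide (v ∈ A)) (fun w => decide (w ∈ B)) t x.1 x.2.1 x.2.2 ∧
        ¬ D x.2.2 x.1 x.2.1).card : ℝ) = ∑ i, c i := by
    have key : ∀ f : Fin n → Fin n → Fin n → ℝ,
        ∑ x : Fin n × Fin n × Fin n, f x.1 x.2.1 x.2.2 = ∑ i, ∑ v, ∑ w, f v w i := by
      intro f
      rw [Fintype.sum_prod_type, Finset.sum_comm (s := (Finset.univ : Finset (Fin n)))]
      simp only [Fintype.sum_prod_type]
      rw [Finset.sum_comm' (t' := Finset.univ) (s' := fun _ => Finset.univ) (by simp)]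
      refine Finset.sum_congr rfl fun v _ => Finset.sum_comm
    rw [← Finset.sum_boole, key (fun v w i => if Even (fun v => decide (v ∈ A))
      (fun w => decide (w ∈ B)) t v w i ∧ ¬ D i v w then (1 : ℝ) else 0)]
    refine Finset.sum_congr rfl fun i _ => ?_
    simp only [hc, cnt_eq_sum]
    refine Finset.sum_congr rfl fun v _ => ?_
    rw [Finset.sum_boole]
    congr
  rw [hsumc]
  have hc1 : ∀ i, c i ≤ (n : ℝ) ^ 2 := by
    intro i
    refine (cnt_le_card_mul_card _ _ _).trans (le_of_eq ?_)
    simp [sq]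
  have hc2 : ∀ i, (1 / 2 - s) * n ≤ ((X i).card : ℝ) ∧ (1 / 2 - s) * n ≤ ((Y i).card : ℝ) →
      c i ≤ (2 * s + 34 * θ) * (n : ℝ) ^ 2 := by
    intro i hi
    have h1 := colour_type hcn hnR hθ0.le hs0.le (by linarith) (hD.out i) (hD.inn i) hA1 hA2 hB1
      (hXm i) (hYm i) hi.1 hi.2
    by_cases h2 : cnt (fun v w => ¬ D i v w) A Bᶜ + cnt (fun v w => ¬ D i v w) Aᶜ B ≤
      (2 * s + 34 * θ) * (n : ℝ) ^ 2
    · refine le_trans ?_ h2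
      have hti : t i = true := decide_eq_true h2
      simp only [hc, Even, hti]
      exact cnt_fit_true_le _ _ _
    · refine le_trans ?_ (h1.resolve_left h2)
      have hti : t i = false := decide_eq_false h2
      simp only [hc, Even, hti]
      exact cnt_fit_false_le _ _ _
  have hc3 : ∑ i, c i ≤ ∑ i, ((2 * s + 34 * θ) * (n : ℝ) ^ 2 +
      (n : ℝ) ^ 2 * if ¬ ((1 / 2 - s) * n ≤ ((X i).card : ℝ) ∧ (1 / 2 - s) * n ≤ ((Y i).card : ℝ))
        then 1 else 0) := by
    refine Finset.sum_le_sum fun i _ => ?_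
    by_cases hi : (1 / 2 - s) * n ≤ ((X i).card : ℝ) ∧ (1 / 2 - s) * n ≤ ((Y i).card : ℝ)
    · rw [if_neg (not_not.2 hi)]
      linarith [hc2 i hi]
    · rw [if_pos hi]
      have : 0 ≤ (2 * s + 34 * θ) * (n : ℝ) ^ 2 := by positivity
      linarith [hc1 i]
  refine hc3.trans ?_
  rw [Finset.sum_add_distrib, ← Finset.mul_sum Finset.univ _ ((n : ℝ) ^ 2), Finset.sum_boole]
  simp only [Finset.sum_const, Finset.card_univ, Fintype.card_fin, nsmul_eq_mul]
  have h1 := mul_le_mul_of_nonneg_left hbad (show 0 ≤ (n : ℝ) ^ 2 by positivity)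
  have h2 : 34 * θ * (n : ℝ) ^ 3 ≤ 34 * (s / 100) * (n : ℝ) ^ 3 :=
    mul_le_mul_of_nonneg_right (by linarith) (by positivity)
  have h3 : 0 ≤ s * (n : ℝ) ^ 3 := by positivity
  have h4 : ε = 100 * s := by rw [hs]; ring
  rw [h4]
  refine (add_le_add_right h1 _).trans ?_
  linarith

end Structure

section Switching
variable {α : Type} [Fintype α] [DecidableEq α] {K : Type}

theorem exists_avoiding_list {β : Type*} (L : List (β → Prop)) (T : Finset β) {c : ℝ}
    (h : ∀ p ∈ L, ((T.filter p).card : ℝ) ≤ c) (hT : L.length * c < T.card) :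
    ∃ x ∈ T, ∀ p ∈ L, ¬ p x := by
  induction L generalizing T with
  | nil =>
    obtain ⟨x, hx⟩ := Finset.card_pos.1 (by simpa using hT : 0 < T.card)
    exact ⟨x, hx, by simp⟩
  | cons p L ih =>
    have h1 : ((T.filter p).card : ℝ) + (T.filter fun x => ¬ p x).card = T.card := by
      exact_mod_cast Finset.card_filter_add_card_filter_not _
    obtain ⟨x, hx, hxL⟩ := ih (T.filter fun x => ¬ p x)
      (fun q hq => by
        refine le_trans ?_ (h q (List.mem_cons_of_mem _ hq))
        exact_mod_cast Finset.card_le_card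
          (Finset.filter_subset_filter _ (Finset.filter_subset _ _)))
      (by
        have := h p List.mem_cons_self
        simp only [List.length_cons, Nat.cast_add, Nat.cast_one] at hT
        linarith)
    rw [Finset.mem_filter] at hx
    refine ⟨x, hx.1, fun q hq => ?_⟩
    rcases List.mem_cons.1 hq with rfl | hq
    · exact hx.2
    · exact hxL q hq

theorem card_le_mul_of_fibres {γ δ : Type*} (U : Finset γ) (f : γ → α) (g : γ → δ)
    (hinj : ∀ x ∈ U, ∀ y ∈ U, f x = f y → g x = g y → x = y) (B : α → Finset δ) {c : ℝ}
    (hg : ∀ x ∈ U, g x ∈ B (f x)) (hc0 : 0 ≤ c) (hB : ∀ x ∈ U, ((B (f x)).card : ℝ) ≤ c) :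
    (U.card : ℝ) ≤ Fintype.card α * c := by
  have h1 : ∀ v, ((U.filter fun x => f x = v).card : ℝ) ≤ c := by
    intro v
    rcases (U.filter fun x => f x = v).eq_empty_or_nonempty with h | ⟨x, hx⟩
    · simpa [h] using hc0
    · rw [Finset.mem_filter] at hx
      have h2 : (U.filter fun x => f x = v).card ≤ (B (f x)).card := by
        refine Finset.card_le_card_of_injOn g (fun y hy => ?_) fun y hy z hz hyz => ?_
        · have hy := Finset.mem_filter.1 hy
          have := hg y hy.1
          rwa [hy.2, ← hx.2] at this
        · have hy := Finset.mem_filter.1 hy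
          have hz := Finset.mem_filter.1 hz
          exact hinj y hy.1 z hz.1 (hy.2.trans hz.2.symm) hyz
      exact (Nat.cast_le.2 h2).trans (hB x hx.1)
  have h2 := Finset.card_eq_sum_card_fiberwise (f := f) (s := U) (t := Finset.univ) (by simp)
  rw [h2]
  push_cast
  refine (Finset.sum_le_sum fun v _ => h1 v).trans (by simp)

/-- A permutation that fixes a set pointwise and preserves classes. -/
structure Adm (cls : α → K) (S : Finset α) (σ : Perm α) : Prop where
  fix : ∀ v ∈ S, σ v = v
  cls : ∀ v, cls (σ v) = cls v

theorem Adm.one (cls : α → K) (S : Finset α) : Adm cls S 1 := ⟨fun _ _ => rfl, fun _ => rfl⟩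

theorem Adm.mul {cls : α → K} {S : Finset α} {σ μ : Perm α} (h : Adm cls S σ) (h' : Adm cls S μ) :
    Adm cls S (σ * μ) :=
  ⟨fun v hv => by rw [Perm.mul_apply, h'.fix v hv, h.fix v hv],
    fun v => by rw [Perm.mul_apply, h.cls, h'.cls]⟩

theorem Adm.inv {cls : α → K} {S : Finset α} {σ : Perm α} (h : Adm cls S σ) : Adm cls S σ⁻¹ :=
  ⟨fun v hv => by rw [Perm.inv_eq_iff_eq, h.fix v hv],
    fun v => by simpa using (h.cls (σ⁻¹ v)).symm⟩

theorem Adm.notMem {cls : α → K} {S : Finset α} {σ : Perm α} (h : Adm cls S σ) {v : α}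
    (hv : v ∉ S) : σ v ∉ S :=
  fun hs => hv (by rwa [σ.injective (h.fix _ hs)] at hs)

theorem Adm.swap {cls : α → K} {S : Finset α} {a b : α} (ha : a ∉ S) (hb : b ∉ S)
    (hab : cls a = cls b) : Adm cls S (swap a b) := by
  refine ⟨fun v hv => swap_apply_of_ne_of_ne (by rintro rfl; exact ha hv)
    (by rintro rfl; exact hb hv), fun v => ?_⟩
  rw [swap_apply_def]
  split_ifs with h1 h2
  · rw [h1, hab]
  · rw [h2, hab]
  · rfl

theorem four_switch {cls : α → K} {S : Finset α} {E : α → α → α → Prop} {σ ρ : Perm α}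
    (hσ : Adm cls S σ) (hρ : Adm cls S ρ) {v₀ v₁ v₂ v₃ : α} (h0 : v₀ ∉ S) (h1 : v₁ ∉ S)
    (h2 : v₂ ∉ S) (h3 : v₃ ∉ S) (c1 : cls v₁ = cls v₀) (c2 : cls v₂ = cls v₀)
    (c3 : cls v₃ = cls v₀) (h01 : v₀ ≠ v₁) (h02 : v₀ ≠ v₂) (h03 : v₀ ≠ v₃) (h12 : v₁ ≠ v₂)
    (h13 : v₁ ≠ v₃) (h23 : v₂ ≠ v₃) (e0 : E v₀ (σ v₁) (ρ v₃)) (e1 : E v₁ (σ v₂) (ρ v₀))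
    (e2 : E v₂ (σ v₃) (ρ v₁)) (e3 : E v₃ (σ v₀) (ρ v₂)) :
    ∃ ρ' : Perm α, Adm cls S (σ * swap v₀ v₁ * swap v₁ v₂ * swap v₂ v₃) ∧ Adm cls S ρ' ∧
      (∀ x, E x (σ x) (ρ x) →
        E x ((σ * swap v₀ v₁ * swap v₁ v₂ * swap v₂ v₃) x) (ρ' x)) ∧
      E v₀ ((σ * swap v₀ v₁ * swap v₁ v₂ * swap v₂ v₃) v₀) (ρ' v₀) := by
  obtain ⟨μ, hμ⟩ : ∃ μ : Perm α, μ = swap v₀ v₁ * swap v₁ v₂ * swap v₂ v₃ := ⟨_, rfl⟩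
  have hAμ : Adm cls S μ := hμ ▸
    ((Adm.swap h0 h1 c1.symm).mul (Adm.swap h1 h2 (c1.trans c2.symm))).mul
      (Adm.swap h2 h3 (c2.trans c3.symm))
  have m0 : μ v₀ = v₁ := by
    simp [Perm.mul_apply, swap_apply_of_ne_of_ne, *]
  have m1 : μ v₁ = v₂ := by
    simp [hμ, Perm.mul_apply, swap_apply_of_ne_of_ne, h12, h13, h02.symm, h12.symm]
  have m2 : μ v₂ = v₃ := by
    simp [hμ, Perm.mul_apply, swap_apply_of_ne_of_ne, h03.symm, h13.symm, h23.symm]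
  have m3 : μ v₃ = v₀ := by
    simp [hμ, Perm.mul_apply]
  have mx : ∀ x, x ≠ v₀ → x ≠ v₁ → x ≠ v₂ → x ≠ v₃ → μ x = x := by
    intro x a b c d
    simp [Perm.mul_apply, swap_apply_of_ne_of_ne, *]
  have inv : ∀ x y, μ x = y → μ⁻¹ y = x := fun x y h => by rw [Perm.inv_eq_iff_eq, h]
  have hσμ : σ * swap v₀ v₁ * swap v₁ v₂ * swap v₂ v₃ = σ * μ := by
    simp only [hμ, mul_assoc]
  rw [hσμ]
  have E0 : E v₀ ((σ * μ) v₀) ((ρ * μ⁻¹) v₀) := by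
    rwa [Perm.mul_apply, Perm.mul_apply, m0, inv _ _ m3]
  refine ⟨ρ * μ⁻¹, hσ.mul hAμ, hρ.mul hAμ.inv, fun x hx => ?_, E0⟩
  by_cases x0 : x = v₀
  · rw [x0]; exact E0
  rw [Perm.mul_apply, Perm.mul_apply]
  by_cases x1 : x = v₁
  · rw [x1, m1, inv _ _ m0]; exact e1
  by_cases x2 : x = v₂
  · rw [x2, m2, inv _ _ m1]; exact e2
  by_cases x3 : x = v₃
  · rw [x3, m3, inv _ _ m2]; exact e3
  have := mx x x0 x1 x2 x3
  rwa [this, inv _ _ this]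

/-- Outside `S`, a vertex in any of the three roles has few defects with its own class. -/
structure Typical (E : α → α → α → Prop) (cls : α → K) (S : Finset α) (κ : ℝ) : Prop where
  fst : ∀ v ∉ S, ((Finset.univ.filter fun p : α × α => p.1 ∉ S ∧ p.2 ∉ S ∧ cls p.1 = cls v ∧
    cls p.2 = cls v ∧ ¬ E v p.1 p.2).card : ℝ) ≤ κ * (Fintype.card α : ℝ) ^ 2
  snd : ∀ a ∉ S, ((Finset.univ.filter fun p : α × α => p.1 ∉ S ∧ p.2 ∉ S ∧ cls p.1 = cls a ∧
    cls p.2 = cls a ∧ ¬ E p.1 a p.2).card : ℝ) ≤ κ * (Fintype.card α : ℝ) ^ 2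
  trd : ∀ b ∉ S, ((Finset.univ.filter fun p : α × α => p.1 ∉ S ∧ p.2 ∉ S ∧ cls p.1 = cls b ∧
    cls p.2 = cls b ∧ ¬ E p.1 p.2 b).card : ℝ) ≤ κ * (Fintype.card α : ℝ) ^ 2

theorem exists_switch_triple {cls : α → K} {S : Finset α} {E : α → α → α → Prop} {κ ζ : ℝ}
    (hE : Typical E cls S κ) (hκ : 0 < κ) (hκζ : κ ≤ ζ ^ 3 / 120) (hζ : 0 < ζ)
    (hn : 1 / κ ≤ Fintype.card α) {σ ρ : Perm α} (hσ : Adm cls S σ) (hρ : Adm cls S ρ)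
    {v₀ : α} (hv₀ : v₀ ∉ S) {Q : Finset α} (hQ : ∀ v ∈ Q, v ∉ S ∧ cls v = cls v₀)
    (hQc : ζ / 2 * Fintype.card α ≤ Q.card) :
    ∃ v₁ ∈ Q, ∃ v₂ ∈ Q, ∃ v₃ ∈ Q, v₀ ≠ v₁ ∧ v₀ ≠ v₂ ∧ v₀ ≠ v₃ ∧ v₁ ≠ v₂ ∧ v₁ ≠ v₃ ∧ v₂ ≠ v₃ ∧
      (E v₀ (σ v₁) (ρ v₃) ∧ E v₁ (σ v₂) (ρ v₀) ∧ E v₂ (σ v₃) (ρ v₁) ∧ E v₃ (σ v₀) (ρ v₂)) ∧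
      (E v₀ (σ v₁) (ρ v₂) ∧ E v₁ (σ v₃) (ρ v₀) ∧ E v₃ (σ v₂) (ρ v₁) ∧ E v₂ (σ v₀) (ρ v₃)) := by
  set N : ℝ := (Fintype.card α : ℝ) with hN
  have hNpos : 0 < N := lt_of_lt_of_le (by positivity) hn
  have hκN : 1 ≤ κ * N := by
    rw [div_le_iff₀ hκ] at hn; linarith
  have hNN : N ≤ κ * N ^ 2 := by nlinarith
  have hc0 : 0 ≤ κ * N ^ 2 := by positivity
  set T := Q ×ˢ Q ×ˢ Q with hT
  have hTc : 14 * (N * (κ * N ^ 2)) < T.card := by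
    have h1 : (T.card : ℝ) = (Q.card : ℝ) ^ 3 := by
      rw [hT, Finset.card_product, Finset.card_product]; push_cast; ring
    rw [h1]
    have h2 : (ζ / 2 * N) ^ 3 ≤ (Q.card : ℝ) ^ 3 := pow_le_pow_left₀ (by positivity) hQc 3
    have h3 : 14 * κ * N ^ 3 < ζ ^ 3 / 8 * N ^ 3 :=
      mul_lt_mul_of_pos_right (by have : 0 < ζ ^ 3 := by positivity
                                  linarith) (by positivity)
    nlinarith
  have hQσ : ∀ v ∈ Q, σ v ∉ S ∧ cls (σ v) = cls v₀ := fun v hv =>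
    ⟨hσ.notMem (hQ v hv).1, by rw [hσ.cls, (hQ v hv).2]⟩
  have hQρ : ∀ v ∈ Q, ρ v ∉ S ∧ cls (ρ v) = cls v₀ := fun v hv =>
    ⟨hρ.notMem (hQ v hv).1, by rw [hρ.cls, (hQ v hv).2]⟩
  have hdiag : (((Finset.univ : Finset α).card : ℕ) : ℝ) ≤ κ * N ^ 2 := by
    rw [Finset.card_univ]; exact hNN
  let bf : α → Finset (α × α) := fun v => Finset.univ.filter fun p : α × α => p.1 ∉ S ∧ p.2 ∉ S ∧
    cls p.1 = cls v ∧ cls p.2 = cls v ∧ ¬ E v p.1 p.2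
  let bs : α → Finset (α × α) := fun a => Finset.univ.filter fun p : α × α => p.1 ∉ S ∧ p.2 ∉ S ∧
    cls p.1 = cls a ∧ cls p.2 = cls a ∧ ¬ E p.1 a p.2
  let bt : α → Finset (α × α) := fun b => Finset.univ.filter fun p : α × α => p.1 ∉ S ∧ p.2 ∉ S ∧
    cls p.1 = cls b ∧ cls p.2 = cls b ∧ ¬ E p.1 p.2 b
  have hσ0 := hσ.notMem hv₀
  have hρ0 := hρ.notMem hv₀
  have mem : ∀ p : α × α × α → Prop, ∀ x ∈ T.filter p, x.1 ∈ Q ∧ x.2.1 ∈ Q ∧ x.2.2 ∈ Q ∧ p x := by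
    intro p x hx
    rw [Finset.mem_filter, hT, Finset.mem_product, Finset.mem_product] at hx
    exact ⟨hx.1.1, hx.1.2.1, hx.1.2.2, hx.2⟩
  obtain ⟨x, hx, hL⟩ := exists_avoiding_list (T := T) (c := N * (κ * N ^ 2))
    [fun x => v₀ = x.1, fun x => v₀ = x.2.1, fun x => v₀ = x.2.2, fun x => x.1 = x.2.1,
      fun x => x.1 = x.2.2, fun x => x.2.1 = x.2.2,
      fun x => ¬ E v₀ (σ x.1) (ρ x.2.2), fun x => ¬ E x.1 (σ x.2.1) (ρ v₀),
      fun x => ¬ E x.2.1 (σ x.2.2) (ρ x.1), fun x => ¬ E x.2.2 (σ v₀) (ρ x.2.1),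
      fun x => ¬ E v₀ (σ x.1) (ρ x.2.1), fun x => ¬ E x.1 (σ x.2.2) (ρ v₀),
      fun x => ¬ E x.2.2 (σ x.2.1) (ρ x.1), fun x => ¬ E x.2.1 (σ v₀) (ρ x.2.2)]
    (by
      simp only [List.forall_mem_cons, List.not_mem_nil, false_imp_iff, implies_true, and_true]
      refine ⟨?_, ?_, ?_, ?_, ?_, ?_, ?_, ?_, ?_, ?_, ?_, ?_, ?_, ?_⟩
      · exact card_le_mul_of_fibres _ (fun x => x.2.1) (fun x => x.2.2) (by
          intro x hx y hy h1 h2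
          exact Prod.ext ((mem _ x hx).2.2.2.symm.trans (mem _ y hy).2.2.2) (Prod.ext h1 h2))
          (fun _ => Finset.univ) (by simp) hc0 fun _ _ => hdiag
      · exact card_le_mul_of_fibres _ (fun x => x.1) (fun x => x.2.2) (by
          intro x hx y hy h1 h2
          exact Prod.ext h1 (Prod.ext ((mem _ x hx).2.2.2.symm.trans (mem _ y hy).2.2.2) h2))
          (fun _ => Finset.univ) (by simp) hc0 fun _ _ => hdiag
      · exact card_le_mul_of_fibres _ (fun x => x.1) (fun x => x.2.1) (by
          intro x hx y hy h1 h2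
          exact Prod.ext h1 (Prod.ext h2 ((mem _ x hx).2.2.2.symm.trans (mem _ y hy).2.2.2)))
          (fun _ => Finset.univ) (by simp) hc0 fun _ _ => hdiag
      · exact card_le_mul_of_fibres _ (fun x => x.1) (fun x => x.2.2) (by
          intro x hx y hy h1 h2
          exact Prod.ext h1 (Prod.ext (((mem _ x hx).2.2.2.symm.trans h1).trans
            (mem _ y hy).2.2.2) h2))
          (fun _ => Finset.univ) (by simp) hc0 fun _ _ => hdiag
      · exact card_le_mul_of_fibres _ (fun x => x.1) (fun x => x.2.1) (by
          intro x hx y hy h1 h2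
          exact Prod.ext h1 (Prod.ext h2 (((mem _ x hx).2.2.2.symm.trans h1).trans
            (mem _ y hy).2.2.2)))
          (fun _ => Finset.univ) (by simp) hc0 fun _ _ => hdiag
      · exact card_le_mul_of_fibres _ (fun x => x.1) (fun x => x.2.1) (by
          intro x hx y hy h1 h2
          exact Prod.ext h1 (Prod.ext h2 (((mem _ x hx).2.2.2.symm.trans h2).trans
            (mem _ y hy).2.2.2)))
          (fun _ => Finset.univ) (by simp) hc0 fun _ _ => hdiag
      · refine card_le_mul_of_fibres _ (fun x => x.2.1) (fun x => (σ x.1, ρ x.2.2)) ?_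
          (fun _ => bf v₀) ?_ hc0 fun _ _ => hE.fst v₀ hv₀
        · intro x _ y _ h1 h2
          simp only [Prod.mk.injEq, EmbeddingLike.apply_eq_iff_eq] at h2
          exact Prod.ext h2.1 (Prod.ext h1 h2.2)
        · intro x hx
          obtain ⟨q1, q2, q3, hp⟩ := mem _ x hx
          simp only [bf, Finset.mem_filter, Finset.mem_univ, true_and]
          exact ⟨(hQσ _ q1).1, (hQρ _ q3).1, (hQσ _ q1).2, (hQρ _ q3).2, hp⟩
      · refine card_le_mul_of_fibres _ (fun x => x.2.2) (fun x => (x.1, σ x.2.1)) ?_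
          (fun _ => bt (ρ v₀)) ?_ hc0 fun _ _ => hE.trd _ hρ0
        · intro x _ y _ h1 h2
          simp only [Prod.mk.injEq, EmbeddingLike.apply_eq_iff_eq] at h2
          exact Prod.ext h2.1 (Prod.ext h2.2 h1)
        · intro x hx
          obtain ⟨q1, q2, q3, hp⟩ := mem _ x hx
          simp only [bt, Finset.mem_filter, Finset.mem_univ, true_and, hρ.cls]
          exact ⟨(hQ _ q1).1, (hQσ _ q2).1, (hQ _ q1).2, (hQσ _ q2).2, hp⟩
      · refine card_le_mul_of_fibres _ (fun x => x.2.1) (fun x => (σ x.2.2, ρ x.1)) ?_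
          bf ?_ hc0 fun x hx => hE.fst _ (hQ _ (mem _ x hx).2.1).1
        · intro x _ y _ h1 h2
          simp only [Prod.mk.injEq, EmbeddingLike.apply_eq_iff_eq] at h2
          exact Prod.ext h2.2 (Prod.ext h1 h2.1)
        · intro x hx
          obtain ⟨q1, q2, q3, hp⟩ := mem _ x hx
          simp only [bf, Finset.mem_filter, Finset.mem_univ, true_and, (hQ _ q2).2]
          exact ⟨(hQσ _ q3).1, (hQρ _ q1).1, (hQσ _ q3).2, (hQρ _ q1).2, hp⟩
      · refine card_le_mul_of_fibres _ (fun x => x.1) (fun x => (x.2.2, ρ x.2.1)) ?_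
          (fun _ => bs (σ v₀)) ?_ hc0 fun _ _ => hE.snd _ hσ0
        · intro x _ y _ h1 h2
          simp only [Prod.mk.injEq, EmbeddingLike.apply_eq_iff_eq] at h2
          exact Prod.ext h1 (Prod.ext h2.2 h2.1)
        · intro x hx
          obtain ⟨q1, q2, q3, hp⟩ := mem _ x hx
          simp only [bs, Finset.mem_filter, Finset.mem_univ, true_and, hσ.cls]
          exact ⟨(hQ _ q3).1, (hQρ _ q2).1, (hQ _ q3).2, (hQρ _ q2).2, hp⟩
      · refine card_le_mul_of_fibres _ (fun x => x.2.2) (fun x => (σ x.1, ρ x.2.1)) ?_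
          (fun _ => bf v₀) ?_ hc0 fun _ _ => hE.fst v₀ hv₀
        · intro x _ y _ h1 h2
          simp only [Prod.mk.injEq, EmbeddingLike.apply_eq_iff_eq] at h2
          exact Prod.ext h2.1 (Prod.ext h2.2 h1)
        · intro x hx
          obtain ⟨q1, q2, q3, hp⟩ := mem _ x hx
          simp only [bf, Finset.mem_filter, Finset.mem_univ, true_and]
          exact ⟨(hQσ _ q1).1, (hQρ _ q2).1, (hQσ _ q1).2, (hQρ _ q2).2, hp⟩
      · refine card_le_mul_of_fibres _ (fun x => x.2.1) (fun x => (x.1, σ x.2.2)) ?_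
          (fun _ => bt (ρ v₀)) ?_ hc0 fun _ _ => hE.trd _ hρ0
        · intro x _ y _ h1 h2
          simp only [Prod.mk.injEq, EmbeddingLike.apply_eq_iff_eq] at h2
          exact Prod.ext h2.1 (Prod.ext h1 h2.2)
        · intro x hx
          obtain ⟨q1, q2, q3, hp⟩ := mem _ x hx
          simp only [bt, Finset.mem_filter, Finset.mem_univ, true_and, hρ.cls]
          exact ⟨(hQ _ q1).1, (hQσ _ q3).1, (hQ _ q1).2, (hQσ _ q3).2, hp⟩
      · refine card_le_mul_of_fibres _ (fun x => x.2.2) (fun x => (σ x.2.1, ρ x.1)) ?_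
          bf ?_ hc0 fun x hx => hE.fst _ (hQ _ (mem _ x hx).2.2.1).1
        · intro x _ y _ h1 h2
          simp only [Prod.mk.injEq, EmbeddingLike.apply_eq_iff_eq] at h2
          exact Prod.ext h2.2 (Prod.ext h2.1 h1)
        · intro x hx
          obtain ⟨q1, q2, q3, hp⟩ := mem _ x hx
          simp only [bf, Finset.mem_filter, Finset.mem_univ, true_and, (hQ _ q3).2]
          exact ⟨(hQσ _ q2).1, (hQρ _ q1).1, (hQσ _ q2).2, (hQρ _ q1).2, hp⟩
      · refine card_le_mul_of_fibres _ (fun x => x.1) (fun x => (x.2.1, ρ x.2.2)) ?_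
          (fun _ => bs (σ v₀)) ?_ hc0 fun _ _ => hE.snd _ hσ0
        · intro x _ y _ h1 h2
          simp only [Prod.mk.injEq, EmbeddingLike.apply_eq_iff_eq] at h2
          exact Prod.ext h1 (Prod.ext h2.1 h2.2)
        · intro x hx
          obtain ⟨q1, q2, q3, hp⟩ := mem _ x hx
          simp only [bs, Finset.mem_filter, Finset.mem_univ, true_and, hσ.cls]
          exact ⟨(hQ _ q2).1, (hQρ _ q3).1, (hQ _ q2).2, (hQρ _ q3).2, hp⟩)
    (by simpa using hTc)
  rw [hT, Finset.mem_product, Finset.mem_product] at hx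
  simp only [List.forall_mem_cons, List.not_mem_nil, false_imp_iff, implies_true, and_true,
    not_not] at hL
  obtain ⟨l1, l2, l3, l4, l5, l6, l7, l8, l9, l10, l11, l12, l13, l14⟩ := hL
  exact ⟨x.1, hx.1, x.2.1, hx.2.1, x.2.2, hx.2.2, l1, l2, l3, l4, l5, l6, ⟨l7, l8, l9, l10⟩,
    l11, l12, l13, l14⟩

end Switching

section Switching
variable {α : Type} [Fintype α] [DecidableEq α] {K : Type}

theorem exists_adm_good {cls : α → K} {S : Finset α} {E : α → α → α → Prop} {κ ζ : ℝ}
    (hE : Typical E cls S κ) (hκ : 0 < κ) (hκζ : κ ≤ ζ ^ 3 / 120) (hζ : 0 < ζ)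
    (hn : 1 / κ ≤ Fintype.card α) (hS : ∀ v ∈ S, E v v v)
    (hcls : ∀ v ∉ S, ζ * Fintype.card α ≤
      (Finset.univ.filter fun u => u ∉ S ∧ cls u = cls v).card) :
    ∃ σ ρ : Perm α, Adm cls S σ ∧ Adm cls S ρ ∧ ∀ v, E v (σ v) (ρ v) := by
  obtain ⟨⟨σ, ρ⟩, hmem, hmax⟩ := Finset.exists_max_image
    (Finset.univ.filter fun x : Perm α × Perm α => Adm cls S x.1 ∧ Adm cls S x.2)
    (fun x => (Finset.univ.filter fun v => E v (x.1 v) (x.2 v)).card)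
    ⟨(1, 1), by simp [Adm.one]⟩
  obtain ⟨hσ, hρ⟩ := (Finset.mem_filter.1 hmem).2
  refine ⟨σ, ρ, hσ, hρ, fun v₀ => ?_⟩
  by_contra hbad
  have hv₀ : v₀ ∉ S := fun hv => hbad (by
    rw [hσ.fix _ hv, hρ.fix _ hv]; exact hS _ hv)
  obtain ⟨v₁, q1, v₂, q2, v₃, q3, h01, h02, h03, h12, h13, h23, ⟨e0, e1, e2, e3⟩, -⟩ :=
    exists_switch_triple hE hκ hκζ hζ hn hσ hρ hv₀
      (Q := Finset.univ.filter fun u => u ∉ S ∧ cls u = cls v₀)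
      (fun v hv => (Finset.mem_filter.1 hv).2) (by
        refine le_trans ?_ (hcls v₀ hv₀)
        have : 0 ≤ ζ * Fintype.card α := by positivity
        linarith)
  simp only [Finset.mem_filter, Finset.mem_univ, true_and] at q1 q2 q3
  obtain ⟨ρ', hσ', hρ', hkeep, hnew⟩ := four_switch hσ hρ hv₀ q1.1 q2.1 q3.1 q1.2 q2.2 q3.2
    h01 h02 h03 h12 h13 h23 e0 e1 e2 e3
  have hle := hmax (_, ρ') (Finset.mem_filter.2 ⟨Finset.mem_univ _, hσ', hρ'⟩)
  refine absurd hle (not_le.2 (Finset.card_lt_card ?_))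
  rw [Finset.ssubset_iff_of_subset fun x hx => by
    simp only [Finset.mem_filter, Finset.mem_univ, true_and] at hx ⊢
    exact hkeep x hx]
  exact ⟨v₀, Finset.mem_filter.2 ⟨Finset.mem_univ _, hnew⟩, by simpa using hbad⟩

/-- With large typical classes, the roles inside the classes can be permuted so that everything is
good and each class lies on one cycle. -/
theorem exists_adm_good_sameCycle {cls : α → K} {S : Finset α} {E : α → α → α → Prop} {κ ζ : ℝ}
    (hE : Typical E cls S κ) (hκ : 0 < κ) (hκζ : κ ≤ ζ ^ 3 / 120) (hζ : 0 < ζ)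
    (hn : 1 / κ ≤ Fintype.card α) (hS : ∀ v ∈ S, E v v v)
    (hcls : ∀ v ∉ S, ζ * Fintype.card α ≤
      (Finset.univ.filter fun u => u ∉ S ∧ cls u = cls v).card) (π₀ : Perm α) :
    ∃ σ ρ : Perm α, Adm cls S σ ∧ Adm cls S ρ ∧ (∀ v, E v (σ v) (ρ v)) ∧
      ∀ u v, u ∉ S → v ∉ S → cls u = cls v → SameCycle (π₀ * σ) u v := by
  obtain ⟨σ₀, ρ₀, h₀⟩ := exists_adm_good hE hκ hκζ hζ hn hS hcls
  obtain ⟨⟨σ, ρ⟩, hmem, hmin⟩ := Finset.exists_min_image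
    (Finset.univ.filter fun x : Perm α × Perm α => Adm cls S x.1 ∧ Adm cls S x.2 ∧
      ∀ v, E v (x.1 v) (x.2 v)) (fun x => numCycles (π₀ * x.1))
    ⟨(σ₀, ρ₀), by simpa using h₀⟩
  obtain ⟨hσ, hρ, hgood⟩ := (Finset.mem_filter.1 hmem).2
  refine ⟨σ, ρ, hσ, hρ, hgood, fun u v hu hv huv => ?_⟩
  by_contra hne
  set P := Finset.univ.filter fun x => x ∉ S ∧ cls x = cls u with hP
  obtain ⟨v₀, hv₀S, hv₀c, hv₀P⟩ : ∃ v₀, v₀ ∉ S ∧ cls v₀ = cls u ∧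
      (P.card : ℝ) ≤ 2 * (P.filter fun x => ¬ SameCycle (π₀ * σ) v₀ x).card := by
    have h1 : ∀ y, ((P.filter fun x => SameCycle (π₀ * σ) y x).card : ℝ) +
        (P.filter fun x => ¬ SameCycle (π₀ * σ) y x).card = P.card := fun y => by
      exact_mod_cast Finset.card_filter_add_card_filter_not _
    have h2 : ((P.filter fun x => SameCycle (π₀ * σ) u x).card : ℝ) ≤
        (P.filter fun x => ¬ SameCycle (π₀ * σ) v x).card := by
      norm_cast
      refine Finset.card_le_card fun x hx => ?_
      rw [Finset.mem_filter] at hx ⊢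
      exact ⟨hx.1, fun h => hne (hx.2.trans h.symm)⟩
    have h3 := h1 u
    have h4 := h1 v
    by_cases h5 : (P.card : ℝ) ≤ 2 * (P.filter fun x => ¬ SameCycle (π₀ * σ) u x).card
    · exact ⟨u, hu, rfl, h5⟩
    · exact ⟨v, hv, huv.symm, by linarith⟩
  have hQ := exists_switch_triple hE hκ hκζ hζ hn hσ hρ hv₀S
      (Q := P.filter fun x => ¬ SameCycle (π₀ * σ) v₀ x)
      (fun x hx => by
        have := (Finset.mem_filter.1 (Finset.mem_filter.1 hx).1).2
        exact ⟨this.1, this.2.trans hv₀c.symm⟩)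
      (by have := hcls u hu
          linarith)
  obtain ⟨v₁, q1, v₂, q2, v₃, q3, h01, h02, h03, h12, h13, h23, ⟨e0, e1, e2, e3⟩,
    f0, f1, f2, f3⟩ := hQ
  simp only [hP, Finset.mem_filter, Finset.mem_univ, true_and] at q1 q2 q3
  have q1c := q1.1.2.trans hv₀c.symm
  have q2c := q2.1.2.trans hv₀c.symm
  have q3c := q3.1.2.trans hv₀c.symm
  rcases numCycles_four_switch_lt q1.2 h23 with hlt | hlt
  · obtain ⟨ρ', hσ', hρ', hkeep, -⟩ := four_switch hσ hρ hv₀S q1.1.1 q2.1.1 q3.1.1 q1c q2c q3c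
      h01 h02 h03 h12 h13 h23 e0 e1 e2 e3
    have hle := hmin (_, ρ') (Finset.mem_filter.2
      ⟨Finset.mem_univ _, hσ', hρ', fun x => hkeep x (hgood x)⟩)
    simp only [mul_assoc] at hle hlt
    omega
  · obtain ⟨ρ', hσ', hρ', hkeep, -⟩ := four_switch hσ hρ hv₀S q1.1.1 q3.1.1 q2.1.1 q1c q3c q2c
      h01 h03 h02 h13 h12 h23.symm f0 f1 f2 f3
    have hle := hmin (_, ρ') (Finset.mem_filter.2
      ⟨Finset.mem_univ _, hσ', hρ', fun x => hkeep x (hgood x)⟩)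
    simp only [mul_assoc] at hle hlt
    omega

end Switching

section Finish
variable {n : ℕ}

/-- The extremal structure: tails, heads and colours are two-coloured, and outside small
exceptional sets almost all fitting triples are edges. The sets have size at most `a * n`, and each
exceptional element is in at least `l * n ^ 2` fitting triples. -/
structure Str (a l : ℝ) (D : Fin n → Fin n → Fin n → Prop) (τ h t : Fin n → Bool)
    (ET EH EC : Finset (Fin n)) : Prop where
  cardT : (ET.card : ℝ) ≤ a * n
  cardH : (EH.card : ℝ) ≤ a * n
  cardC : (EC.card : ℝ) ≤ a * n
  tail : ∀ v ∉ ET, ((Finset.univ.filter fun p : Fin n × Fin n => p.1 ∉ EH ∧ p.2 ∉ EC ∧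
    Even τ h t v p.1 p.2 ∧ ¬ D p.2 v p.1).card : ℝ) ≤ 1 / 10 ^ 16 * (n : ℝ) ^ 2
  head : ∀ w ∉ EH, ((Finset.univ.filter fun p : Fin n × Fin n => p.1 ∉ ET ∧ p.2 ∉ EC ∧
    Even τ h t p.1 w p.2 ∧ ¬ D p.2 p.1 w).card : ℝ) ≤ 1 / 10 ^ 16 * (n : ℝ) ^ 2
  col : ∀ i ∉ EC, ((Finset.univ.filter fun p : Fin n × Fin n => p.1 ∉ ET ∧ p.2 ∉ EH ∧
    Even τ h t p.1 p.2 i ∧ ¬ D i p.1 p.2).card : ℝ) ≤ 1 / 10 ^ 16 * (n : ℝ) ^ 2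
  capT : ∀ v ∈ ET, l * (n : ℝ) ^ 2 ≤ (Finset.univ.filter fun p : Fin n × Fin n =>
    h p.1 = τ v ∧ t p.2 = false ∧ D p.2 v p.1).card
  capH : ∀ w ∈ EH, l * (n : ℝ) ^ 2 ≤ (Finset.univ.filter fun p : Fin n × Fin n =>
    τ p.1 = h w ∧ t p.2 = false ∧ D p.2 p.1 w).card
  capC : ∀ i ∈ EC, t i = false → l * (n : ℝ) ^ 2 ≤
    (Finset.univ.filter fun p : Fin n × Fin n => τ p.1 = h p.2 ∧ D i p.1 p.2).card
  capC' : ∀ i b, t i = true → l * (n : ℝ) ^ 2 ≤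
    (Finset.univ.filter fun p : Fin n × Fin n => τ p.1 = b ∧ h p.2 = !b ∧ D i p.1 p.2).card
  sizeT : |((Finset.univ.filter fun v => τ v = false).card : ℝ) - n / 2| ≤ a * n
  sizeH : |((Finset.univ.filter fun w => h w = false).card : ℝ) - n / 2| ≤ a * n
  sizeC : (n : ℝ) / 3 ≤ (Finset.univ.filter fun i => t i = false).card

/-- A set of edges (tail, head, colour) with distinct tails, distinct heads, distinct colours. -/
structure Mat (D : Fin n → Fin n → Fin n → Prop) (M : Finset (Fin n × Fin n × Fin n)) : Prop where
  edge : ∀ x ∈ M, D x.2.2 x.1 x.2.1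
  inj₁ : ∀ x ∈ M, ∀ y ∈ M, x.1 = y.1 → x = y
  inj₂ : ∀ x ∈ M, ∀ y ∈ M, x.2.1 = y.2.1 → x = y
  inj₃ : ∀ x ∈ M, ∀ y ∈ M, x.2.2 = y.2.2 → x = y

theorem exists_perm_of_fibres {L : Type} [DecidableEq L] (f g : Fin n → L)
    (hfg : ∀ l, (Finset.univ.filter fun v => f v = l).card =
      (Finset.univ.filter fun v => g v = l).card) : ∃ π : Perm (Fin n), ∀ v, g (π v) = f v := by
  refine ⟨Equiv.ofFiberEquiv (f := f) (g := g) fun l => Fintype.equivOfCardEq ?_,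
    Equiv.ofFiberEquiv_map _⟩
  rw [Fintype.card_subtype, Fintype.card_subtype]
  exact hfg l

/-- Label of a coordinate: the triple using it (named by its tail), or its class. -/
noncomputable def lab (M : Finset (Fin n × Fin n × Fin n)) (c : Fin n × Fin n × Fin n → Fin n)
    (g : Fin n → Bool × Bool) (w : Fin n) : Fin n ⊕ (Bool × Bool) :=
  if hx : ∃ x ∈ M, c x = w then Sum.inl hx.choose.1 else Sum.inr (g w)

section Lab
variable {M : Finset (Fin n × Fin n × Fin n)} {c : Fin n × Fin n × Fin n → Fin n}
  {g : Fin n → Bool × Bool}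

theorem lab_eq_inl (hc : ∀ x ∈ M, ∀ y ∈ M, c x = c y → x = y) {w v : Fin n} :
    lab M c g w = Sum.inl v ↔ ∃ x ∈ M, c x = w ∧ x.1 = v := by
  unfold lab
  split_ifs with hx
  · have h1 := hx.choose_spec
    constructor
    · intro h2
      exact ⟨_, h1.1, h1.2, Sum.inl_injective h2⟩
    · rintro ⟨x, hxM, hxw, rfl⟩
      rw [hc _ h1.1 _ hxM (h1.2.trans hxw.symm)]
  · constructor
    · intro h2; cases h2
    · rintro ⟨x, hxM, hxw, -⟩
      exact absurd ⟨x, hxM, hxw⟩ hx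

theorem lab_eq_inr {w : Fin n} {k : Bool × Bool} :
    lab M c g w = Sum.inr k ↔ w ∉ M.image c ∧ g w = k := by
  unfold lab
  rw [Finset.mem_image]
  split_ifs with hx
  · simp [hx]
  · simp [hx]

theorem card_lab_inl (hc : ∀ x ∈ M, ∀ y ∈ M, c x = c y → x = y) (v : Fin n) :
    (Finset.univ.filter fun w => lab M c g w = Sum.inl v).card =
      (M.filter fun x => x.1 = v).card := by
  rw [← Finset.card_image_of_injOn (s := M.filter fun x => x.1 = v) (f := c)]
  · congr 1
    ext w
    simp only [Finset.mem_filter, Finset.mem_univ, true_and, lab_eq_inl hc, Finset.mem_image]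
    constructor
    · rintro ⟨x, a, b, d⟩; exact ⟨x, ⟨a, d⟩, b⟩
    · rintro ⟨x, ⟨a, d⟩, b⟩; exact ⟨x, a, b, d⟩
  · intro x hx y hy hxy
    exact hc x (Finset.mem_filter.1 hx).1 y (Finset.mem_filter.1 hy).1 hxy

theorem card_lab_inr (k : Bool × Bool) :
    (Finset.univ.filter fun w => lab M c g w = Sum.inr k).card =
      (Finset.univ.filter fun w => w ∉ M.image c ∧ g w = k).card := by
  simp only [lab_eq_inr]

end Lab

theorem exists_perm_extending {D : Fin n → Fin n → Fin n → Prop}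
    {M : Finset (Fin n × Fin n × Fin n)} (hM : Mat D M) {c : Fin n × Fin n × Fin n → Fin n}
    (hc : ∀ x ∈ M, ∀ y ∈ M, c x = c y → x = y) {gT g : Fin n → Bool × Bool}
    (hg : ∀ k, (Finset.univ.filter fun v => v ∉ M.image (fun x => x.1) ∧ gT v = k).card =
      (Finset.univ.filter fun w => w ∉ M.image c ∧ g w = k).card) :
    ∃ π : Perm (Fin n), (∀ x ∈ M, π x.1 = c x) ∧
      ∀ v ∉ M.image (fun x => x.1), π v ∉ M.image c ∧ g (π v) = gT v := by
  obtain ⟨π, hπ⟩ := exists_perm_of_fibres (lab M (fun x => x.1) gT) (lab M c g) (by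
    rintro (v | k)
    · rw [card_lab_inl hM.inj₁, card_lab_inl hc]
    · rw [card_lab_inr, card_lab_inr, hg])
  refine ⟨π, fun x hx => ?_, fun v hv => ?_⟩
  · have h1 : lab M (fun x => x.1) gT x.1 = Sum.inl x.1 :=
      (lab_eq_inl hM.inj₁).2 ⟨x, hx, rfl, rfl⟩
    rw [← hπ, lab_eq_inl hc] at h1
    obtain ⟨y, hy, h2, h3⟩ := h1
    rw [← h2, hM.inj₁ y hy x hx h3]
  · have h1 : lab M (fun x => x.1) gT v = Sum.inr (gT v) := lab_eq_inr.2 ⟨hv, rfl⟩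
    rwa [← hπ, lab_eq_inr] at h1

/-- A forced matching with balanced labels outside it extends to a transversal `1`-factor in which
every class of unforced tails lies on one cycle. -/
theorem Str.exists_factor {a l : ℝ} {D : Fin n → Fin n → Fin n → Prop} {τ h t : Fin n → Bool}
    {ET EH EC : Finset (Fin n)} (hS : Str a l D τ h t ET EH EC) (hn : 10 ^ 16 ≤ n)
    {M : Finset (Fin n × Fin n × Fin n)} (hM : Mat D M)
    (hET : ∀ v ∈ ET, v ∈ M.image fun x => x.1) (hEH : ∀ v ∈ EH, v ∈ M.image fun x => x.2.1)
    (hEC : ∀ v ∈ EC, v ∈ M.image fun x => x.2.2) {gT gH gC : Fin n → Bool × Bool}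
    (hgT : ∀ v, (gT v).1 = τ v) (hgH : ∀ w, (gH w).2 = h w)
    (hgC : ∀ i, ((gC i).1 ^^ (gC i).2) = t i)
    (hTH : ∀ k, (Finset.univ.filter fun v => v ∉ M.image (fun x => x.1) ∧ gT v = k).card =
      (Finset.univ.filter fun w => w ∉ M.image (fun x => x.2.1) ∧ gH w = k).card)
    (hTC : ∀ k, (Finset.univ.filter fun v => v ∉ M.image (fun x => x.1) ∧ gT v = k).card =
      (Finset.univ.filter fun w => w ∉ M.image (fun x => x.2.2) ∧ gC w = k).card)
    (hbig : ∀ v ∉ M.image (fun x => x.1), 1 / 40000 * (n : ℝ) ≤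
      (Finset.univ.filter fun u => u ∉ M.image (fun x => x.1) ∧ gT u = gT v).card) :
    ∃ π ψ : Perm (Fin n), (∀ v, D (ψ v) v (π v)) ∧ (∀ x ∈ M, π x.1 = x.2.1) ∧
      (∀ v ∉ M.image (fun x => x.1), π v ∉ M.image (fun x => x.2.1) ∧ gH (π v) = gT v) ∧
      ∀ u v, u ∉ M.image (fun x => x.1) → v ∉ M.image (fun x => x.1) → gT u = gT v →
        SameCycle π u v := by
  obtain ⟨π₀, hπ₀, hπ₀'⟩ := exists_perm_extending hM hM.inj₂ hTH
  obtain ⟨ψ₀, hψ₀, hψ₀'⟩ := exists_perm_extending hM hM.inj₃ hTC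
  set S := M.image fun x => x.1 with hSdef
  have hT : Typical (fun v a b => D (ψ₀ b) v (π₀ a)) gT S (1 / 10 ^ 16) := by
    have ev : ∀ v a b, v ∉ S → a ∉ S → b ∉ S → gT a = gT v → gT b = gT v →
        Even τ h t v (π₀ a) (ψ₀ b) := by
      intro v a b hv ha hb hav hbv
      unfold Even
      rw [← hgT, ← hgH, ← hgC, (hπ₀' a ha).2, (hψ₀' b hb).2, hav, hbv]
    have nT : ∀ v ∉ S, v ∉ ET := fun v hv h1 => hv (hET v h1)
    have nH : ∀ v ∉ S, π₀ v ∉ EH := fun v hv h1 => (hπ₀' v hv).1 (hEH _ h1)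
    have nC : ∀ v ∉ S, ψ₀ v ∉ EC := fun v hv h1 => (hψ₀' v hv).1 (hEC _ h1)
    refine ⟨fun v hv => ?_, fun a ha => ?_, fun b hb => ?_⟩
    · rw [Fintype.card_fin]
      refine le_trans ?_ (hS.tail v (nT v hv))
      norm_cast
      refine Finset.card_le_card_of_injOn (fun p => (π₀ p.1, ψ₀ p.2)) (fun p hp => ?_)
        fun p _ q _ hpq => ?_
      · simp only [Finset.coe_filter, Finset.mem_univ, true_and, Set.mem_ofPred_eq] at hp
        have hp' := hp
        refine Finset.mem_filter.2 ⟨Finset.mem_univ _, nH _ hp'.1, nC _ hp'.2.1,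
          ev _ _ _ hv hp'.1 hp'.2.1 hp'.2.2.1 hp'.2.2.2.1, hp'.2.2.2.2⟩
      · simp only [Prod.mk.injEq, EmbeddingLike.apply_eq_iff_eq] at hpq
        exact Prod.ext hpq.1 hpq.2
    · rw [Fintype.card_fin]
      refine le_trans ?_ (hS.head (π₀ a) (nH a ha))
      norm_cast
      refine Finset.card_le_card_of_injOn (fun p => (p.1, ψ₀ p.2)) (fun p hp => ?_)
        fun p _ q _ hpq => ?_
      · simp only [Finset.coe_filter, Finset.mem_univ, true_and, Set.mem_ofPred_eq] at hp
        have hp' := hp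
        refine Finset.mem_filter.2 ⟨Finset.mem_univ _, nT _ hp'.1, nC _ hp'.2.1,
          ev _ _ _ hp'.1 ha hp'.2.1 hp'.2.2.1.symm (hp'.2.2.2.1.trans hp'.2.2.1.symm),
          hp'.2.2.2.2⟩
      · simp only [Prod.mk.injEq, EmbeddingLike.apply_eq_iff_eq] at hpq
        exact Prod.ext hpq.1 hpq.2
    · rw [Fintype.card_fin]
      refine le_trans ?_ (hS.col (ψ₀ b) (nC b hb))
      norm_cast
      refine Finset.card_le_card_of_injOn (fun p => (p.1, π₀ p.2)) (fun p hp => ?_)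
        fun p _ q _ hpq => ?_
      · simp only [Finset.coe_filter, Finset.mem_univ, true_and, Set.mem_ofPred_eq] at hp
        have hp' := hp
        refine Finset.mem_filter.2 ⟨Finset.mem_univ _, nT _ hp'.1, nH _ hp'.2.1,
          ev _ _ _ hp'.1 hp'.2.1 hb (hp'.2.2.2.1.trans hp'.2.2.1.symm) hp'.2.2.1.symm,
          hp'.2.2.2.2⟩
      · simp only [Prod.mk.injEq, EmbeddingLike.apply_eq_iff_eq] at hpq
        exact Prod.ext hpq.1 hpq.2
  obtain ⟨σ, ρ, hσ, hρ, hgood, hcyc⟩ := exists_adm_good_sameCycle hT (ζ := 1 / 40000)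
    (by norm_num) (by norm_num) (by norm_num)
    (by rw [Fintype.card_fin]; norm_num; exact_mod_cast hn)
    (by
      intro v hv
      obtain ⟨x, hx, rfl⟩ := Finset.mem_image.1 hv
      rw [hπ₀ x hx, hψ₀ x hx]
      exact hM.edge x hx)
    (by
      intro v hv
      rw [Fintype.card_fin]
      convert hbig v hv) π₀
  refine ⟨π₀ * σ, ψ₀ * ρ, hgood, fun x hx => ?_, fun v hv => ?_, hcyc⟩
  · rw [Perm.mul_apply, hσ.fix _ (Finset.mem_image_of_mem _ hx), hπ₀ x hx]
  · have h1 := hπ₀' (σ v) (hσ.notMem hv)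
    rw [hσ.cls] at h1
    exact h1

end Finish

/-- Greedy choice of pairwise disjoint pairs avoiding a given set. -/
theorem exists_disjoint_pairs {J R : Type} [Nonempty R] (s : Finset J) (Ω : J → R → R → Prop)
    (U₀ : Finset R)
    (hΩ : ∀ j ∈ s, ∀ U : Finset R, U.card ≤ U₀.card + 2 * s.card →
      ∃ p q, Ω j p q ∧ p ≠ q ∧ p ∉ U ∧ q ∉ U) :
    ∃ f g : J → R, (∀ j ∈ s, Ω j (f j) (g j) ∧ f j ≠ g j ∧ f j ∉ U₀ ∧ g j ∉ U₀) ∧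
      ∀ j ∈ s, ∀ k ∈ s, j ≠ k → f j ≠ f k ∧ f j ≠ g k ∧ g j ≠ f k ∧ g j ≠ g k := by
  induction s using Finset.induction_on with
  | empty => exact ⟨fun _ => Classical.arbitrary R, fun _ => Classical.arbitrary R, by simp, by simp⟩
  | insert a s ha ih =>
    obtain ⟨f, g, h1, h2⟩ := ih fun j hj U hU => hΩ j (Finset.mem_insert_of_mem hj) U
      (hU.trans (by rw [Finset.card_insert_of_notMem ha]; omega))
    obtain ⟨p, q, h3, h4, h5, h6⟩ := hΩ a (Finset.mem_insert_self _ _)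
      (U₀ ∪ (s.image f ∪ s.image g)) (by
        have e1 := Finset.card_union_le U₀ (s.image f ∪ s.image g)
        have e2 := Finset.card_union_le (s.image f) (s.image g)
        have e3 := Finset.card_image_le (s := s) (f := f)
        have e4 := Finset.card_image_le (s := s) (f := g)
        rw [Finset.card_insert_of_notMem ha]; omega)
    simp only [Finset.mem_union, Finset.mem_image, not_or, not_exists, not_and] at h5 h6
    have hne : ∀ j ∈ s, j ≠ a := fun j hj e => ha (e ▸ hj)
    refine ⟨Function.update f a p, Function.update g a q, fun j hj => ?_, fun j hj k hk hjk => ?_⟩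
    · rcases Finset.mem_insert.1 hj with rfl | hj'
      · simp [h3, h4, h5.1, h6.1]
      · simpa [hne j hj'] using h1 j hj'
    · rcases Finset.mem_insert.1 hj with rfl | hj' <;> rcases Finset.mem_insert.1 hk with rfl | hk'
      · exact absurd rfl hjk
      · have n1 := hne k hk'
        simp only [Function.update_self, Function.update_of_ne n1]
        exact ⟨fun e => h5.2.1 k hk' e.symm, fun e => h5.2.2 k hk' e.symm,
          fun e => h6.2.1 k hk' e.symm, fun e => h6.2.2 k hk' e.symm⟩
      · have n1 := hne j hj'
        simp only [Function.update_self, Function.update_of_ne n1]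
        exact ⟨h5.2.1 j hj', h6.2.1 j hj', h5.2.2 j hj', h6.2.2 j hj'⟩
      · simpa [hne j hj', hne k hk'] using h2 j hj' k hk' hjk

section Cover
variable {n : ℕ}

/-- A set of more than `(|A| + |B|) n` pairs has a member outside `A × univ ∪ univ × B`. -/
theorem exists_pair_avoiding (P : Fin n × Fin n → Prop) [DecidablePred P] (A B : Finset (Fin n))
    (hP : (A.card + B.card) * n < (Finset.univ.filter P).card) :
    ∃ p, P p ∧ p.1 ∉ A ∧ p.2 ∉ B := by
  by_contra! hc
  have h1 : Finset.univ.filter P ⊆ A ×ˢ Finset.univ ∪ Finset.univ ×ˢ B := by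
    intro p hp
    rw [Finset.mem_filter] at hp
    by_cases hA : p.1 ∈ A
    · simp [hA]
    · simp [hc p hp.2 hA]
  have h2 := (Finset.card_le_card h1).trans (Finset.card_union_le _ _)
  simp only [Finset.card_product, Finset.card_univ, Fintype.card_fin] at h2
  nlinarith

/-- The three ways in which an added triple covers an exceptional element. -/
inductive Added (τ h t : Fin n → Bool) (ET EH EC UV UC : Finset (Fin n)) (b : Fin n → Bool)
    (TM HM : Finset (Fin n)) : Fin n × Fin n × Fin n → Prop
  | tail {x} : x.1 ∈ ET → x.2.1 ∉ UV → x.2.1 ∉ TM → x.2.2 ∉ UC → h x.2.1 = τ x.1 →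
      t x.2.2 = false → Added τ h t ET EH EC UV UC b TM HM x
  | head {x} : x.2.1 ∈ EH → x.1 ∉ UV → x.1 ∉ HM → x.2.2 ∉ UC → τ x.1 = h x.2.1 →
      t x.2.2 = false → Added τ h t ET EH EC UV UC b TM HM x
  | col {x} : x.2.2 ∈ EC → x.1 ∉ UV → x.1 ∉ HM → x.2.1 ∉ UV → x.2.1 ∉ TM →
      (t x.2.2 = false → τ x.1 = h x.2.1) →
      (t x.2.2 = true → τ x.1 = b x.2.2 ∧ h x.2.1 = !(b x.2.2)) →
      Added τ h t ET EH EC UV UC b TM HM x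

/-- Admissible pairs of further coordinates for covering a tail, a head or a colour. -/
def Fits (D : Fin n → Fin n → Fin n → Prop) (τ h t b : Fin n → Bool) :
    Fin n ⊕ Fin n ⊕ Fin n → Fin n ⊕ Fin n → Fin n ⊕ Fin n → Prop
  | .inl v, p, q => ∃ w i, p = .inl w ∧ q = .inr i ∧ h w = τ v ∧ t i = false ∧ D i v w
  | .inr (.inl w), p, q => ∃ v i, p = .inl v ∧ q = .inr i ∧ τ v = h w ∧ t i = false ∧ D i v w
  | .inr (.inr i), p, q => ∃ v w, p = .inl v ∧ q = .inl w ∧ (t i = false → τ v = h w) ∧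
      (t i = true → τ v = b i ∧ h w = !(b i)) ∧ D i v w

/-- The triple formed by a demand and two further coordinates. -/
def trip : Fin n ⊕ Fin n ⊕ Fin n → Fin n ⊕ Fin n → Fin n ⊕ Fin n → Fin n × Fin n × Fin n
  | .inl v, p, q => (v, p.elim id id, q.elim id id)
  | .inr (.inl w), p, q => (p.elim id id, w, q.elim id id)
  | .inr (.inr i), p, q => (p.elim id id, q.elim id id, i)

/-- Every matching extends to one covering all exceptional elements by even edges. -/
theorem Str.exists_cover {a l : ℝ} {D : Fin n → Fin n → Fin n → Prop} {τ h t : Fin n → Bool}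
    {ET EH EC : Finset (Fin n)} (hS : Str a l D τ h t ET EH EC)
    (hloop : ∀ i v, ¬ D i v v)
    {O : Finset (Fin n × Fin n × Fin n)} (hO : Mat D O) (KC UV UC : Finset (Fin n))
    (hKC : EC ⊆ KC) (hKC' : ∀ i ∈ KC, t i = false → i ∈ EC)
    (hUV : ET ∪ EH ∪ (O.image fun x => x.1) ∪ (O.image fun x => x.2.1) ⊆ UV)
    (hUC : KC ∪ (O.image fun x => x.2.2) ⊆ UC) (b : Fin n → Bool)
    (hsize : 2 * ((UV.card : ℝ) + UC.card + 2 * (ET.card + EH.card + KC.card)) < l * n) :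
    ∃ M, Mat D M ∧ O ⊆ M ∧ (∀ v ∈ ET, v ∈ M.image fun x => x.1) ∧
      (∀ v ∈ EH, v ∈ M.image fun x => x.2.1) ∧ (∀ v ∈ KC, v ∈ M.image fun x => x.2.2) ∧
      M.card ≤ O.card + (ET.card + EH.card + KC.card) ∧
      ∀ x ∈ M, x ∉ O → Added τ h t ET EH KC UV UC b (M.image fun x => x.1)
        (M.image fun x => x.2.1) x := by
  have hn : 0 < n := by
    rcases Nat.eq_zero_or_pos n with rfl | h0
    · exfalso
      norm_num at hsize
      have := hsize.not_ge
      apply this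
      positivity
    · exact h0
  have : Nonempty (Fin n ⊕ Fin n) := ⟨.inl ⟨0, hn⟩⟩
  have hnR : (0 : ℝ) < n := by exact_mod_cast hn
  set s : Finset (Fin n ⊕ Fin n ⊕ Fin n) := (ET \ O.image fun x => x.1).disjSum
    ((EH \ O.image fun x => x.2.1).disjSum (KC \ O.image fun x => x.2.2)) with hs
  have hscard : s.card ≤ ET.card + EH.card + KC.card := by
    have e1 := Finset.card_le_card (Finset.sdiff_subset (s := ET) (t := O.image fun x => x.1))
    have e2 := Finset.card_le_card (Finset.sdiff_subset (s := EH) (t := O.image fun x => x.2.1))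
    have e3 := Finset.card_le_card (Finset.sdiff_subset (s := KC) (t := O.image fun x => x.2.2))
    rw [hs, Finset.card_disjSum, Finset.card_disjSum]
    omega
  obtain ⟨f, g, hfg, hdis⟩ := exists_disjoint_pairs s (Fits D τ h t b) (UV.disjSum UC) (by
    intro j hj U hU
    rw [Finset.card_disjSum] at hU
    have hU2 := U.card_toLeft_add_card_toRight
    have hU3 : ((U.toLeft.card : ℝ) + U.toRight.card) * (2 * n) < l * n ^ 2 := by
      have : ((U.toLeft.card : ℝ) + U.toRight.card) ≤
          (UV.card : ℝ) + UC.card + 2 * (ET.card + EH.card + KC.card) := by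
        exact_mod_cast (hU2.trans_le hU).trans (by omega)
      nlinarith
    have hcnt : ∀ m : ℕ, l * (n : ℝ) ^ 2 ≤ m → ((U.toLeft.card + U.toRight.card) * n < m) ∧
        (U.toLeft.card + U.toLeft.card) * n < m := by
      intro m hm
      have e1 : (0 : ℝ) ≤ U.toRight.card * n := by positivity
      have e2 : (0 : ℝ) ≤ U.toLeft.card * n := by positivity
      constructor <;> (rw [← Nat.cast_lt (α := ℝ)]; push_cast; linarith)
    rw [hs] at hj
    rcases j with v | w | i
    · have hv : v ∈ ET := by simpa using (Finset.mem_sdiff.1 (Finset.inl_mem_disjSum.1 hj)).1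
      obtain ⟨p, hp, h1, h2⟩ := exists_pair_avoiding _ _ _ (hcnt _ (hS.capT v hv)).1
      exact ⟨.inl p.1, .inr p.2, ⟨_, _, rfl, rfl, hp⟩, by simp, by simpa using h1, by simpa using h2⟩
    · have hv : w ∈ EH := by
        simp only [Finset.inr_mem_disjSum, Finset.inl_mem_disjSum, Finset.mem_sdiff] at hj
        exact hj.1
      obtain ⟨p, hp, h1, h2⟩ := exists_pair_avoiding _ _ _ (hcnt _ (hS.capH w hv)).1
      exact ⟨.inl p.1, .inr p.2, ⟨_, _, rfl, rfl, hp⟩, by simp, by simpa using h1, by simpa using h2⟩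
    · have hv : i ∈ KC := by
        simp only [Finset.inr_mem_disjSum, Finset.mem_sdiff] at hj
        exact hj.1
      cases hti : t i
      · obtain ⟨p, hp, h1, h2⟩ := exists_pair_avoiding _ _ _
          (hcnt _ (hS.capC i (hKC' i hv hti) hti)).2
        refine ⟨.inl p.1, .inl p.2, ⟨_, _, rfl, rfl, fun _ => hp.1, ?_, hp.2⟩, ?_,
          by simpa using h1, by simpa using h2⟩
        · rw [hti]; simp
        · intro e
          rw [Sum.inl.injEq] at e
          exact hloop i p.1 (by simpa [← e] using hp.2)
      · obtain ⟨p, hp, h1, h2⟩ := exists_pair_avoiding _ _ _ (hcnt _ (hS.capC' i (b i) hti)).2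
        refine ⟨.inl p.1, .inl p.2, ⟨_, _, rfl, rfl, ?_, fun _ => ⟨hp.1, hp.2.1⟩, hp.2.2⟩, ?_,
          by simpa using h1, by simpa using h2⟩
        · rw [hti]; simp
        · intro e
          rw [Sum.inl.injEq] at e
          exact hloop i p.1 (by simpa [← e] using hp.2.2))
  have hsub : ∀ v, v ∉ UV → v ∉ ET ∧ v ∉ EH ∧ (∀ x ∈ O, x.1 ≠ v) ∧ ∀ x ∈ O, x.2.1 ≠ v := by
    intro v hv
    have h1 : ¬ _ := fun h => hv (hUV h)
    simp only [Finset.mem_union, Finset.mem_image, not_or, not_exists, not_and] at h1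
    exact ⟨h1.1.1.1, h1.1.1.2, h1.1.2, h1.2⟩
  have hsubC : ∀ v, v ∉ UC → v ∉ KC ∧ (∀ x ∈ O, x.2.2 ≠ v) := by
    intro v hv
    have h1 : ¬ _ := fun h => hv (hUC h)
    simp only [Finset.mem_union, Finset.mem_image, not_or, not_exists, not_and] at h1
    exact h1
  have hsT : ∀ v, Sum.inl v ∈ s ↔ v ∈ ET ∧ ∀ x ∈ O, x.1 ≠ v := by
    intro v
    rw [hs, Finset.inl_mem_disjSum]
    simp only [Finset.mem_sdiff, Finset.mem_image, not_exists, not_and]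
  have hsH : ∀ v, Sum.inr (Sum.inl v) ∈ s ↔ v ∈ EH ∧ ∀ x ∈ O, x.2.1 ≠ v := by
    intro v
    rw [hs, Finset.inr_mem_disjSum, Finset.inl_mem_disjSum]
    simp only [Finset.mem_sdiff, Finset.mem_image, not_exists, not_and]
  have hsC : ∀ v, Sum.inr (Sum.inr v) ∈ s ↔ v ∈ KC ∧ ∀ x ∈ O, x.2.2 ≠ v := by
    intro v
    rw [hs, Finset.inr_mem_disjSum, Finset.inr_mem_disjSum]
    simp only [Finset.mem_sdiff, Finset.mem_image, not_exists, not_and]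
  have hUVT : ∀ v ∈ ET, v ∈ UV := fun v hv => by_contra fun h1 => (hsub v h1).1 hv
  have hUVH : ∀ v ∈ EH, v ∈ UV := fun v hv => by_contra fun h1 => (hsub v h1).2.1 hv
  have hUCK : ∀ v ∈ KC, v ∈ UC := fun v hv => by_contra fun h1 => (hsubC v h1).1 hv
  have hinj : ∀ c : Fin n ⊕ Fin n ⊕ Fin n → Fin n ⊕ Fin n,
      (∀ j ∈ s, ∀ k ∈ s, c j = c k → c j ∈ UV.disjSum UC → c k ∈ UV.disjSum UC → j = k) →
      (∀ j ∈ s, c j ∈ UV.disjSum UC ∨ c j = f j ∨ c j = g j) →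
      ∀ j ∈ s, ∀ k ∈ s, c j = c k → j = k := by
    intro c h1 h2 j hj k hk hjk
    by_contra hne
    obtain ⟨d1, d2, d3, d4⟩ := hdis j hj k hk hne
    obtain ⟨-, -, e1, e2⟩ := hfg j hj
    obtain ⟨-, -, e3, e4⟩ := hfg k hk
    have h3 := h1 j hj k hk hjk
    rcases h2 j hj with h4 | h4 | h4 <;> rcases h2 k hk with h5 | h5 | h5 <;> grind
  have hT : ∀ j ∈ s, (∃ v, j = .inl v ∧ v ∈ UV ∧ (trip j (f j) (g j)).1 = v) ∨
      Sum.inl (trip j (f j) (g j)).1 = f j := by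
    intro j hj
    obtain ⟨hfit, -⟩ := hfg j hj
    rcases j with v | w | i
    · exact Or.inl ⟨v, rfl, hUVT v ((hsT v).1 hj).1, rfl⟩
    · obtain ⟨v, i, hp, hq, -⟩ := hfit
      exact Or.inr (by simp [trip, hp])
    · obtain ⟨v, i, hp, hq, -⟩ := hfit
      exact Or.inr (by simp [trip, hp])
  have hH : ∀ j ∈ s, (∃ w, j = .inr (.inl w) ∧ w ∈ UV ∧ (trip j (f j) (g j)).2.1 = w) ∨
      Sum.inl (trip j (f j) (g j)).2.1 = f j ∨ Sum.inl (trip j (f j) (g j)).2.1 = g j := by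
    intro j hj
    obtain ⟨hfit, -⟩ := hfg j hj
    rcases j with v | w | i
    · obtain ⟨v, i, hp, hq, -⟩ := hfit
      exact Or.inr (Or.inl (by simp [trip, hp]))
    · exact Or.inl ⟨w, rfl, hUVH w ((hsH w).1 hj).1, rfl⟩
    · obtain ⟨v, i, hp, hq, -⟩ := hfit
      exact Or.inr (Or.inr (by simp [trip, hq]))
  have hC : ∀ j ∈ s, (∃ i, j = .inr (.inr i) ∧ i ∈ UC ∧ (trip j (f j) (g j)).2.2 = i) ∨
      Sum.inr (trip j (f j) (g j)).2.2 = g j := by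
    intro j hj
    obtain ⟨hfit, -⟩ := hfg j hj
    rcases j with v | w | i
    · obtain ⟨v, i, hp, hq, -⟩ := hfit
      exact Or.inr (by simp [trip, hq])
    · obtain ⟨v, i, hp, hq, -⟩ := hfit
      exact Or.inr (by simp [trip, hq])
    · exact Or.inl ⟨i, rfl, hUCK i ((hsC i).1 hj).1, rfl⟩
  have hTinj : ∀ j ∈ s, ∀ k ∈ s, (trip j (f j) (g j)).1 = (trip k (f k) (g k)).1 → j = k := by
    intro j hj k hk hjk
    refine hinj (fun j => .inl (trip j (f j) (g j)).1) (fun j hj k hk hjk h1 h2 => ?_)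
      (fun j hj => ?_) j hj k hk (congrArg _ hjk)
    · rcases hT j hj with ⟨v, rfl, -, e⟩ | e
      · rcases hT k hk with ⟨v', rfl, -, e'⟩ | e'
        · simp only [Sum.inl.injEq] at hjk
          rw [← e, ← e', hjk]
        · simp only [e'] at h2; exact absurd h2 (hfg k hk).2.2.1
      · simp only [e] at h1; exact absurd h1 (hfg j hj).2.2.1
    · rcases hT j hj with ⟨v, rfl, h1, e⟩ | e
      · left; simpa [e] using h1
      · exact Or.inr (Or.inl e)
  have hHinj : ∀ j ∈ s, ∀ k ∈ s, (trip j (f j) (g j)).2.1 = (trip k (f k) (g k)).2.1 → j = k := by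
    intro j hj k hk hjk
    refine hinj (fun j => .inl (trip j (f j) (g j)).2.1) (fun j hj k hk hjk h1 h2 => ?_)
      (fun j hj => ?_) j hj k hk (congrArg _ hjk)
    · rcases hH j hj with ⟨v, rfl, -, e⟩ | e | e
      · rcases hH k hk with ⟨v', rfl, -, e'⟩ | e' | e'
        · simp only [Sum.inl.injEq] at hjk
          rw [← e, ← e', hjk]
        · simp only [e'] at h2; exact absurd h2 (hfg k hk).2.2.1
        · simp only [e'] at h2; exact absurd h2 (hfg k hk).2.2.2
      · simp only [e] at h1; exact absurd h1 (hfg j hj).2.2.1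
      · simp only [e] at h1; exact absurd h1 (hfg j hj).2.2.2
    · rcases hH j hj with ⟨v, rfl, h1, e⟩ | e
      · left; simpa [e] using h1
      · exact Or.inr e
  have hCinj : ∀ j ∈ s, ∀ k ∈ s, (trip j (f j) (g j)).2.2 = (trip k (f k) (g k)).2.2 → j = k := by
    intro j hj k hk hjk
    refine hinj (fun j => .inr (trip j (f j) (g j)).2.2) (fun j hj k hk hjk h1 h2 => ?_)
      (fun j hj => ?_) j hj k hk (congrArg _ hjk)
    · rcases hC j hj with ⟨v, rfl, -, e⟩ | e
      · rcases hC k hk with ⟨v', rfl, -, e'⟩ | e'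
        · simp only [Sum.inr.injEq] at hjk
          rw [← e, ← e', hjk]
        · simp only [e'] at h2; exact absurd h2 (hfg k hk).2.2.2
      · simp only [e] at h1; exact absurd h1 (hfg j hj).2.2.2
    · rcases hC j hj with ⟨v, rfl, h1, e⟩ | e
      · left; simpa [e] using h1
      · exact Or.inr (Or.inr e)
  have hOne : ∀ j ∈ s, ∀ x ∈ O, x.1 ≠ (trip j (f j) (g j)).1 ∧
      x.2.1 ≠ (trip j (f j) (g j)).2.1 ∧ x.2.2 ≠ (trip j (f j) (g j)).2.2 := by
    intro j hj x hx
    obtain ⟨-, -, e1, e2⟩ := hfg j hj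
    refine ⟨?_, ?_, ?_⟩
    · rcases hT j hj with ⟨v, rfl, -, e⟩ | e
      · exact ((hsT v).1 hj).2 x hx
      · rw [← e, Finset.inl_mem_disjSum] at e1
        exact (hsub _ e1).2.2.1 x hx
    · rcases hH j hj with ⟨v, rfl, -, e⟩ | e | e
      · exact ((hsH v).1 hj).2 x hx
      · rw [← e, Finset.inl_mem_disjSum] at e1
        exact (hsub _ e1).2.2.2 x hx
      · rw [← e, Finset.inl_mem_disjSum] at e2
        exact (hsub _ e2).2.2.2 x hx
    · rcases hC j hj with ⟨v, rfl, -, e⟩ | e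
      · exact ((hsC v).1 hj).2 x hx
      · rw [← e, Finset.inr_mem_disjSum] at e2
        exact (hsubC _ e2).2 x hx
  have hedge : ∀ j ∈ s, D (trip j (f j) (g j)).2.2 (trip j (f j) (g j)).1 (trip j (f j) (g j)).2.1 := by
    intro j hj
    obtain ⟨hfit, -⟩ := hfg j hj
    rcases j with v | w | i
    · obtain ⟨w, i, hp, hq, -, -, hD⟩ := hfit
      simpa [trip, hp, hq] using hD
    · obtain ⟨w, i, hp, hq, -, -, hD⟩ := hfit
      simpa [trip, hp, hq] using hD
    · obtain ⟨w, i, hp, hq, -, -, hD⟩ := hfit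
      simpa [trip, hp, hq] using hD
  set F := fun j => trip j (f j) (g j) with hF
  have hmem : ∀ x ∈ O ∪ s.image F, x ∈ O ∨ ∃ j ∈ s, F j = x := by
    intro x hx
    simpa [Finset.mem_union] using hx
  refine ⟨O ∪ s.image F, ⟨fun x hx => ?_, fun x hx y hy hxy => ?_, fun x hx y hy hxy => ?_,
    fun x hx y hy hxy => ?_⟩, Finset.subset_union_left, fun v hv => ?_, fun v hv => ?_,
    fun v hv => ?_, ?_, fun x hx hxO => ?_⟩
  · rcases hmem x hx with h1 | ⟨j, hj, rfl⟩
    · exact hO.edge x h1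
    · exact hedge j hj
  · rcases hmem x hx with h1 | ⟨j, hj, rfl⟩ <;> rcases hmem y hy with h2 | ⟨k, hk, rfl⟩
    · exact hO.inj₁ x h1 y h2 hxy
    · exact absurd hxy (hOne k hk x h1).1
    · exact absurd hxy.symm (hOne j hj y h2).1
    · rw [hTinj j hj k hk hxy]
  · rcases hmem x hx with h1 | ⟨j, hj, rfl⟩ <;> rcases hmem y hy with h2 | ⟨k, hk, rfl⟩
    · exact hO.inj₂ x h1 y h2 hxy
    · exact absurd hxy (hOne k hk x h1).2.1
    · exact absurd hxy.symm (hOne j hj y h2).2.1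
    · rw [hHinj j hj k hk hxy]
  · rcases hmem x hx with h1 | ⟨j, hj, rfl⟩ <;> rcases hmem y hy with h2 | ⟨k, hk, rfl⟩
    · exact hO.inj₃ x h1 y h2 hxy
    · exact absurd hxy (hOne k hk x h1).2.2
    · exact absurd hxy.symm (hOne j hj y h2).2.2
    · rw [hCinj j hj k hk hxy]
  · rw [Finset.mem_image]
    by_cases h1 : ∃ x ∈ O, x.1 = v
    · obtain ⟨x, hx, hxv⟩ := h1
      exact ⟨x, Finset.mem_union_left _ hx, hxv⟩
    · push Not at h1
      exact ⟨_, Finset.mem_union_right _ (Finset.mem_image_of_mem _ ((hsT v).2 ⟨hv, h1⟩)), rfl⟩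
  · rw [Finset.mem_image]
    by_cases h1 : ∃ x ∈ O, x.2.1 = v
    · obtain ⟨x, hx, hxv⟩ := h1
      exact ⟨x, Finset.mem_union_left _ hx, hxv⟩
    · push Not at h1
      exact ⟨_, Finset.mem_union_right _ (Finset.mem_image_of_mem _ ((hsH v).2 ⟨hv, h1⟩)), rfl⟩
  · rw [Finset.mem_image]
    by_cases h1 : ∃ x ∈ O, x.2.2 = v
    · obtain ⟨x, hx, hxv⟩ := h1
      exact ⟨x, Finset.mem_union_left _ hx, hxv⟩
    · push Not at h1
      exact ⟨_, Finset.mem_union_right _ (Finset.mem_image_of_mem _ ((hsC v).2 ⟨hv, h1⟩)), rfl⟩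
  · have e1 := Finset.card_union_le O (s.image F)
    have e2 := Finset.card_image_le (s := s) (f := F)
    omega
  · obtain h1 | ⟨j, hj, rfl⟩ := hmem x hx
    · exact absurd h1 hxO
    obtain ⟨hfit, hne, hf, hg⟩ := hfg j hj
    have hfg' : ∀ v k, k ∈ s → (.inl v = f j ∨ .inl v = g j) → (.inl v = f k ∨ .inl v = g k) →
        k = j := by
      intro v k hk h1 h2
      by_contra h3
      obtain ⟨d1, d2, d3, d4⟩ := hdis k hk j hj h3
      grind
    have hfU : ∀ v, (.inl v = f j ∨ .inl v = g j) → v ∉ UV := by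
      intro v hv
      rcases hv with e | e
      · rwa [← e, Finset.inl_mem_disjSum] at hf
      · rwa [← e, Finset.inl_mem_disjSum] at hg
    have hfT : ∀ v, (.inl v = f j ∨ .inl v = g j) → v ∈ (O ∪ s.image F).image (fun x => x.1) →
        v = (F j).1 := by
      intro v hv hmem'
      have hvU := hfU v hv
      obtain ⟨y, hy, rfl⟩ := Finset.mem_image.1 hmem'
      rcases hmem y hy with h1 | ⟨k, hk, rfl⟩
      · exact absurd rfl ((hsub _ hvU).2.2.1 y h1)
      · rcases hT k hk with ⟨v', rfl, h2, e⟩ | e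
        · rw [← e] at h2; exact absurd h2 hvU
        · rw [hfg' _ k hk hv (Or.inl e)]
    have hfH : ∀ v, (.inl v = f j ∨ .inl v = g j) → v ∈ (O ∪ s.image F).image (fun x => x.2.1) →
        v = (F j).2.1 := by
      intro v hv hmem'
      have hvU := hfU v hv
      obtain ⟨y, hy, rfl⟩ := Finset.mem_image.1 hmem'
      rcases hmem y hy with h1 | ⟨k, hk, rfl⟩
      · exact absurd rfl ((hsub _ hvU).2.2.2 y h1)
      · rcases hH k hk with ⟨v', rfl, h2, e⟩ | e
        · rw [← e] at h2; exact absurd h2 hvU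
        · have e' : Sum.inl (F k).2.1 = f k ∨ Sum.inl (F k).2.1 = g k := e
          rw [hfg' _ k hk hv e']
    have hloop' : (F j).1 ≠ (F j).2.1 := by
      intro e
      have := hedge j hj
      rw [hF] at e
      simp only at e
      rw [e] at this
      exact hloop _ _ this
    rcases j with v | w | i
    · obtain ⟨w, i, hp, hq, h1, h2, hD⟩ := hfit
      have e1 : (F (.inl v)) = (v, w, i) := by simp [hF, trip, hp, hq]
      have e2 : i ∉ UC := by rwa [hq, Finset.inr_mem_disjSum] at hg
      have e3 := hfT w (Or.inl hp.symm)
      rw [e1] at hloop' e3 ⊢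
      exact .tail ((hsT v).1 hj).1 (hfU w (Or.inl hp.symm)) (fun h3 => hloop' (e3 h3).symm) e2 h1 h2
    · obtain ⟨v, i, hp, hq, h1, h2, hD⟩ := hfit
      have e1 : (F (.inr (.inl w))) = (v, w, i) := by simp [hF, trip, hp, hq]
      have e2 : i ∉ UC := by rwa [hq, Finset.inr_mem_disjSum] at hg
      have e3 := hfH v (Or.inl hp.symm)
      rw [e1] at hloop' e3 ⊢
      exact .head ((hsH w).1 hj).1 (hfU v (Or.inl hp.symm)) (fun h3 => hloop' (e3 h3)) e2 h1 h2
    · obtain ⟨v, w, hp, hq, h1, h2, hD⟩ := hfit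
      have e1 : (F (.inr (.inr i))) = (v, w, i) := by simp [hF, trip, hp, hq]
      have e3 := hfH v (Or.inl hp.symm)
      have e4 := hfT w (Or.inr hq.symm)
      rw [e1] at hloop' e3 e4 ⊢
      exact .col ((hsC i).1 hj).1 (hfU v (Or.inl hp.symm)) (fun h3 => hloop' (e3 h3))
        (hfU w (Or.inr hq.symm)) (fun h3 => hloop' (e4 h3).symm) h1 h2

end Cover

section Correction
variable {n : ℕ}

/-- Split the two classes of `τ` outside `S` into parts of given sizes, with prescribed values
on a small set `P`. -/
theorem exists_split (S P : Finset (Fin n)) (hPS : ∀ v ∈ P, v ∉ S) (τ : Fin n → Bool)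
    (N : Bool → Bool → ℕ)
    (hN : ∀ a, N a false + N a true = (Finset.univ.filter fun v => v ∉ S ∧ τ v = a).card)
    (hP : ∀ a b, P.card ≤ N a b) (pp : Fin n → Bool) :
    ∃ g : Fin n → Bool, (∀ v ∈ P, g v = pp v) ∧
      ∀ a b, (Finset.univ.filter fun v => v ∉ S ∧ τ v = a ∧ g v = b).card = N a b := by
  have h1 : ∀ a, ∃ A : Finset (Fin n), (P.filter fun v => τ v = a ∧ pp v = true) ⊆ A ∧
      A ⊆ (Finset.univ.filter fun v => v ∉ S ∧ τ v = a) \ (P.filter fun v => pp v = false) ∧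
      A.card = N a true := by
    intro a
    refine Finset.exists_subsuperset_card_eq (fun v hv => ?_)
      ((Finset.card_filter_le _ _).trans (hP a true)) ?_
    · rw [Finset.mem_filter] at hv
      simp [hv.1, hv.2, hPS v hv.1]
    · have e1 := Finset.le_card_sdiff (P.filter fun v => pp v = false)
        (Finset.univ.filter fun v => v ∉ S ∧ τ v = a)
      have e2 := Finset.card_filter_le P (fun v => pp v = false)
      have e3 := hP a false
      have e4 := hN a
      omega
  choose A hA1 hA2 hA3 using h1
  have hA4 : ∀ a v, v ∈ A a → v ∉ S ∧ τ v = a ∧ (v ∈ P → pp v ≠ false) := by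
    intro a v hv
    have := hA2 a hv
    simp only [Finset.mem_sdiff, Finset.mem_filter, Finset.mem_univ, true_and, not_and] at this
    exact ⟨this.1.1, this.1.2, this.2⟩
  have ht : ∀ a, (Finset.univ.filter fun v => v ∉ S ∧ τ v = a ∧ decide (v ∈ A (τ v)) = true) =
      A a := by
    intro a
    ext v
    simp only [Finset.mem_filter, Finset.mem_univ, true_and, decide_eq_true_eq]
    constructor
    · rintro ⟨-, rfl, h⟩; exact h
    · intro h
      obtain ⟨e1, rfl, -⟩ := hA4 a v h
      exact ⟨e1, rfl, h⟩
  refine ⟨fun v => decide (v ∈ A (τ v)), fun v hv => ?_, fun a b => ?_⟩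
  · cases hp : pp v
    · rw [decide_eq_false_iff_not]
      exact fun h => (hA4 _ v h).2.2 hv hp
    · rw [decide_eq_true_eq]
      exact hA1 _ (Finset.mem_filter.2 ⟨hv, rfl, hp⟩)
  · cases b
    · have e1 : (Finset.univ.filter fun v => v ∉ S ∧ τ v = a ∧ decide (v ∈ A (τ v)) = false) =
          (Finset.univ.filter fun v => v ∉ S ∧ τ v = a) \ A a := by
        rw [← ht a]
        ext v
        simp only [Finset.mem_filter, Finset.mem_univ, true_and, Finset.mem_sdiff]
        grind
      have e2 : A a ⊆ Finset.univ.filter fun v => v ∉ S ∧ τ v = a :=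
        (hA2 a).trans Finset.sdiff_subset
      rw [e1, Finset.card_sdiff_of_subset e2, hA3, ← hN a]
      omega
    · rw [ht, hA3]

/-- A matching covering the exceptional elements, and class sizes compatible with it, give a
transversal `1`-factor in which every class of unforced tails lies on one cycle. -/
theorem Str.finish {a l : ℝ} {D : Fin n → Fin n → Fin n → Prop} {τ h t : Fin n → Bool}
    {ET EH EC : Finset (Fin n)} (hS : Str a l D τ h t ET EH EC) (hn : 10 ^ 16 ≤ n)
    {M : Finset (Fin n × Fin n × Fin n)} (hM : Mat D M)
    (hET : ∀ v ∈ ET, v ∈ M.image fun x => x.1) (hEH : ∀ v ∈ EH, v ∈ M.image fun x => x.2.1)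
    (hEC : ∀ v ∈ EC, v ∈ M.image fun x => x.2.2) (N : Bool → Bool → ℕ)
    (hNT : ∀ a, N a false + N a true =
      (Finset.univ.filter fun v => v ∉ M.image (fun x => x.1) ∧ τ v = a).card)
    (hNH : ∀ b, N false b + N true b =
      (Finset.univ.filter fun v => v ∉ M.image (fun x => x.2.1) ∧ h v = b).card)
    (hNC : ∀ c, N false c + N true (!c) =
      (Finset.univ.filter fun v => v ∉ M.image (fun x => x.2.2) ∧ t v = c).card)
    (hN : ∀ a b, N a b = 0 ∨ 1 / 40000 * (n : ℝ) ≤ N a b)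
    (P : Finset (Fin n)) (hPT : ∀ v ∈ P, v ∉ M.image fun x => x.1)
    (hPH : ∀ v ∈ P, v ∉ M.image fun x => x.2.1) (hP : ∀ a b, P.card ≤ N a b)
    (pp qq : Fin n → Bool) :
    ∃ (π ψ : Perm (Fin n)) (p q : Fin n → Bool), (∀ v, D (ψ v) v (π v)) ∧
      (∀ x ∈ M, π x.1 = x.2.1) ∧
      (∀ v ∉ M.image (fun x => x.1), π v ∉ M.image (fun x => x.2.1) ∧ q (π v) = τ v ∧
        h (π v) = p v ∧ N (τ v) (p v) ≠ 0) ∧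
      (∀ u v, u ∉ M.image (fun x => x.1) → v ∉ M.image (fun x => x.1) → τ u = τ v → p u = p v →
        SameCycle π u v) ∧
      ∀ v ∈ P, p v = pp v ∧ q v = qq v := by
  obtain ⟨p, hp, hp'⟩ := exists_split _ P hPT τ N hNT hP pp
  obtain ⟨q, hq, hq'⟩ := exists_split _ P hPH h (fun b a => N a b) hNH (fun a b => hP b a) qq
  obtain ⟨g, -, hg'⟩ := exists_split (M.image fun x => x.2.2) ∅ (by simp) t
    (fun c a => N a (a ^^ c)) (by
      intro c
      rw [← hNC c]; simp) (by simp) pp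
  have fT : ∀ k : Bool × Bool, (Finset.univ.filter fun v => v ∉ M.image (fun x => x.1) ∧
      (τ v, p v) = k).card = N k.1 k.2 := by
    rintro ⟨a, b⟩
    rw [← hp' a b]
    simp only [Prod.mk.injEq]
  have fH : ∀ k : Bool × Bool, (Finset.univ.filter fun v => v ∉ M.image (fun x => x.2.1) ∧
      (q v, h v) = k).card = N k.1 k.2 := by
    rintro ⟨a, b⟩
    rw [← hq' b a]
    simp only [Prod.mk.injEq, and_comm]
  have fC : ∀ k : Bool × Bool, (Finset.univ.filter fun v => v ∉ M.image (fun x => x.2.2) ∧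
      (g v, g v ^^ t v) = k).card = N k.1 k.2 := by
    rintro ⟨a, b⟩
    have := hg' (a ^^ b) a
    rw [← Bool.xor_assoc, Bool.xor_self, Bool.false_xor] at this
    rw [← this]
    congr 1
    ext v
    simp only [Finset.mem_filter, Finset.mem_univ, true_and, Prod.mk.injEq]
    cases g v <;> cases t v <;> cases a <;> cases b <;> simp
  have hpos : ∀ v ∉ M.image (fun x => x.1), N (τ v) (p v) ≠ 0 := by
    intro v hv h0
    have := fT (τ v, p v)
    rw [h0, Finset.card_eq_zero] at this
    have h1 : v ∈ (∅ : Finset (Fin n)) := by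
      rw [← this]; exact Finset.mem_filter.2 ⟨Finset.mem_univ _, hv, rfl⟩
    simp at h1
  obtain ⟨π, ψ, h1, h2, h3, h4⟩ := hS.exists_factor hn hM hET hEH hEC
    (gT := fun v => (τ v, p v)) (gH := fun v => (q v, h v)) (gC := fun v => (g v, g v ^^ t v))
    (fun _ => rfl) (fun _ => rfl) (fun i => by simp)
    (fun k => by rw [fT, fH]) (fun k => by rw [fT, fC])
    (fun v hv => by
      rw [fT]
      exact (hN _ _).resolve_left (hpos v hv))
  refine ⟨π, ψ, p, q, h1, h2, fun v hv => ?_, fun u v hu hv e1 e2 => h4 u v hu hv ?_,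
    fun v hv => ⟨hp v hv, hq v hv⟩⟩
  · obtain ⟨e1, e2⟩ := h3 v hv
    rw [Prod.mk.injEq] at e2
    exact ⟨e1, e2.1, e2.2, hpos v hv⟩
  · rw [e1, e2]

/-- Every vertex is linked forward to an unforced tail. -/
theorem exists_unforced {τ h t b : Fin n → Bool}
    {ET EH EC UV UC : Finset (Fin n)} {O M : Finset (Fin n × Fin n × Fin n)}
    (hO : ∀ x ∈ O, ∀ y ∈ O, x.2.1 ≠ y.1)
    (hUV : ET ∪ EH ∪ (O.image fun x => x.1) ∪ (O.image fun x => x.2.1) ⊆ UV)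
    (hadd : ∀ x ∈ M, x ∉ O → Added τ h t ET EH EC UV UC b (M.image fun x => x.1)
        (M.image fun x => x.2.1) x)
    {π : Perm (Fin n)} (hπ : ∀ x ∈ M, π x.1 = x.2.1) (z : Fin n → Bool)
    (hz : ∀ v, z (π v) = z v) (y : Fin n) :
    ∃ q, q ∉ M.image (fun x => x.1) ∧ z y = z q := by
  have hsub : ∀ v, v ∉ UV → v ∉ ET ∧ v ∉ EH ∧ (∀ x ∈ O, x.1 ≠ v) ∧ ∀ x ∈ O, x.2.1 ≠ v := by
    intro v hv
    have h1 : ¬ _ := fun h => hv (hUV h)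
    simp only [Finset.mem_union, Finset.mem_image, not_or, not_exists, not_and] at h1
    exact ⟨h1.1.1.1, h1.1.1.2, h1.1.2, h1.2⟩
  have hzM : ∀ x ∈ M, z x.1 = z x.2.1 := fun x hx => by rw [← hz, hπ x hx]
  have c1 : ∀ y, y ∈ UV → (∀ x ∈ O, x.1 ≠ y) → ∃ q, q ∉ M.image (fun x => x.1) ∧ z y = z q := by
    intro y hy hyO
    by_cases hyM : y ∈ M.image fun x => x.1
    · obtain ⟨x, hx, rfl⟩ := Finset.mem_image.1 hyM
      have hxO : x ∉ O := fun h => hyO x h rfl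
      rcases hadd x hx hxO with ⟨-, -, h3, -⟩ | ⟨-, h2, -⟩ | ⟨-, h2, -⟩
      · exact ⟨_, h3, hzM x hx⟩
      · exact absurd hy h2
      · exact absurd hy h2
    · exact ⟨y, hyM, rfl⟩
  have c2 : ∀ x ∈ O, x ∈ M → ∃ q, q ∉ M.image (fun x => x.1) ∧ z x.1 = z q := by
    intro x hx hxM
    obtain ⟨q, h1, h2⟩ := c1 x.2.1 (by_contra fun h => (hsub _ h).2.2.2 x hx rfl)
      fun y hy => (hO x hx y hy).symm
    exact ⟨q, h1, (hzM x hxM).trans h2⟩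
  have c3 : ∀ y, y ∈ UV → ∃ q, q ∉ M.image (fun x => x.1) ∧ z y = z q := by
    intro y hy
    by_cases hyM : y ∈ M.image fun x => x.1
    · obtain ⟨x, hx, rfl⟩ := Finset.mem_image.1 hyM
      by_cases hxO : x ∈ O
      · exact c2 x hxO hx
      · rcases hadd x hx hxO with ⟨-, -, h3, -⟩ | ⟨-, h2, -⟩ | ⟨-, h2, -⟩
        · exact ⟨_, h3, hzM x hx⟩
        · exact absurd hy h2
        · exact absurd hy h2
    · exact ⟨y, hyM, rfl⟩
  by_cases hyM : y ∈ M.image fun x => x.1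
  · obtain ⟨x, hx, rfl⟩ := Finset.mem_image.1 hyM
    by_cases hxO : x ∈ O
    · exact c2 x hxO hx
    · rcases hadd x hx hxO with ⟨-, -, h3, -⟩ | ⟨h2, -⟩ | ⟨-, -, -, -, h3, -⟩
      · exact ⟨_, h3, hzM x hx⟩
      · obtain ⟨q, h3, h4⟩ := c3 x.2.1 (by_contra fun h => (hsub _ h).2.1 h2)
        exact ⟨q, h3, (hzM x hx).trans h4⟩
      · exact ⟨_, h3, hzM x hx⟩
  · exact ⟨y, hyM, rfl⟩

theorem sameCycle_of_forall_invariant {π : Perm (Fin n)}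
    (H : ∀ z : Fin n → Bool, (∀ v, z (π v) = z v) → ∀ x y, z x = z y) (x y : Fin n) :
    SameCycle π x y := by
  have h1 := H (fun v => decide (SameCycle π x v)) (fun v => by simp [sameCycle_apply_right]) x y
  simpa [SameCycle.refl] using h1

theorem SameCycle.invariant_eq {π : Perm (Fin n)} {z : Fin n → Bool} (hz : ∀ v, z (π v) = z v)
    {u v : Fin n} (h : SameCycle π u v) : z u = z v := by
  obtain ⟨k, -, -, rfl⟩ := h.exists_pow_eq'
  induction k with
  | zero => rfl
  | succ k ih => rw [pow_succ', Perm.mul_apply, hz, ← ih ⟨k, by simp⟩]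

theorem exists_comp_eq {K : Type} {V : Type} (f : V → K) (U : V → Prop) (z : V → Bool)
    (H : ∀ u v, U u → U v → f u = f v → z u = z v) : ∃ Z : K → Bool, ∀ v, U v → z v = Z (f v) := by
  refine ⟨fun k => decide (∃ v, U v ∧ f v = k ∧ z v = true), fun v hv => ?_⟩
  cases hz : z v
  · symm
    rw [decide_eq_false_iff_not]
    rintro ⟨u, hu, e, hzu⟩
    rw [H u v hu hv e, hz] at hzu
    cases hzu
  · symm
    rw [decide_eq_true_eq]
    exact ⟨v, hv, rfl, hz⟩

theorem card_notMem_image {M : Finset (Fin n × Fin n × Fin n)} {c : Fin n × Fin n × Fin n → Fin n}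
    (hc : ∀ x ∈ M, ∀ y ∈ M, c x = c y → x = y) (P : Fin n → Prop) [DecidablePred P] :
    (Finset.univ.filter fun v => v ∉ M.image c ∧ P v).card + (M.filter fun x => P (c x)).card =
      (Finset.univ.filter P).card := by
  have h1 : (M.filter fun x => P (c x)).card =
      (Finset.univ.filter fun v => v ∈ M.image c ∧ P v).card := by
    rw [← Finset.card_image_of_injOn (f := c) (s := M.filter fun x => P (c x))]
    · congr 1
      ext v
      simp only [Finset.mem_filter, Finset.mem_image, Finset.mem_univ, true_and]
      constructor
      · rintro ⟨x, ⟨hx, hP⟩, rfl⟩; exact ⟨⟨x, hx, rfl⟩, hP⟩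
      · rintro ⟨⟨x, hx, rfl⟩, hP⟩; exact ⟨x, ⟨hx, hP⟩, rfl⟩
    · intro x hx y hy
      exact hc x (Finset.mem_filter.1 hx).1 y (Finset.mem_filter.1 hy).1
  rw [h1, ← Finset.card_union_of_disjoint]
  · congr 1
    ext v
    simp only [Finset.mem_union, Finset.mem_filter, Finset.mem_univ, true_and]
    tauto
  · rw [Finset.disjoint_filter]
    tauto

/-- The contribution of a triple to the imbalance between the two classes. -/
def imb (τ h : Fin n → Bool) (x : Fin n × Fin n × Fin n) : ℤ :=
  (if τ x.1 = false then 1 else 0) - (if h x.2.1 = false then 1 else 0)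

theorem sum_imb (τ h : Fin n → Bool) (M : Finset (Fin n × Fin n × Fin n)) :
    ∑ x ∈ M, imb τ h x = ((M.filter fun x => τ x.1 = false).card : ℤ) -
      (M.filter fun x => h x.2.1 = false).card := by
  unfold imb
  rw [Finset.sum_sub_distrib, Finset.sum_boole, Finset.sum_boole]

/-- The imbalance of a covering. -/
theorem sum_imb_cover {τ h t b : Fin n → Bool} {ET EH KC UV UC : Finset (Fin n)}
    {D : Fin n → Fin n → Fin n → Prop} {O M : Finset (Fin n × Fin n × Fin n)} (hM : Mat D M)
    (hOM : O ⊆ M) (hcol : ∀ i, t i = true → i ∈ M.image fun x => x.2.2)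
    (hadd : ∀ x ∈ M, x ∉ O → Added τ h t ET EH KC UV UC b (M.image fun x => x.1)
        (M.image fun x => x.2.1) x) :
    ∑ x ∈ M, imb τ h x = ∑ x ∈ O, imb τ h x +
      ∑ i ∈ Finset.univ.filter (fun i => t i = true ∧ i ∉ O.image fun x => x.2.2),
        (if b i = true then (-1 : ℤ) else 1) := by
  rw [← Finset.sum_sdiff hOM, add_comm]
  congr 1
  set s : Fin n → ℤ := fun i => if t i = true then (if b i = true then (-1 : ℤ) else 1) else 0
    with hs
  have h1 : ∀ x ∈ M \ O, imb τ h x = s x.2.2 := by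
    intro x hx
    rw [Finset.mem_sdiff] at hx
    rcases hadd x hx.1 hx.2 with ⟨-, -, -, -, h1, h2⟩ | ⟨-, -, -, -, h1, h2⟩ |
      ⟨-, -, -, -, -, h1, h2⟩
    · simp [imb, hs, h1, h2]
    · simp [imb, hs, h1, h2]
    · cases ht : t x.2.2
      · simp [imb, hs, ht, h1 ht]
      · have := h2 ht
        simp only [imb, hs, ht, this]
        cases b x.2.2 <;> simp
  rw [Finset.sum_congr rfl h1]
  have h2 : ∑ x ∈ M \ O, s x.2.2 = ∑ i ∈ (M \ O).image (fun x => x.2.2), s i := by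
    rw [Finset.sum_image]
    intro x hx y hy hxy
    exact hM.inj₃ x (Finset.mem_sdiff.1 hx).1 y (Finset.mem_sdiff.1 hy).1 hxy
  rw [h2, hs, ← Finset.sum_filter]
  refine Finset.sum_congr ?_ fun _ _ => rfl
  ext i
  simp only [Finset.mem_filter, Finset.mem_univ, true_and, Finset.mem_image, Finset.mem_sdiff,
    not_exists, not_and]
  constructor
  · rintro ⟨⟨x, ⟨hx, hxO⟩, rfl⟩, hti⟩
    refine ⟨hti, fun y hy hyx => hxO ?_⟩
    rwa [← hM.inj₃ y (hOM hy) x hx hyx]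
  · rintro ⟨hti, hiO⟩
    obtain ⟨x, hx, rfl⟩ := Finset.mem_image.1 (hcol i hti)
    exact ⟨⟨x, ⟨hx, fun hxO => hiO x hxO rfl⟩, rfl⟩, hti⟩

theorem bool_map_eq_of_ne {Z : Bool → Bool} (c d : Bool) (hcd : c ≠ d) (h : Z c = Z d) :
    Z false = Z true := by
  cases c <;> cases d <;> simp_all

theorem bool_map_const {Z : Bool → Bool} (h : Z false = Z true) (c d : Bool) : Z c = Z d := by
  cases c <;> cases d <;> simp [h]

set_option maxHeartbeats 800000 in
/-- The case of few colours with `t i = true`: all of them are used in added triples, and the two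
remaining classes are linked by a vertex, a colour or a given odd edge. -/
theorem Str.hasTHC_small {a l : ℝ} {D : Fin n → Fin n → Fin n → Prop} {τ h t : Fin n → Bool}
    {ET EH EC : Finset (Fin n)} (hS : Str a l D τ h t ET EH EC) (hn : 10 ^ 16 ≤ n)
    (hloop : ∀ i v, ¬ D i v v) (ha : a ≤ 1 / 10 ^ 6) (hl : 1 / 10 ^ 3 ≤ l)
    (hm : ((Finset.univ.filter fun i => t i = true).card : ℝ) ≤ n / 10 ^ 4)
    {O : Finset (Fin n × Fin n × Fin n)} (hO : Mat D O) (hOd : ∀ x ∈ O, ∀ y ∈ O, x.2.1 ≠ y.1)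
    (hOc : (O.card : ℝ) ≤ n / 10 ^ 5) (b : Fin n → Bool)
    (hbal : ((Finset.univ.filter fun v => τ v = false).card : ℤ) -
      (Finset.univ.filter fun v => h v = false).card = ∑ x ∈ O, imb τ h x +
      ∑ i ∈ Finset.univ.filter (fun i => t i = true ∧ i ∉ O.image fun x => x.2.2),
        (if b i = true then (-1 : ℤ) else 1))
    (hlink : (∃ x₀, x₀ ∉ ET ∧ x₀ ∉ EH ∧ (∀ x ∈ O, x.1 ≠ x₀ ∧ x.2.1 ≠ x₀) ∧ τ x₀ ≠ h x₀) ∨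
      (((Finset.univ.filter fun v => τ v ≠ h v).card : ℝ) ≤ n / 10 ^ 4 ∧
        ((∃ i, t i = true ∧ ∀ x ∈ O, x.2.2 ≠ i) ∨
          (∃ x₀, (∀ x ∈ O, x.1 ≠ x₀ ∧ x.2.1 ≠ x₀) ∧ τ x₀ ≠ h x₀) ∨
          ∃ x ∈ O, h x.1 ≠ τ x.2.1))) : HasTHC D := by
  have hnR : (10 : ℝ) ^ 16 ≤ n := by exact_mod_cast hn
  obtain ⟨W, hW⟩ : ∃ W : Finset (Fin n), W = if (((Finset.univ.filter fun v => τ v ≠ h v).card : ℝ)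
    ≤ n / 10 ^ 4) then Finset.univ.filter fun v => τ v ≠ h v else
      Finset.univ.filter fun v => ∃ h : (∃ x₀, x₀ ∉ ET ∧ x₀ ∉ EH ∧
        (∀ x ∈ O, x.1 ≠ x₀ ∧ x.2.1 ≠ x₀) ∧ τ x₀ ≠ h x₀), v = h.choose := ⟨_, rfl⟩
  have hWc : (W.card : ℝ) ≤ n / 10 ^ 4 := by
    rw [hW]
    split_ifs with h1
    · exact h1
    · have : (Finset.univ.filter fun v => ∃ h : (∃ x₀, x₀ ∉ ET ∧ x₀ ∉ EH ∧
        (∀ x ∈ O, x.1 ≠ x₀ ∧ x.2.1 ≠ x₀) ∧ τ x₀ ≠ h x₀), v = h.choose).card ≤ 1 := by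
        rw [Finset.card_le_one]
        intro u hu v hv
        simp only [Finset.mem_filter, Finset.mem_univ, true_and] at hu hv
        obtain ⟨_, rfl⟩ := hu
        obtain ⟨_, rfl⟩ := hv
        rfl
      have h2 : ((Finset.univ.filter fun v => ∃ h : (∃ x₀, x₀ ∉ ET ∧ x₀ ∉ EH ∧
        (∀ x ∈ O, x.1 ≠ x₀ ∧ x.2.1 ≠ x₀) ∧ τ x₀ ≠ h x₀), v = h.choose).card : ℝ) ≤ 1 := by
        exact_mod_cast this
      refine h2.trans ?_
      linarith
  have hlink' : (∃ x₀, x₀ ∈ W ∧ x₀ ∉ ET ∧ x₀ ∉ EH ∧ (∀ x ∈ O, x.1 ≠ x₀ ∧ x.2.1 ≠ x₀) ∧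
      τ x₀ ≠ h x₀) ∨ ((∀ v, τ v ≠ h v → v ∈ W) ∧
        ((∃ i, t i = true ∧ ∀ x ∈ O, x.2.2 ≠ i) ∨
          (∃ x₀, (∀ x ∈ O, x.1 ≠ x₀ ∧ x.2.1 ≠ x₀) ∧ τ x₀ ≠ h x₀) ∨
          ∃ x ∈ O, h x.1 ≠ τ x.2.1)) := by
    rw [hW]
    split_ifs with h1
    · rcases hlink with ⟨x₀, h2, h3, h4, h5⟩ | ⟨-, h2⟩
      · exact Or.inl ⟨x₀, by simpa using h5, h2, h3, h4, h5⟩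
      · exact Or.inr ⟨fun v hv => by simpa using hv, h2⟩
    · rcases hlink with h2 | h2
      · exact Or.inl ⟨h2.choose, Finset.mem_filter.2 ⟨Finset.mem_univ _, h2, rfl⟩, h2.choose_spec⟩
      · exact absurd h2.1 h1
  clear hlink hW
  set m := (Finset.univ.filter fun i => t i = true).card with hmdef
  obtain ⟨KC, hKC⟩ : ∃ KC : Finset (Fin n), KC = EC ∪ Finset.univ.filter fun i => t i = true :=
    ⟨_, rfl⟩
  obtain ⟨UV, hUV⟩ : ∃ UV : Finset (Fin n), UV = (ET ∪ EH ∪ (O.image fun x => x.1) ∪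
    (O.image fun x => x.2.1)) ∪ W := ⟨_, rfl⟩
  have hKCc : (KC.card : ℝ) ≤ a * n + n / 10 ^ 4 := by
    have := Finset.card_union_le EC (Finset.univ.filter fun i => t i = true)
    rw [← hKC] at this
    have h2 : (KC.card : ℝ) ≤ EC.card + m := by exact_mod_cast this
    linarith [hS.cardC]
  have hUVc : (UV.card : ℝ) ≤ 2 * (a * n) + 2 * (n / 10 ^ 5) + n / 10 ^ 4 := by
    have e1 := Finset.card_union_le (ET ∪ EH ∪ (O.image fun x => x.1) ∪ (O.image fun x => x.2.1)) W
    have e2 := Finset.card_union_le (ET ∪ EH ∪ (O.image fun x => x.1)) (O.image fun x => x.2.1)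
    have e3 := Finset.card_union_le (ET ∪ EH) (O.image fun x => x.1)
    have e4 := Finset.card_union_le ET EH
    have e5 := Finset.card_image_le (s := O) (f := fun x => x.1)
    have e6 := Finset.card_image_le (s := O) (f := fun x => x.2.1)
    have h2 : (UV.card : ℝ) ≤ (ET.card + EH.card) + 2 * O.card + W.card := by
      rw [hUV]
      exact_mod_cast (by omega : _ ≤ (ET.card + EH.card) + 2 * O.card + W.card)
    linarith [hS.cardT, hS.cardH]
  have hUCc : ((KC ∪ O.image fun x => x.2.2).card : ℝ) ≤ a * n + n / 10 ^ 4 + n / 10 ^ 5 := by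
    have e1 := Finset.card_union_le KC (O.image fun x => x.2.2)
    have e2 := Finset.card_image_le (s := O) (f := fun x => x.2.2)
    have h2 : ((KC ∪ O.image fun x => x.2.2).card : ℝ) ≤ KC.card + O.card := by
      exact_mod_cast (by omega : _ ≤ KC.card + O.card)
    linarith
  have han : a * n ≤ 1 / 10 ^ 6 * n := mul_le_mul_of_nonneg_right ha (by linarith)
  have hln : 1 / 10 ^ 3 * (n : ℝ) ≤ l * n := mul_le_mul_of_nonneg_right hl (by linarith)
  have hUVO : ET ∪ EH ∪ (O.image fun x => x.1) ∪ (O.image fun x => x.2.1) ⊆ UV := by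
    rw [hUV]; exact Finset.subset_union_left
  have hWU : ∀ v ∈ W, v ∈ UV := fun v hv => by
    rw [hUV]; exact Finset.mem_union_right _ hv
  obtain ⟨M, hM, hOM, cT, cH, cC, hMc, hadd⟩ := hS.exists_cover hloop hO KC UV
    (KC ∪ O.image fun x => x.2.2) (by rw [hKC]; exact Finset.subset_union_left) (by
      intro i hi hti
      rw [hKC, Finset.mem_union] at hi
      rcases hi with hi | hi
      · exact hi
      · simp [hti] at hi)
    hUVO (Finset.Subset.refl _) b (by linarith [hS.cardT, hS.cardH])
  have cC1 : ∀ i, t i = true → i ∈ M.image fun x => x.2.2 := fun i hi => cC i (by simp [hKC, hi])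
  have cC2 : ∀ i ∈ EC, i ∈ M.image fun x => x.2.2 := fun i hi => cC i (by simp [hKC, hi])
  have hsum := sum_imb_cover hM hOM cC1 hadd
  rw [← hbal, sum_imb] at hsum
  have hMcR : (M.card : ℝ) ≤ n / 10 := by
    have : (M.card : ℝ) ≤ O.card + (ET.card + EH.card + KC.card) := by exact_mod_cast hMc
    linarith [hS.cardT, hS.cardH]
  -- class sizes
  obtain ⟨T, hT⟩ : ∃ T : Bool → ℕ, T = fun a => (Finset.univ.filter fun v =>
    v ∉ M.image (fun x => x.1) ∧ τ v = a).card := ⟨_, rfl⟩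
  have t1 : (Finset.univ.filter fun v => v ∉ M.image (fun x => x.1) ∧ τ v = false).card +
      (M.filter fun x => τ x.1 = false).card = (Finset.univ.filter fun v => τ v = false).card :=
    card_notMem_image hM.inj₁ fun v => τ v = false
  have t2 : (Finset.univ.filter fun v => v ∉ M.image (fun x => x.2.1) ∧ h v = false).card +
      (M.filter fun x => h x.2.1 = false).card = (Finset.univ.filter fun v => h v = false).card :=
    card_notMem_image hM.inj₂ fun v => h v = false
  have t3 : (Finset.univ.filter fun v => v ∉ M.image (fun x => x.1) ∧ τ v = true).card +
      (M.filter fun x => τ x.1 = true).card = (Finset.univ.filter fun v => τ v = true).card :=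
    card_notMem_image hM.inj₁ fun v => τ v = true
  have t4 : (Finset.univ.filter fun v => v ∉ M.image (fun x => x.2.1) ∧ h v = true).card +
      (M.filter fun x => h x.2.1 = true).card = (Finset.univ.filter fun v => h v = true).card :=
    card_notMem_image hM.inj₂ fun v => h v = true
  have t5 : (Finset.univ.filter fun v => v ∉ M.image (fun x => x.2.2) ∧ t v = false).card +
      (M.filter fun x => t x.2.2 = false).card = (Finset.univ.filter fun v => t v = false).card :=
    card_notMem_image hM.inj₃ fun v => t v = false
  have t6 : (Finset.univ.filter fun v => v ∉ M.image (fun x => x.2.2) ∧ t v = true).card +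
      (M.filter fun x => t x.2.2 = true).card = (Finset.univ.filter fun v => t v = true).card :=
    card_notMem_image hM.inj₃ fun v => t v = true
  have s1 : ∀ (s : Finset (Fin n)) (f : Fin n → Bool), (s.filter fun v => f v = false).card +
      (s.filter fun v => f v = true).card = s.card := fun s f => by
    rw [← Finset.card_filter_add_card_filter_not (s := s) fun v => f v = false]
    simp
  have s2 : ∀ (f : Fin n × Fin n × Fin n → Bool), (M.filter fun v => f v = false).card +
      (M.filter fun v => f v = true).card = M.card := fun f => by
    rw [← Finset.card_filter_add_card_filter_not (s := M) fun v => f v = false]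
    simp
  have u1 := s1 Finset.univ τ
  have u2 := s1 Finset.univ h
  have u3 := s1 Finset.univ t
  have w1 := s2 fun x => τ x.1
  have w2 := s2 fun x => h x.2.1
  have w3 := s2 fun x => t x.2.2
  beta_reduce at w1 w2 w3
  rw [Finset.card_univ, Fintype.card_fin] at u1 u2 u3
  have c0 : (Finset.univ.filter fun v => v ∉ M.image (fun x => x.2.2) ∧ t v = true).card = 0 := by
    rw [Finset.card_eq_zero, Finset.filter_eq_empty_iff]
    exact fun i _ hi => hi.1 (cC1 i hi.2)
  have hTf : T false = (Finset.univ.filter fun v =>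
    v ∉ M.image (fun x => x.1) ∧ τ v = false).card := by rw [hT]
  have hTt : T true = (Finset.univ.filter fun v =>
    v ∉ M.image (fun x => x.1) ∧ τ v = true).card := by rw [hT]
  have hTa : ∀ a, (n : ℝ) / 4 ≤ T a := by
    have r1 : (T false : ℝ) + M.card ≥ (Finset.univ.filter fun v => τ v = false).card := by
      rw [hTf]; exact_mod_cast (by omega)
    have r2 : (T true : ℝ) + M.card + (Finset.univ.filter fun v => τ v = false).card ≥ n := by
      rw [hTt]; exact_mod_cast (by omega)
    have r3 := abs_le.1 hS.sizeT
    intro a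
    cases a <;> linarith
  have hTpos : ∀ a, 1 / 40000 * (n : ℝ) ≤ T a := fun a => by linarith [hTa a]
  obtain ⟨π, ψ, p, q, hD, hπM, hπ, hcyc, -⟩ := hS.finish hn hM cT cH cC2
    (fun a b => if a = b then T a else 0) (by
      intro a
      cases a <;> simp only [reduceCtorEq, reduceIte, hTf, hTt] <;> omega) (by
      intro a
      cases a <;> simp only [reduceCtorEq, reduceIte, hTf, hTt] <;> omega) (by
      intro a
      cases a <;> simp only [reduceCtorEq, reduceIte, hTf, hTt, Bool.not_false, Bool.not_true]
        <;> omega) (by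
      intro a b
      by_cases hab : a = b
      · right; simpa [hab] using hTpos b
      · left; simp [hab]) ∅ (by simp) (by simp) (by simp) (fun _ => false) (fun _ => false)
  refine ⟨π, ψ, sameCycle_of_forall_invariant fun z hz => ?_, hD⟩
  have hpT : ∀ v ∉ M.image (fun x => x.1), p v = τ v := by
    intro v hv
    have := (hπ v hv).2.2.2
    by_contra h1
    exact this (if_neg fun h2 => h1 h2.symm)
  obtain ⟨Z, hZ⟩ := exists_comp_eq τ (fun v => v ∉ M.image (fun x => x.1)) z
    fun u v hu hv huv => SameCycle.invariant_eq hz (hcyc u v hu hv huv (by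
      rw [hpT u hu, hpT v hv, huv]))
  have hZH : ∀ w ∉ M.image (fun x => x.2.1), z w = Z (h w) := by
    intro w hw
    obtain ⟨v, rfl⟩ := π.surjective w
    have hv : v ∉ M.image (fun x => x.1) := by
      intro h1
      obtain ⟨x, hx, rfl⟩ := Finset.mem_image.1 h1
      rw [hπM x hx] at hw
      exact hw (Finset.mem_image_of_mem _ hx)
    rw [hz, hZ v hv, (hπ v hv).2.2.1, hpT v hv]
  have hzM : ∀ x ∈ M, z x.1 = z x.2.1 := fun x hx => by rw [← hz, hπM x hx]
  suffices hZc : Z false = Z true by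
    intro x y
    obtain ⟨u, hu, e1⟩ := exists_unforced hOd hUVO hadd hπM z hz x
    obtain ⟨v, hv, e2⟩ := exists_unforced hOd hUVO hadd hπM z hz y
    rw [e1, e2, hZ u hu, hZ v hv, bool_map_const hZc (τ u)]
  rcases hlink' with ⟨x₀, h1, h2, h3, h4, h5⟩ | ⟨hdiag, hlink⟩
  · have f1 : x₀ ∉ M.image fun x => x.1 := by
      intro h6
      obtain ⟨x, hx, rfl⟩ := Finset.mem_image.1 h6
      rcases hadd x hx (fun h => (h4 x h).1 rfl) with ⟨h7, -⟩ | ⟨-, h7, -⟩ | ⟨-, h7, -⟩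
      · exact h2 h7
      · exact h7 (hWU _ h1)
      · exact h7 (hWU _ h1)
    have f2 : x₀ ∉ M.image fun x => x.2.1 := by
      intro h6
      obtain ⟨x, hx, rfl⟩ := Finset.mem_image.1 h6
      rcases hadd x hx (fun h => (h4 x h).2 rfl) with ⟨-, h7, -⟩ | ⟨h7, -⟩ | ⟨-, -, -, h7, -⟩
      · exact h7 (hWU _ h1)
      · exact h3 h7
      · exact h7 (hWU _ h1)
    exact bool_map_eq_of_ne _ _ h5 ((hZ x₀ f1).symm.trans (hZH x₀ f2))
  · have hdiag' : ∀ v ∉ UV, τ v = h v := fun v hv => by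
      by_contra h1
      exact hv (hWU v (hdiag v h1))
    have gT : ∀ v ∈ UV, (∀ x ∈ O, x.1 ≠ v) → z v = Z (τ v) := by
      intro v hv hvO
      by_cases hvM : v ∈ M.image fun x => x.1
      · obtain ⟨x, hx, rfl⟩ := Finset.mem_image.1 hvM
        rcases hadd x hx (fun h => hvO x h rfl) with ⟨-, h2, h3, -, h4, -⟩ | ⟨-, h7, -⟩ | ⟨-, h7, -⟩
        · rw [hzM x hx, hZ _ h3, hdiag' _ h2, h4]
        · exact absurd hv h7
        · exact absurd hv h7
      · exact hZ v hvM
    have gH : ∀ v ∈ UV, (∀ x ∈ O, x.2.1 ≠ v) → z v = Z (h v) := by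
      intro v hv hvO
      by_cases hvM : v ∈ M.image fun x => x.2.1
      · obtain ⟨x, hx, rfl⟩ := Finset.mem_image.1 hvM
        rcases hadd x hx (fun h => hvO x h rfl) with ⟨-, h7, -⟩ | ⟨-, h2, h3, -, h4, -⟩ |
          ⟨-, -, -, h7, -⟩
        · exact absurd hv h7
        · rw [← hzM x hx, hZH _ h3, ← hdiag' _ h2, h4]
        · exact absurd hv h7
      · exact hZH v hvM
    have hOU : ∀ x ∈ O, x.1 ∈ UV ∧ x.2.1 ∈ UV := fun x hx =>
      ⟨hUVO (by simp only [Finset.mem_union, Finset.mem_image]; exact Or.inl (Or.inr ⟨x, hx, rfl⟩)),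
        hUVO (by simp only [Finset.mem_union, Finset.mem_image]; exact Or.inr ⟨x, hx, rfl⟩)⟩
    rcases hlink with ⟨i, hi, hiO⟩ | ⟨x₀, h1, h2⟩ | ⟨x, hx, h1⟩
    · obtain ⟨x, hx, rfl⟩ := Finset.mem_image.1 (cC1 i hi)
      rcases hadd x hx (fun h => hiO x h rfl) with ⟨-, -, -, -, -, h7⟩ | ⟨-, -, -, -, -, h7⟩ |
        ⟨-, h2, h3, h4, h5, -, h6⟩
      · rw [h7] at hi; cases hi
      · rw [h7] at hi; cases hi
      · refine bool_map_eq_of_ne (τ x.1) (h x.2.1) ?_ ?_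
        · rw [(h6 hi).1, (h6 hi).2]; simp
        · rw [hdiag' _ h2, ← hZH _ h3, ← hdiag' _ h4, ← hZ _ h5, hzM x hx]
    · have h3 := hWU _ (hdiag x₀ h2)
      exact bool_map_eq_of_ne _ _ h2 ((gT x₀ h3 fun x hx => (h1 x hx).1).symm.trans
        (gH x₀ h3 fun x hx => (h1 x hx).2))
    · refine bool_map_eq_of_ne _ _ h1 ?_
      rw [← gH _ (hOU x hx).1 fun y hy => hOd y hy x hx, ← gT _ (hOU x hx).2 fun y hy =>
        (hOd x hx y hy).symm, hzM x (hOM hx)]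

theorem exists_mem_class (P : Fin n → Prop) [DecidablePred P] (B : Finset (Fin n))
    (hB : (B.card : ℝ) < (Finset.univ.filter P).card) : ∃ x, P x ∧ x ∉ B := by
  obtain ⟨x, hx, hxB⟩ := Finset.exists_mem_notMem_of_card_lt_card (by exact_mod_cast hB)
  exact ⟨x, (Finset.mem_filter.1 hx).2, hxB⟩

theorem card_bool_classes (τ h : Fin n → Bool) :
    (∀ b, (Finset.univ.filter fun v => τ v = b ∧ h v = false).card +
      (Finset.univ.filter fun v => τ v = b ∧ h v = true).card =
        (Finset.univ.filter fun v => τ v = b).card) ∧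
    (∀ b, (Finset.univ.filter fun v => τ v = false ∧ h v = b).card +
      (Finset.univ.filter fun v => τ v = true ∧ h v = b).card =
        (Finset.univ.filter fun v => h v = b).card) ∧
    (Finset.univ.filter fun v => τ v = false).card +
      (Finset.univ.filter fun v => τ v = true).card = n := by
  have s1 : ∀ (s : Finset (Fin n)) (f : Fin n → Bool), (s.filter fun v => f v = false).card +
      (s.filter fun v => f v = true).card = s.card := fun s f => by
    rw [← Finset.card_filter_add_card_filter_not (s := s) fun v => f v = false]
    simp
  refine ⟨fun b => ?_, fun b => ?_, ?_⟩
  · rw [← s1 (Finset.univ.filter fun v => τ v = b) h, Finset.filter_filter, Finset.filter_filter]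
  · rw [← s1 (Finset.univ.filter fun v => h v = b) τ, Finset.filter_filter, Finset.filter_filter]
    simp only [and_comm]
  · rw [s1, Finset.card_univ, Fintype.card_fin]

/-- Three vertices whose classes can be used to link all four kinds of edges. -/
theorem exists_links {a : ℝ} (τ h : Fin n → Bool) (hn : 10 ^ 16 ≤ n) (ha : a ≤ 1 / 10 ^ 6)
    (sT : |((Finset.univ.filter fun v => τ v = false).card : ℝ) - n / 2| ≤ a * n)
    (sH : |((Finset.univ.filter fun v => h v = false).card : ℝ) - n / 2| ≤ a * n)
    (B : Finset (Fin n)) (hB : (B.card : ℝ) ≤ n / 100) : ∃ (c : Bool) (x₁ x₂ x₃ : Fin n),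
    (x₁ ≠ x₂ ∧ x₁ ≠ x₃ ∧ x₂ ≠ x₃) ∧ (x₁ ∉ B ∧ x₂ ∉ B ∧ x₃ ∉ B) ∧ (τ x₁ = false ∧ h x₁ = c) ∧
      (τ x₂ = false ∧ h x₂ = c) ∧ τ x₃ = true ∧ h x₃ = !c := by
  have hnR : (10 : ℝ) ^ 16 ≤ n := by exact_mod_cast hn
  have han : a * n ≤ 1 / 10 ^ 6 * n := mul_le_mul_of_nonneg_right ha (by linarith)
  obtain ⟨k1, k2, k3⟩ := card_bool_classes τ h
  have k4 := (card_bool_classes h τ).2.2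
  have sT := abs_le.1 sT
  have sH := abs_le.1 sH
  obtain ⟨c, h1, h2⟩ : ∃ c, (n : ℝ) / 5 ≤ (Finset.univ.filter fun v => τ v = false ∧ h v = c).card ∧
      (n : ℝ) / 5 ≤ (Finset.univ.filter fun v => τ v = true ∧ h v = !c).card := by
    have k1f := k1 false
    have k1t := k1 true
    have k2f := k2 false
    have k2t := k2 true
    by_cases h1 : (n : ℝ) / 5 + 2 * (a * n) ≤
      (Finset.univ.filter fun v => τ v = false ∧ h v = false).card
    · refine ⟨false, by linarith [abs_nonneg (((Finset.univ.filter fun v => τ v = false).card : ℝ) - n / 2)], ?_⟩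
      rw [Bool.not_false]
      rify at k1f k1t k2f k2t k3 k4
      linarith
    · refine ⟨true, ?_, ?_⟩ <;> (try rw [Bool.not_true]) <;>
      · rify at k1f k1t k2f k2t k3 k4
        linarith
  obtain ⟨x₁, p1, q1⟩ := exists_mem_class _ B (show _ <
    ((Finset.univ.filter fun v => τ v = false ∧ h v = c).card : ℝ) by linarith)
  have hB1 := Finset.card_insert_le x₁ B
  have hB1' : ((insert x₁ B).card : ℝ) ≤ B.card + 1 := by exact_mod_cast hB1
  obtain ⟨x₂, p2, q2⟩ := exists_mem_class _ (insert x₁ B) (show _ <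
    ((Finset.univ.filter fun v => τ v = false ∧ h v = c).card : ℝ) by linarith)
  obtain ⟨x₃, p3, q3⟩ := exists_mem_class _ B (show _ <
    ((Finset.univ.filter fun v => τ v = true ∧ h v = !c).card : ℝ) by linarith)
  rw [Finset.mem_insert, not_or] at q2
  refine ⟨c, x₁, x₂, x₃, ⟨fun e => q2.1 e.symm, ?_, ?_⟩, ⟨q1, q2.2, q3⟩, p1, p2, p3⟩
  · rintro rfl; rw [p1.1] at p3; simp at p3
  · rintro rfl; rw [p2.1] at p3; simp at p3

theorem exists_four_sizes {T H C : Bool → ℕ} (e1 : T false + T true = H false + H true)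
    (e2 : T false + T true = C false + C true) (hpar : (T false + H false + C true) % 2 = 0)
    {x : ℝ} (hx : 1 ≤ x) (h1 : |(T false : ℝ) - H false| ≤ C true - 2 * x)
    (h2 : ∀ a, (C true : ℝ) + 2 * x ≤ T a + H a) : ∃ N : Bool → Bool → ℕ,
      (∀ a, N a false + N a true = T a) ∧ (∀ b, N false b + N true b = H b) ∧
      (∀ c, N false c + N true (!c) = C c) ∧ ∀ a b, x ≤ N a b := by
  have h3 := h2 false
  have h4 := h2 true
  obtain ⟨h5, h6⟩ := abs_le.1 h1
  have g1 : H false ≤ C true + T false := by rify; linarith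
  have g2 : T false ≤ C true + H false := by rify; linarith
  have g3 : C true ≤ T false + H false := by rify; linarith
  obtain ⟨k, hk⟩ : ∃ k, C true + T false = H false + 2 * k :=
    ⟨(C true + T false - H false) / 2, by omega⟩
  have hkC : k ≤ C true := by omega
  have hkT : k ≤ T false := by omega
  obtain ⟨u, hu⟩ := Nat.exists_eq_add_of_le hkC
  obtain ⟨w, hw⟩ := Nat.exists_eq_add_of_le hkT
  have g4 : C true ≤ T true + H true := by rify; linarith
  obtain ⟨y, hy⟩ := Nat.exists_eq_add_of_le (show w ≤ C false by omega)
  refine ⟨fun a b => cond a (cond b y u) (cond b k w), ?_, ?_, ?_, ?_⟩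
  · intro a; cases a <;> simp only [cond_true, cond_false] <;> omega
  · intro a; cases a <;> simp only [cond_true, cond_false] <;> omega
  · intro a; cases a <;> simp only [cond_true, cond_false, Bool.not_true, Bool.not_false] <;> omega
  · rify at hk hu hw hy e1 e2
    intro a b; cases a <;> cases b <;> simp only [cond_true, cond_false] <;> linarith

theorem parity_cover (τ h t : Fin n → Bool) (M : Finset (Fin n × Fin n × Fin n)) :
    ((M.filter fun x => τ x.1 = false).card + (M.filter fun x => h x.2.1 = false).card +
      (M.filter fun x => t x.2.2 = true).card +
      (M.filter fun x => ¬ Even τ h t x.1 x.2.1 x.2.2).card) % 2 = 0 := by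
  induction M using Finset.induction with
  | empty => simp
  | insert x M hx ih =>
    have hc : ∀ (P : Fin n × Fin n × Fin n → Prop) [DecidablePred P],
        ((insert x M).filter P).card = (M.filter P).card + if P x then 1 else 0 := by
      intro P _
      rw [Finset.filter_insert]
      split_ifs with hP
      · rw [Finset.card_insert_of_notMem fun h => hx (Finset.mem_filter.1 h).1]
      · rfl
    rw [hc, hc, hc, hc]
    generalize (M.filter fun x => τ x.1 = false).card = k1 at *
    generalize (M.filter fun x => h x.2.1 = false).card = k2 at *
    generalize (M.filter fun x => t x.2.2 = true).card = k3 at *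
    generalize (M.filter fun x => ¬ Even τ h t x.1 x.2.1 x.2.2).card = k4 at *
    unfold Even
    clear hc
    cases τ x.1 <;> cases h x.2.1 <;> cases t x.2.2 <;> simp <;> omega

theorem Added.even {τ h t b : Fin n → Bool} {ET EH EC UV UC TM HM : Finset (Fin n)}
    {x : Fin n × Fin n × Fin n} (hx : Added τ h t ET EH EC UV UC b TM HM x) :
    Even τ h t x.1 x.2.1 x.2.2 := by
  unfold Even
  rcases hx with ⟨-, -, -, -, h1, h2⟩ | ⟨-, -, -, -, h1, h2⟩ | ⟨-, -, -, -, -, h1, h2⟩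
  · rw [h1, h2, Bool.xor_self]
  · rw [h1, h2, Bool.xor_self]
  · cases ht : t x.2.2
    · rw [h1 ht, Bool.xor_self]
    · rw [(h2 ht).1, (h2 ht).2]
      cases b x.2.2 <;> rfl

/-- Vertices outside `UV` that are not matched heads and tails. -/
theorem Added.notMem {τ h t b : Fin n → Bool} {ET EH EC UV UC : Finset (Fin n)}
    {O M : Finset (Fin n × Fin n × Fin n)}
    (hadd : ∀ x ∈ M, x ∉ O → Added τ h t ET EH EC UV UC b (M.image fun x => x.1)
        (M.image fun x => x.2.1) x) {v : Fin n} (hv : v ∈ UV) (hT : v ∉ ET) (hH : v ∉ EH)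
    (hO : v ∉ O.image fun x => x.1) (hO' : v ∉ O.image fun x => x.2.1) :
    v ∉ M.image (fun x => x.1) ∧ v ∉ M.image fun x => x.2.1 := by
  constructor
  · intro h6
    obtain ⟨x, hx, rfl⟩ := Finset.mem_image.1 h6
    rcases hadd x hx (fun h => hO (Finset.mem_image_of_mem _ h)) with
      ⟨h7, -⟩ | ⟨-, h7, -⟩ | ⟨-, h7, -⟩
    · exact hT h7
    · exact h7 hv
    · exact h7 hv
  · intro h6
    obtain ⟨x, hx, rfl⟩ := Finset.mem_image.1 h6
    rcases hadd x hx (fun h => hO' (Finset.mem_image_of_mem (fun x => x.2.1) h)) with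
      ⟨-, h7, -⟩ | ⟨h7, -⟩ | ⟨-, -, -, h7, -⟩
    · exact h7 hv
    · exact hH h7
    · exact h7 hv

theorem links_connect {Z : Bool → Bool → Bool} {c : Bool} (h1 : Z false (!c) = Z c c)
    (h2 : Z false c = Z true c) (h3 : Z true false = Z (!c) (!c)) (a b a' b' : Bool) :
    Z a b = Z a' b' := by
  cases c <;> cases a <;> cases b <;> cases a' <;> cases b' <;> simp_all

set_option maxHeartbeats 1600000 in
/-- The case of many colours with `t i = true`. -/
theorem Str.hasTHC_large {a l : ℝ} {D : Fin n → Fin n → Fin n → Prop} {τ h t : Fin n → Bool}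
    {ET EH EC : Finset (Fin n)} (hS : Str a l D τ h t ET EH EC) (hn : 10 ^ 16 ≤ n)
    (hloop : ∀ i v, ¬ D i v v) (ha : a ≤ 1 / 10 ^ 6) (hl : 1 / 10 ^ 3 ≤ l)
    (hm : (n : ℝ) / 10 ^ 4 ≤ (Finset.univ.filter fun i => t i = true).card)
    {O : Finset (Fin n × Fin n × Fin n)} (hO : Mat D O) (hOd : ∀ x ∈ O, ∀ y ∈ O, x.2.1 ≠ y.1)
    (hOc : O.card ≤ 1)
    (hpar : ((Finset.univ.filter fun v => τ v = false).card +
      (Finset.univ.filter fun v => h v = false).card +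
      (Finset.univ.filter fun i => t i = true).card +
      (O.filter fun x => ¬ Even τ h t x.1 x.2.1 x.2.2).card) % 2 = 0) : HasTHC D := by
  have hnR : (10 : ℝ) ^ 16 ≤ n := by exact_mod_cast hn
  have han : a * n ≤ 1 / 10 ^ 6 * n := mul_le_mul_of_nonneg_right ha (by linarith)
  have hln : 1 / 10 ^ 3 * (n : ℝ) ≤ l * n := mul_le_mul_of_nonneg_right hl (by linarith)
  have hOcR : (O.card : ℝ) ≤ 1 := by exact_mod_cast hOc
  obtain ⟨B, hB⟩ : ∃ B, B = ET ∪ EH ∪ (O.image fun x => x.1) ∪ (O.image fun x => x.2.1) := ⟨_, rfl⟩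
  have hBc : (B.card : ℝ) ≤ 2 * (a * n) + 2 := by
    have e2 := Finset.card_union_le (ET ∪ EH ∪ (O.image fun x => x.1)) (O.image fun x => x.2.1)
    have e3 := Finset.card_union_le (ET ∪ EH) (O.image fun x => x.1)
    have e4 := Finset.card_union_le ET EH
    have e5 := Finset.card_image_le (s := O) (f := fun x => x.1)
    have e6 := Finset.card_image_le (s := O) (f := fun x => x.2.1)
    have h2 : (B.card : ℝ) ≤ (ET.card + EH.card) + 2 * O.card := by
      rw [hB]
      exact_mod_cast (by omega : _ ≤ (ET.card + EH.card) + 2 * O.card)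
    linarith [hS.cardT, hS.cardH]
  obtain ⟨c, x₁, x₂, x₃, hne, hxB, y1, y2, y3⟩ := exists_links τ h hn ha hS.sizeT hS.sizeH B
    (by linarith)
  obtain ⟨P, hP⟩ : ∃ P : Finset (Fin n), P = {x₁, x₂, x₃} := ⟨_, rfl⟩
  have hPc : P.card ≤ 3 := by rw [hP]; exact Finset.card_le_three
  have hPB : ∀ x ∈ P, x ∉ B := by
    intro x hx
    rw [hP] at hx
    simp only [Finset.mem_insert, Finset.mem_singleton] at hx
    rcases hx with rfl | rfl | rfl
    exacts [hxB.1, hxB.2.1, hxB.2.2]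
  have hBP := Finset.card_union_le B P
  have hUVc : ((B ∪ P).card : ℝ) ≤ 2 * (a * n) + 5 := by
    have : ((B ∪ P).card : ℝ) ≤ B.card + 3 := by exact_mod_cast (by omega)
    linarith
  have hUCc : ((EC ∪ O.image fun x => x.2.2).card : ℝ) ≤ a * n + 1 := by
    have e1 := Finset.card_union_le EC (O.image fun x => x.2.2)
    have e2 := Finset.card_image_le (s := O) (f := fun x => x.2.2)
    have h2 : ((EC ∪ O.image fun x => x.2.2).card : ℝ) ≤ EC.card + O.card := by
      exact_mod_cast (by omega : _ ≤ EC.card + O.card)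
    linarith [hS.cardC]
  have hUVO : ET ∪ EH ∪ (O.image fun x => x.1) ∪ (O.image fun x => x.2.1) ⊆ B ∪ P := by
    rw [← hB]; exact Finset.subset_union_left
  obtain ⟨M, hM, hOM, cT, cH, cC, hMc, hadd⟩ := hS.exists_cover hloop hO EC (B ∪ P)
    (EC ∪ O.image fun x => x.2.2) (Finset.Subset.refl _) (fun i hi _ => hi)
    hUVO (Finset.Subset.refl _) (fun _ => false) (by linarith [hS.cardT, hS.cardH, hS.cardC])
  have hMcR : (M.card : ℝ) ≤ 1 / 10 ^ 5 * n := by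
    have : (M.card : ℝ) ≤ O.card + (ET.card + EH.card + EC.card) := by exact_mod_cast hMc
    linarith [hS.cardT, hS.cardH, hS.cardC]
  have hPM : ∀ x ∈ P, x ∉ M.image (fun x => x.1) ∧ x ∉ M.image fun x => x.2.1 := by
    intro x hx
    have h1 : ¬ _ := hPB x hx
    rw [hB] at h1
    simp only [Finset.mem_union, not_or] at h1
    exact Added.notMem hadd (Finset.mem_union_right _ hx) h1.1.1.1 h1.1.1.2 h1.1.2 h1.2
  have hparM := parity_cover τ h t M
  have hoddM : (M.filter fun x => ¬ Even τ h t x.1 x.2.1 x.2.2) =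
      O.filter fun x => ¬ Even τ h t x.1 x.2.1 x.2.2 := by
    ext x
    simp only [Finset.mem_filter]
    constructor
    · rintro ⟨h1, h2⟩
      refine ⟨?_, h2⟩
      by_contra h3
      exact h2 (hadd x h1 h3).even
    · rintro ⟨h1, h2⟩
      exact ⟨hOM h1, h2⟩
  rw [hoddM] at hparM
  obtain ⟨T, hT⟩ : ∃ T : Bool → ℕ, ∀ a, T a = (Finset.univ.filter fun v =>
    v ∉ M.image (fun x => x.1) ∧ τ v = a).card := ⟨_, fun _ => rfl⟩
  obtain ⟨H, hH⟩ : ∃ H : Bool → ℕ, ∀ a, H a = (Finset.univ.filter fun v =>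
    v ∉ M.image (fun x => x.2.1) ∧ h v = a).card := ⟨_, fun _ => rfl⟩
  obtain ⟨C, hC⟩ : ∃ C : Bool → ℕ, ∀ a, C a = (Finset.univ.filter fun v =>
    v ∉ M.image (fun x => x.2.2) ∧ t v = a).card := ⟨_, fun _ => rfl⟩
  have tT : ∀ a, T a + (M.filter fun x => τ x.1 = a).card =
      (Finset.univ.filter fun v => τ v = a).card := fun a => by
    rw [hT]; exact card_notMem_image hM.inj₁ fun v => τ v = a
  have tH : ∀ a, H a + (M.filter fun x => h x.2.1 = a).card =
      (Finset.univ.filter fun v => h v = a).card := fun a => by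
    rw [hH]; exact card_notMem_image hM.inj₂ fun v => h v = a
  have tC : ∀ a, C a + (M.filter fun x => t x.2.2 = a).card =
      (Finset.univ.filter fun v => t v = a).card := fun a => by
    rw [hC]; exact card_notMem_image hM.inj₃ fun v => t v = a
  have u1 := (card_bool_classes τ h).2.2
  have u2 := (card_bool_classes h h).2.2
  have u3 := (card_bool_classes t h).2.2
  have s2 : ∀ (f : Fin n × Fin n × Fin n → Bool), (M.filter fun v => f v = false).card +
      (M.filter fun v => f v = true).card = M.card := fun f => by
    rw [← Finset.card_filter_add_card_filter_not (s := M) fun v => f v = false]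
    simp
  have w1 := s2 fun x => τ x.1
  have w2 := s2 fun x => h x.2.1
  have w3 := s2 fun x => t x.2.2
  beta_reduce at w1 w2 w3
  have r1 := abs_le.1 hS.sizeT
  have r2 := abs_le.1 hS.sizeH
  have r3 := hS.sizeC
  have q1 := tT false
  have q2 := tT true
  have q3 := tH false
  have q4 := tH true
  have q5 := tC false
  have q6 := tC true
  obtain ⟨N, hNT, hNH, hNC, hN⟩ : ∃ N : Bool → Bool → ℕ,
      (∀ a, N a false + N a true = T a) ∧ (∀ b, N false b + N true b = H b) ∧
      (∀ c, N false c + N true (!c) = C c) ∧ ∀ a b, 1 / 40000 * (n : ℝ) ≤ N a b := by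
    refine exists_four_sizes (by omega) (by omega) (by omega) (by linarith) ?_ ?_
    · rify at q1 q2 q3 q4 q5 q6 w1 w2 w3
      have m1 : (0 : ℝ) ≤ (M.filter fun x => τ x.1 = true).card := by positivity
      have m2 : (0 : ℝ) ≤ (M.filter fun x => h x.2.1 = true).card := by positivity
      have m3 : (0 : ℝ) ≤ (M.filter fun x => t x.2.2 = false).card := by positivity
      have m4 : (0 : ℝ) ≤ (M.filter fun x => τ x.1 = false).card := by positivity
      have m5 : (0 : ℝ) ≤ (M.filter fun x => h x.2.1 = false).card := by positivity
      rw [abs_le]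
      constructor <;> linarith
    · rify at q1 q2 q3 q4 q5 q6 w1 w2 w3 u1 u2 u3
      have m1 : (0 : ℝ) ≤ (M.filter fun x => τ x.1 = true).card := by positivity
      have m2 : (0 : ℝ) ≤ (M.filter fun x => h x.2.1 = true).card := by positivity
      have m3 : (0 : ℝ) ≤ (M.filter fun x => t x.2.2 = true).card := by positivity
      have m4 : (0 : ℝ) ≤ (M.filter fun x => τ x.1 = false).card := by positivity
      have m5 : (0 : ℝ) ≤ (M.filter fun x => h x.2.1 = false).card := by positivity
      intro a
      cases a <;> linarith
  have hNP : ∀ a b, P.card ≤ N a b := by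
    intro a b
    have : (P.card : ℝ) ≤ 3 := by exact_mod_cast hPc
    have h1 := hN a b
    exact_mod_cast (show (P.card : ℝ) ≤ N a b by linarith)
  obtain ⟨π, ψ, p, q, hD, hπM, hπ, hcyc, hpq⟩ := hS.finish hn hM cT cH cC N
    (fun a => (hNT a).trans (hT a)) (fun a => (hNH a).trans (hH a))
    (fun a => (hNC a).trans (hC a)) (fun a b => Or.inr (hN a b)) P
    (fun x hx => (hPM x hx).1) (fun x hx => (hPM x hx).2) hNP
    (fun x => if x = x₁ then !c else if x = x₂ then c else false)
    (fun x => if x = x₁ then c else if x = x₂ then true else !c)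
  refine ⟨π, ψ, sameCycle_of_forall_invariant fun z hz => ?_, hD⟩
  obtain ⟨Z, hZ⟩ := exists_comp_eq (fun v => (τ v, p v)) (fun v => v ∉ M.image (fun x => x.1)) z
    fun u v hu hv huv => SameCycle.invariant_eq hz (hcyc u v hu hv (Prod.ext_iff.1 huv).1
      (Prod.ext_iff.1 huv).2)
  have hZH : ∀ w ∉ M.image (fun x => x.2.1), z w = Z (q w, h w) := by
    intro w hw
    obtain ⟨v, rfl⟩ := π.surjective w
    have hv : v ∉ M.image (fun x => x.1) := by
      intro h1
      obtain ⟨x, hx, rfl⟩ := Finset.mem_image.1 h1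
      rw [hπM x hx] at hw
      exact hw (Finset.mem_image_of_mem _ hx)
    rw [hz, hZ v hv, (hπ v hv).2.2.1, (hπ v hv).2.1]
  have hlink : ∀ x ∈ P, Z (τ x, p x) = Z (q x, h x) := fun x hx => by
    rw [← hZ x (hPM x hx).1, hZH x (hPM x hx).2]
  have i1 : x₁ ∈ P := by simp [hP]
  have i2 : x₂ ∈ P := by simp [hP]
  have i3 : x₃ ∈ P := by simp [hP]
  have l1 := hlink x₁ i1
  have l2 := hlink x₂ i2
  have l3 := hlink x₃ i3
  rw [(hpq x₁ i1).1, (hpq x₁ i1).2, if_pos rfl, if_pos rfl, y1.1, y1.2] at l1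
  rw [(hpq x₂ i2).1, (hpq x₂ i2).2, if_neg hne.1.symm, if_neg hne.1.symm, if_pos rfl, if_pos rfl,
    y2.1, y2.2] at l2
  rw [(hpq x₃ i3).1, (hpq x₃ i3).2, if_neg hne.2.1.symm, if_neg hne.2.1.symm,
    if_neg hne.2.2.symm, if_neg hne.2.2.symm, y3.1, y3.2] at l3
  have hZc := links_connect (Z := fun a b => Z (a, b)) l1 l2 l3
  intro x y
  obtain ⟨u, hu, e1⟩ := exists_unforced hOd hUVO hadd hπM z hz x
  obtain ⟨v, hv, e2⟩ := exists_unforced hOd hUVO hadd hπM z hz y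
  rw [e1, e2, hZ u hu, hZ v hv]
  exact hZc _ _ _ _

theorem exists_signs (K : Finset (Fin n)) (d : ℤ) (h1 : |d| ≤ K.card)
    (h2 : (d + K.card) % 2 = 0) :
    ∃ b : Fin n → Bool, ∑ i ∈ K, (if b i = true then (-1 : ℤ) else 1) = d := by
  rw [abs_le] at h1
  obtain ⟨k, hk⟩ : ∃ k : ℕ, (K.card : ℤ) - d = 2 * k := ⟨((K.card - d) / 2).toNat, by omega⟩
  obtain ⟨S, hS, hSk⟩ := Finset.exists_subset_card_eq (show k ≤ K.card by omega)
  refine ⟨fun i => decide (i ∈ S), ?_⟩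
  simp only [decide_eq_true_eq]
  rw [Finset.sum_ite, Finset.filter_mem_eq_inter, Finset.inter_eq_right.2 hS, Finset.sum_const,
    Finset.sum_const, hSk]
  have h3 : (K.filter fun i => i ∉ S).card + S.card = K.card := by
    rw [Finset.filter_notMem_eq_sdiff]
    exact Finset.card_sdiff_add_card_eq_card hS
  simp only [nsmul_eq_mul]
  omega

theorem DegHyp.exists_out {D : Fin n → Fin n → Fin n → Prop} (hD : DegHyp D) (i v : Fin n)
    (A : Finset (Fin n)) (hA : (A.card : ℝ) < n / 2) : ∃ w, D i v w ∧ w ∉ A :=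
  exists_mem_class _ A (hA.trans_le (hD.out i v))

theorem DegHyp.exists_inn {D : Fin n → Fin n → Fin n → Prop} (hD : DegHyp D) (i v : Fin n)
    (A : Finset (Fin n)) (hA : (A.card : ℝ) < n / 2) : ∃ w, D i w v ∧ w ∉ A :=
  exists_mem_class _ A (hA.trans_le (hD.inn i v))

/-- If out-neighbours of `v` lie in `A` then `A` is large. -/
theorem DegHyp.le_card {D : Fin n → Fin n → Fin n → Prop} (hD : DegHyp D) (i v : Fin n)
    (A : Finset (Fin n)) (hA : ∀ w, D i v w → w ∈ A) :
    (n : ℝ) / 2 ≤ A.card ∧ (v ∈ A → (n : ℝ) / 2 + 1 ≤ A.card) := by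
  constructor
  · by_contra h1
    obtain ⟨w, h2, h3⟩ := hD.exists_out i v A (not_le.1 h1)
    exact h3 (hA w h2)
  · intro hv
    by_contra h1
    have h4 : ((A.erase v).card : ℝ) < n / 2 := by
      have : ((A.erase v).card : ℝ) + 1 = A.card := by
        exact_mod_cast Finset.card_erase_add_one hv
      linarith
    obtain ⟨w, h2, h3⟩ := hD.exists_out i v _ h4
    exact h3 (Finset.mem_erase.2 ⟨fun h => hD.loopless i v (h ▸ h2), hA w h2⟩)

theorem ne_of_no_odd {D : Fin n → Fin n → Fin n → Prop} (hD : DegHyp D) (τ h : Fin n → Bool)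
    (hτ : ∀ a, ∃ v, τ v = a) (i : Fin n) (hi : ∀ v w, D i v w → τ v = h w) (v : Fin n) :
    τ v ≠ h v := by
  intro hv
  obtain ⟨u, hu⟩ := hτ (!τ v)
  have h1 := (hD.le_card i v (Finset.univ.filter fun w => h w = τ v) (by
    intro w hw; simp [hi v w hw])).2 (by simp [hv])
  have h2 := (hD.le_card i u (Finset.univ.filter fun w => h w = !τ v) (by
    intro w hw; simp [← hi u w hw, hu])).1
  have h3 := (card_bool_classes h h).2.2
  rify at h3
  cases h4 : τ v <;> simp only [h4, Bool.not_true, Bool.not_false] at h1 h2 <;> linarith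

theorem exists_odd {D : Fin n → Fin n → Fin n → Prop} (hD : DegHyp D) (τ h t : Fin n → Bool)
    (hτ : ∀ a, ∃ v, τ v = a) (ht : ∀ c, ∃ i, t i = c) :
    ∃ x : Fin n × Fin n × Fin n, D x.2.2 x.1 x.2.1 ∧ ¬ Even τ h t x.1 x.2.1 x.2.2 := by
  by_contra! hno
  have hno : ∀ v w i, D i v w → (τ v ^^ h w) = t i := fun v w i => hno (v, w, i)
  obtain ⟨i, hi⟩ := ht false
  obtain ⟨j, hj⟩ := ht true
  have h1 := ne_of_no_odd hD τ h hτ i fun v w hvw => by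
    have := hno v w i hvw
    rw [hi] at this
    simpa using this
  have h2 : ∀ v w, D j v w → τ w = τ v := fun v w hvw => by
    have h3 := hno v w j hvw
    have h4 := h1 w
    rw [hj] at h3
    revert h3 h4
    cases τ v <;> cases τ w <;> cases h w <;> simp
  have h5 : ∀ a, (n : ℝ) / 2 + 1 ≤ (Finset.univ.filter fun w => τ w = a).card := by
    intro a
    obtain ⟨v, hv⟩ := hτ a
    exact (hD.le_card j v (Finset.univ.filter fun w => τ w = a) (by
      intro w hw; simp [h2 v w hw, hv])).2 (by simp [hv])
  have h3 := (card_bool_classes τ h).2.2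
  rify at h3
  linarith [h5 true, h5 false]

theorem exists_crossing_aux {D : Fin n → Fin n → Fin n → Prop} (hD : DegHyp D) (hn : 10 ≤ n)
    (f : Fin n → Bool) (hf : 2 ≤ (Finset.univ.filter fun v => f v = false).card)
    (hX : ((Finset.univ.filter fun v => f v = false).card : ℝ) ≤ n / 2) (i j : Fin n) :
    ∃ a b c d, f a = false ∧ f b = true ∧ f c = true ∧ f d = false ∧ a ≠ d ∧
      b ≠ c ∧ D i a b ∧ D j c d := by
  have hnR : (10 : ℝ) ≤ n := by exact_mod_cast hn
  obtain ⟨X, hXd⟩ : ∃ X : Finset (Fin n), X = Finset.univ.filter fun v => f v = false := ⟨_, rfl⟩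
  have hXm : ∀ v, v ∈ X ↔ f v = false := fun v => by simp [hXd]
  rw [← hXd] at hX hf
  have hf2 : ∀ v, ∃ w, f w = false ∧ w ≠ v := fun v => by
    obtain ⟨w, h1, h2⟩ := Finset.exists_mem_ne (show 1 < X.card by omega) v
    exact ⟨w, (hXm w).1 h1, h2⟩
  have hXc : (X.card : ℝ) + Xᶜ.card = n := by
    have := Finset.card_add_card_compl X
    rw [Fintype.card_fin] at this
    exact_mod_cast this
  have hout : ∀ v, f v = false → ∃ w, f w = true ∧ D i v w := by
    intro v hv
    have h1 : ((X.erase v).card : ℝ) + 1 = X.card := by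
      exact_mod_cast Finset.card_erase_add_one ((hXm v).2 hv)
    obtain ⟨w, h2, h3⟩ := hD.exists_out i v (X.erase v) (by linarith)
    refine ⟨w, ?_, h2⟩
    by_contra h4
    exact h3 (Finset.mem_erase.2 ⟨fun h => hD.loopless i v (h ▸ h2), (hXm w).2 (by simpa using h4)⟩)
  obtain ⟨v₁, hv₁⟩ : ∃ v, f v = false := (Finset.card_pos.1 (by omega : 0 < X.card)).imp
    fun v hv => (hXm v).1 hv
  obtain ⟨w₁, hw₁, e₁⟩ := hout v₁ hv₁
  by_cases hex : ∃ w v, f w = false ∧ w ≠ v₁ ∧ f v = true ∧ v ≠ w₁ ∧ D j v w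
  · obtain ⟨w, v, h1, h2, h3, h4, h5⟩ := hex
    exact ⟨v₁, w₁, v, w, hv₁, hw₁, h3, h1, h2.symm, h4.symm, e₁, h5⟩
  push Not at hex
  -- vertices outside `X` other than `w₁` have in colour `j` at most the out-neighbour `v₁` in `X`
  have key : ∀ v, f v = true → v ≠ w₁ → (∀ w, D j v w → w ∈ insert v₁ (Xᶜ.erase v)) := by
    intro v hv hvw w hw
    rw [Finset.mem_insert, Finset.mem_erase, Finset.mem_compl, hXm]
    by_cases h1 : w = v₁
    · exact Or.inl h1
    · refine Or.inr ⟨fun h => hD.loopless j v (h ▸ hw), fun h2 => hex w v h2 h1 hv hvw hw⟩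
  have hX2 : (n : ℝ) / 2 ≤ X.card := by
    obtain ⟨w, hw, hwv⟩ := hf2 v₁
    by_contra h3
    have h4 : ((insert w₁ (X.erase w)).card : ℝ) ≤ X.card := by
      have := Finset.card_insert_le w₁ (X.erase w)
      rw [Finset.card_erase_add_one ((hXm w).2 hw)] at this
      exact_mod_cast this
    obtain ⟨u, h5, h6⟩ := hD.exists_inn j w _ (h4.trans_lt (not_le.1 h3))
    rw [Finset.mem_insert, Finset.mem_erase, hXm] at h6
    push Not at h6
    refine hex w u hw hwv ?_ h6.1 h5
    have := h6.2 (fun h => hD.loopless j w (h ▸ h5))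
    simpa using this
  have hv₁' : ∀ v, f v = true → v ≠ w₁ → D j v v₁ := by
    intro v hv hvw
    by_contra h1
    have hvX : v ∈ Xᶜ := by rw [Finset.mem_compl, hXm, hv]; simp
    have h2 : ((Xᶜ.erase v).card : ℝ) + 1 = Xᶜ.card := by
      exact_mod_cast Finset.card_erase_add_one hvX
    obtain ⟨u, h3, h4⟩ := hD.exists_out j v (Xᶜ.erase v) (by linarith)
    rcases Finset.mem_insert.1 (key v hv hvw u h3) with rfl | h5
    · exact h1 h3
    · exact h4 h5
  obtain ⟨v, hv, hvv⟩ := hf2 v₁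
  obtain ⟨w, hw, e₂⟩ := hout v hv
  obtain ⟨u, hu, huw⟩ : ∃ u, u ∈ Xᶜ ∧ u ∉ ({w, w₁} : Finset (Fin n)) := by
    refine Finset.exists_mem_notMem_of_card_lt_card ?_
    have h1 : (({w, w₁} : Finset (Fin n)).card : ℝ) ≤ 2 := by
      exact_mod_cast Finset.card_le_two
    rify
    linarith
  rw [Finset.mem_compl, hXm] at hu
  simp only [Finset.mem_insert, Finset.mem_singleton, not_or] at huw
  have hu : f u = true := by simpa using hu
  exact ⟨v, w, u, v₁, hv, hw, hu, hv₁, hvv, fun h => huw.1 h.symm, e₂, hv₁' u hu huw.2⟩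

theorem exists_two_crossing {D : Fin n → Fin n → Fin n → Prop} (hD : DegHyp D) (hn : 10 ≤ n)
    (f : Fin n → Bool) (hf : ∀ a, 2 ≤ (Finset.univ.filter fun v => f v = a).card) :
    ∃ a b c d i j, i ≠ j ∧ f a = false ∧ f b = true ∧ f c = true ∧ f d = false ∧ a ≠ d ∧
      b ≠ c ∧ D i a b ∧ D j c d := by
  have hij : (⟨0, by omega⟩ : Fin n) ≠ ⟨1, by omega⟩ := by simp
  by_cases hX : ((Finset.univ.filter fun v => f v = false).card : ℝ) ≤ n / 2
  · obtain ⟨a, b, c, d, h⟩ := exists_crossing_aux hD hn f (hf false) hX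
      ⟨0, by omega⟩ ⟨1, by omega⟩
    exact ⟨a, b, c, d, _, _, hij, h⟩
  · have h3 := (card_bool_classes f f).2.2
    rify at h3
    have h4 : (Finset.univ.filter fun v => (!f v) = false) =
      Finset.univ.filter fun v => f v = true := by simp
    obtain ⟨a, b, c, d, h1, h2, h3, h4, h5, h6, h7, h8⟩ := exists_crossing_aux hD hn (fun v => !f v)
      (by rw [h4]; exact hf true) (by rw [h4]; linarith) ⟨0, by omega⟩ ⟨1, by omega⟩
    simp only [Bool.not_eq_false', Bool.not_eq_true'] at h1 h2 h3 h4
    exact ⟨c, d, a, b, _, _, hij.symm, h3, h4, h1, h2, h6.symm, h5.symm, h8, h7⟩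

theorem Mat.empty (D : Fin n → Fin n → Fin n → Prop) : Mat D ∅ :=
  ⟨by simp, by simp, by simp, by simp⟩

theorem Mat.singleton {D : Fin n → Fin n → Fin n → Prop} {x : Fin n × Fin n × Fin n}
    (hx : D x.2.2 x.1 x.2.1) : Mat D {x} :=
  ⟨by simpa using hx, by simp, by simp, by simp⟩

theorem Mat.insert {D : Fin n → Fin n → Fin n → Prop} {x : Fin n × Fin n × Fin n}
    {O : Finset (Fin n × Fin n × Fin n)} (hO : Mat D O) (hx : D x.2.2 x.1 x.2.1)
    (h1 : ∀ y ∈ O, y.1 ≠ x.1) (h2 : ∀ y ∈ O, y.2.1 ≠ x.2.1) (h3 : ∀ y ∈ O, y.2.2 ≠ x.2.2) :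
    Mat D (insert x O) := by
  refine ⟨fun y hy => ?_, fun y hy z hz e => ?_, fun y hy z hz e => ?_, fun y hy z hz e => ?_⟩
  · rcases Finset.mem_insert.1 hy with rfl | hy
    exacts [hx, hO.edge y hy]
  · rcases Finset.mem_insert.1 hy with rfl | hy' <;> rcases Finset.mem_insert.1 hz with rfl | hz'
    exacts [rfl, absurd e.symm (h1 z hz'), absurd e (h1 y hy'), hO.inj₁ y hy' z hz' e]
  · rcases Finset.mem_insert.1 hy with rfl | hy' <;> rcases Finset.mem_insert.1 hz with rfl | hz'
    exacts [rfl, absurd e.symm (h2 z hz'), absurd e (h2 y hy'), hO.inj₂ y hy' z hz' e]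
  · rcases Finset.mem_insert.1 hy with rfl | hy' <;> rcases Finset.mem_insert.1 hz with rfl | hz'
    exacts [rfl, absurd e.symm (h3 z hz'), absurd e (h3 y hy'), hO.inj₃ y hy' z hz' e]

theorem imb_of_not_even {τ h t : Fin n → Bool} {x : Fin n × Fin n × Fin n}
    (hx : ¬ Even τ h t x.1 x.2.1 x.2.2) : (t x.2.2 = false ∧ |imb τ h x| = 1) ∨
      (t x.2.2 = true ∧ imb τ h x = 0) := by
  revert hx
  unfold Even imb
  cases τ x.1 <;> cases h x.2.1 <;> cases t x.2.2 <;> simp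

theorem Str.exists_ne {a l : ℝ} {D : Fin n → Fin n → Fin n → Prop} {τ h t : Fin n → Bool}
    {ET EH EC : Finset (Fin n)} (hS : Str a l D τ h t ET EH EC)
    (hn : 10 ^ 16 ≤ n) (ha : a ≤ 1 / 10 ^ 6) (B : Finset (Fin n)) (hB : (B.card : ℝ) ≤ n / 10 ^ 5)
    (h1 : (n : ℝ) / 10 ^ 4 < (Finset.univ.filter fun v => τ v ≠ h v).card) :
    ∃ x₀, x₀ ∉ ET ∧ x₀ ∉ EH ∧ x₀ ∉ B ∧ τ x₀ ≠ h x₀ := by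
  have hnR : (10 : ℝ) ^ 16 ≤ n := by exact_mod_cast hn
  have han : a * n ≤ 1 / 10 ^ 6 * n := mul_le_mul_of_nonneg_right ha (by linarith)
  obtain ⟨x, hx, hxB⟩ := exists_mem_class (fun v => τ v ≠ h v) (ET ∪ EH ∪ B) (by
    have e2 := Finset.card_union_le (ET ∪ EH) B
    have e3 := Finset.card_union_le ET EH
    have h2 : ((ET ∪ EH ∪ B).card : ℝ) ≤ ET.card + EH.card + B.card := by
      exact_mod_cast (by omega : _ ≤ ET.card + EH.card + B.card)
    linarith [hS.cardT, hS.cardH])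
  simp only [Finset.mem_union, not_or] at hxB
  exact ⟨x, hxB.1.1, hxB.1.2, hxB.2, hx⟩

theorem Str.exists_class {a l : ℝ} {D : Fin n → Fin n → Fin n → Prop} {τ h t : Fin n → Bool}
    {ET EH EC : Finset (Fin n)} (hS : Str a l D τ h t ET EH EC)
    (hn : 10 ^ 16 ≤ n) (ha : a ≤ 1 / 10 ^ 6) :
    (∀ b, (n : ℝ) / 2 - a * n ≤ (Finset.univ.filter fun v => τ v = b).card) ∧
    (∀ b, (n : ℝ) / 2 - a * n ≤ (Finset.univ.filter fun v => h v = b).card) ∧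
    (∀ b, ∃ v, τ v = b) ∧ (∃ i, t i = false) := by
  have hnR : (10 : ℝ) ^ 16 ≤ n := by exact_mod_cast hn
  have han : a * n ≤ 1 / 10 ^ 6 * n := mul_le_mul_of_nonneg_right ha (by linarith)
  have u1 := (card_bool_classes τ h).2.2
  have u2 := (card_bool_classes h h).2.2
  have r1 := abs_le.1 hS.sizeT
  have r2 := abs_le.1 hS.sizeH
  have r3 := hS.sizeC
  rify at u1 u2
  have h1 : ∀ b, (n : ℝ) / 2 - a * n ≤ (Finset.univ.filter fun v => τ v = b).card := by
    intro b; cases b <;> linarith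
  refine ⟨h1, ?_, fun b => ?_, ?_⟩
  · intro b; cases b <;> linarith
  · have : (0 : ℝ) < (Finset.univ.filter fun v => τ v = b).card := by linarith [h1 b]
    obtain ⟨v, hv⟩ := Finset.card_pos.1 (by exact_mod_cast this)
    exact ⟨v, (Finset.mem_filter.1 hv).2⟩
  · have : (0 : ℝ) < (Finset.univ.filter fun v => t v = false).card := by linarith
    obtain ⟨v, hv⟩ := Finset.card_pos.1 (by exact_mod_cast this)
    exact ⟨v, (Finset.mem_filter.1 hv).2⟩

/-- The case in which the imbalance is at most the number of colours with `t i = true`. -/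
theorem Str.hasTHC_of_le {a l : ℝ} {D : Fin n → Fin n → Fin n → Prop} {τ h t : Fin n → Bool}
    {ET EH EC : Finset (Fin n)} (hS : Str a l D τ h t ET EH EC) (hn : 10 ^ 16 ≤ n)
    (hD : DegHyp D) (ha : a ≤ 1 / 10 ^ 6) (hl : 1 / 10 ^ 3 ≤ l)
    (hd : |((Finset.univ.filter fun v => τ v = false).card : ℤ) -
      (Finset.univ.filter fun v => h v = false).card| ≤
      (Finset.univ.filter fun i => t i = true).card) : HasTHC D := by
  have hnR : (10 : ℝ) ^ 16 ≤ n := by exact_mod_cast hn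
  have han : a * n ≤ 1 / 10 ^ 6 * n := mul_le_mul_of_nonneg_right ha (by linarith)
  obtain ⟨c1, c2, c3, c4⟩ := hS.exists_class hn ha
  obtain ⟨m, hm⟩ : ∃ m, m = (Finset.univ.filter fun i => t i = true).card := ⟨_, rfl⟩
  obtain ⟨X, hX⟩ : ∃ X, X = (Finset.univ.filter fun v => τ v = false).card := ⟨_, rfl⟩
  obtain ⟨Y, hY⟩ : ∃ Y, Y = (Finset.univ.filter fun v => h v = false).card := ⟨_, rfl⟩
  rw [← hX, ← hY, ← hm] at hd
  have hm1 : 1 ≤ m → ∃ i, t i = true := fun h1 => by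
    obtain ⟨v, hv⟩ := Finset.card_pos.1 (show 0 < (Finset.univ.filter fun i => t i = true).card
      by omega)
    exact ⟨v, (Finset.mem_filter.1 hv).2⟩
  have hpm1 : (X + Y + m) % 2 ≠ 0 → 1 ≤ m := by
    intro h1
    rw [abs_le] at hd
    omega
  have hodd : 1 ≤ m → ∃ x : Fin n × Fin n × Fin n, D x.2.2 x.1 x.2.1 ∧
      ¬ Even τ h t x.1 x.2.1 x.2.2 := fun h1 => exists_odd hD τ h t c3 (by
    intro c; cases c
    exacts [c4, hm1 h1])
  have hsing : ∀ x : Fin n × Fin n × Fin n, D x.2.2 x.1 x.2.1 →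
      ∀ y ∈ ({x} : Finset (Fin n × Fin n × Fin n)),
      ∀ z ∈ ({x} : Finset (Fin n × Fin n × Fin n)), y.2.1 ≠ z.1 := by
    intro x hx y hy z hz e
    rw [Finset.mem_singleton] at hy hz
    rw [hy, hz] at e
    exact hD.loopless x.2.2 x.1 (e ▸ hx)
  by_cases hmL : (n : ℝ) / 10 ^ 4 ≤ m
  · by_cases hpar : (X + Y + m) % 2 = 0
    · refine hS.hasTHC_large hn hD.loopless ha hl (hm ▸ hmL) (Mat.empty D) (by simp) (by simp) ?_
      rw [← hX, ← hY, ← hm]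
      simpa using hpar
    · obtain ⟨x, hx, hxe⟩ := hodd (hpm1 hpar)
      refine hS.hasTHC_large hn hD.loopless ha hl (hm ▸ hmL) (Mat.singleton hx) (hsing x hx)
        (by simp) ?_
      rw [← hX, ← hY, ← hm, Finset.filter_singleton, if_pos hxe, Finset.card_singleton]
      omega
  have hmS : (m : ℝ) ≤ n / 10 ^ 4 := (not_le.1 hmL).le
  by_cases hpar : (X + Y + m) % 2 = 0
  · by_cases hz : (n : ℝ) / 10 ^ 4 < (Finset.univ.filter fun v => τ v ≠ h v).card ∨ 1 ≤ m ∨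
      ∃ v, τ v ≠ h v
    · obtain ⟨b, hb⟩ := exists_signs (Finset.univ.filter fun i => t i = true) ((X : ℤ) - Y)
        (by rw [← hm]; exact hd) (by rw [← hm]; omega)
      refine hS.hasTHC_small hn hD.loopless ha hl (hm ▸ hmS) (Mat.empty D) (by simp)
        (by rw [Finset.card_empty]; push_cast; positivity) b (by simpa [← hX, ← hY] using hb.symm) ?_
      by_cases h1 : (n : ℝ) / 10 ^ 4 < (Finset.univ.filter fun v => τ v ≠ h v).card
      · obtain ⟨x₀, h2, h3, -, h4⟩ := hS.exists_ne hn ha ∅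
          (by rw [Finset.card_empty]; push_cast; positivity) h1
        exact Or.inl ⟨x₀, h2, h3, by simp, h4⟩
      · refine Or.inr ⟨not_lt.1 h1, ?_⟩
        rcases hz with h2 | h2 | ⟨v, hv⟩
        · exact absurd h2 h1
        · obtain ⟨i, hi⟩ := hm1 h2
          exact Or.inl ⟨i, hi, by simp⟩
        · exact Or.inr (Or.inl ⟨v, by simp, hv⟩)
    · push Not at hz
      obtain ⟨h1, h2, h3⟩ := hz
      have hτh : τ = h := funext h3
      have hm0 : m = 0 := by omega
      have ht : ∀ i, t i = false := by
        intro i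
        by_contra h4
        rw [hm, Finset.card_eq_zero, Finset.filter_eq_empty_iff] at hm0
        exact hm0 (Finset.mem_univ i) (by simpa using h4)
      obtain ⟨u, v, w, x, i, j, hij, hu, hv, hw, hx, hux, hvw, e1, e2⟩ := exists_two_crossing hD
        (by omega) τ (fun a => by
          have h4 := c1 a
          exact_mod_cast (show (2 : ℝ) ≤ (Finset.univ.filter fun v => τ v = a).card by linarith))
      have huv : u ≠ v := fun h => by rw [h, hv] at hu; cases hu
      have huw : u ≠ w := fun h => by rw [h, hw] at hu; cases hu
      have hvx : v ≠ x := fun h => by rw [h, hx] at hv; cases hv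
      have hwx : w ≠ x := fun h => by rw [h, hx] at hw; cases hw
      have hne : (u, v, i) ∉ ({(w, x, j)} : Finset (Fin n × Fin n × Fin n)) := by simp [huw]
      refine hS.hasTHC_small hn hD.loopless ha hl (hm ▸ hmS) (O := {(u, v, i), (w, x, j)})
        ((Mat.singleton (x := (w, x, j)) e2).insert (x := (u, v, i)) e1 (by simpa using huw.symm)
          (by simpa using hvx.symm) (by simpa using hij.symm)) ?_ ?_ (fun _ => false) ?_
        (Or.inr ⟨h1, Or.inr (Or.inr ⟨(u, v, i), by simp, ?_⟩)⟩)
      · simp only [Finset.mem_insert, Finset.mem_singleton, forall_eq_or_imp, forall_eq]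
        exact ⟨⟨huv.symm, hvw⟩, hux.symm, hwx.symm⟩
      · rw [Finset.card_insert_of_notMem hne, Finset.card_singleton]
        push_cast
        linarith
      · rw [Finset.sum_insert hne, Finset.sum_singleton, ← hτh]
        simp [imb, hu, hv, hw, hx, ht]
      · simp [← hτh, hu, hv]
  · have hm1' := hpm1 hpar
    obtain ⟨x, hx, hxe, hxl⟩ : ∃ x : Fin n × Fin n × Fin n, D x.2.2 x.1 x.2.1 ∧
        ¬ Even τ h t x.1 x.2.1 x.2.2 ∧ ((n : ℝ) / 10 ^ 4 <
          (Finset.univ.filter fun v => τ v ≠ h v).card ∨ t x.2.2 = false) := by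
      by_cases h1 : (n : ℝ) / 10 ^ 4 < (Finset.univ.filter fun v => τ v ≠ h v).card
      · obtain ⟨x, hx, hxe⟩ := hodd hm1'
        exact ⟨x, hx, hxe, Or.inl h1⟩
      · by_contra! hno
        obtain ⟨i, hi⟩ := c4
        have h2 := ne_of_no_odd hD τ h c3 i (by
          intro v w hvw
          by_contra h3
          exact (hno (v, w, i) hvw (by simpa [Even, hi] using h3)).2 hi)
        apply h1
        rw [Finset.filter_true_of_mem fun v _ => h2 v, Finset.card_univ, Fintype.card_fin]
        linarith
    obtain ⟨K, hK⟩ : ∃ K, K = Finset.univ.filter (fun i => t i = true ∧ i ∉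
      ({x} : Finset (Fin n × Fin n × Fin n)).image fun x => x.2.2) := ⟨_, rfl⟩
    have hbK : |(X : ℤ) - Y - imb τ h x| ≤ K.card ∧ ((X : ℤ) - Y - imb τ h x + K.card) % 2 = 0 := by
      rcases imb_of_not_even hxe with ⟨h1, h2⟩ | ⟨h1, h2⟩
      · have h3 : K.card = m := by
          rw [hm, hK]
          congr 1
          ext i
          simp only [Finset.mem_filter, Finset.mem_univ, true_and, Finset.image_singleton,
            Finset.mem_singleton, and_iff_left_iff_imp]
          rintro h4 rfl
          rw [h1] at h4; cases h4
        rw [h3]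
        rw [abs_le] at hd ⊢
        have h4 : imb τ h x = 1 ∨ imb τ h x = -1 := by
          rcases abs_eq (zero_le_one) |>.1 h2 with h | h <;> simp [h]
        omega
      · have h3 : K.card + 1 = m := by
          have h5 : x.2.2 ∈ Finset.univ.filter fun i => t i = true :=
            Finset.mem_filter.2 ⟨Finset.mem_univ _, h1⟩
          have h6 : K = (Finset.univ.filter fun i => t i = true).erase x.2.2 := by
            rw [hK]
            ext i
            simp [and_comm]
          rw [hm, ← Finset.card_erase_add_one h5, h6]
        rw [h2]
        rw [abs_le] at hd ⊢
        omega
    obtain ⟨b, hb⟩ := exists_signs K _ hbK.1 hbK.2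
    refine hS.hasTHC_small hn hD.loopless ha hl (hm ▸ hmS) (Mat.singleton hx) (hsing x hx)
      (by rw [Finset.card_singleton]; push_cast; linarith) b ?_ ?_
    · rw [← hX, ← hY, ← hK, hb, Finset.sum_singleton]
      ring
    · by_cases h1 : (n : ℝ) / 10 ^ 4 < (Finset.univ.filter fun v => τ v ≠ h v).card
      · obtain ⟨x₀, h2, h3, h5, h4⟩ := hS.exists_ne hn ha {x.1, x.2.1} (by
          have h1 : (({x.1, x.2.1} : Finset (Fin n)).card : ℝ) ≤ 2 := by
            exact_mod_cast Finset.card_le_two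
          linarith) h1
        simp only [Finset.mem_insert, Finset.mem_singleton, not_or] at h5
        refine Or.inl ⟨x₀, h2, h3, ?_, h4⟩
        simp only [Finset.mem_singleton, forall_eq]
        exact ⟨fun h => h5.1 h.symm, fun h => h5.2 h.symm⟩
      · refine Or.inr ⟨not_lt.1 h1, Or.inl ?_⟩
        obtain ⟨i, hi⟩ := hm1 hm1'
        refine ⟨i, hi, ?_⟩
        simp only [Finset.mem_singleton, forall_eq]
        rintro rfl
        rw [hxl.resolve_left h1] at hi
        cases hi

theorem card_filter_swap {α β : Type*} [Fintype α] [Fintype β] (P : α × β → Prop)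
    [DecidablePred P] [DecidablePred fun p : β × α => P (p.2, p.1)] :
    (Finset.univ.filter P).card = (Finset.univ.filter fun p : β × α => P (p.2, p.1)).card :=
  Finset.card_bij (fun p _ => (p.2, p.1)) (by simp) (by
    rintro ⟨a, b⟩ - ⟨c, d⟩ - h
    simp only [Prod.mk.injEq] at h ⊢
    exact h.symm) (by
    rintro ⟨b, a⟩ h
    exact ⟨(a, b), by simpa using h, rfl⟩)

theorem mul_le_card_filter_fst {α β : Type*} [Fintype α] [Fintype β] (P : α → Prop)
    [DecidablePred P] (R : α → β → Prop) [∀ a b, Decidable (R a b)] {c : ℝ}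
    (h : ∀ a, P a → c ≤ (Finset.univ.filter fun b => R a b).card) :
    ((Finset.univ.filter P).card : ℝ) * c ≤
      (Finset.univ.filter fun p : α × β => P p.1 ∧ R p.1 p.2).card := by
  have e := card_filter_prod_eq_sum fun a b => P a ∧ R a b
  refine le_trans ?_ (le_of_eq ((e.symm).trans (by congr)))
  rw [← nsmul_eq_mul, ← Finset.sum_const, Finset.sum_filter]
  refine Finset.sum_le_sum fun a _ => ?_
  by_cases ha : P a
  · simpa [ha] using h a ha
  · simp [ha]

theorem mul_le_card_filter_snd {α β : Type*} [Fintype α] [Fintype β] (P : β → Prop)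
    [DecidablePred P] (R : α → β → Prop) [∀ a b, Decidable (R a b)] {c : ℝ}
    (h : ∀ b, P b → c ≤ (Finset.univ.filter fun a => R a b).card) :
    ((Finset.univ.filter P).card : ℝ) * c ≤
      (Finset.univ.filter fun p : α × β => P p.2 ∧ R p.1 p.2).card := by
  rw [card_filter_swap fun p : α × β => P p.2 ∧ R p.1 p.2]
  exact mul_le_card_filter_fst P (fun b a => R a b) h

/-- Number of edges from `τ = false` to `h = true` forced by the imbalance. -/
theorem DegHyp.crossing_card {D : Fin n → Fin n → Fin n → Prop} (hD : DegHyp D)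
    (τ h : Fin n → Bool) {d s : ℝ} (hd : 0 ≤ d)
    (hdd : d ≤ ((Finset.univ.filter fun v => τ v = false).card : ℝ) -
      (Finset.univ.filter fun v => h v = false).card)
    (hs : s ≤ (Finset.univ.filter fun v => τ v = false).card)
    (hs' : s ≤ (Finset.univ.filter fun v => h v = true).card) (i : Fin n) :
    d / 2 * s ≤ (Finset.univ.filter fun p : Fin n × Fin n =>
      τ p.1 = false ∧ h p.2 = true ∧ D i p.1 p.2).card := by
  have hsplit : ∀ (f : Fin n → Bool) (P : Fin n → Prop) (b : Bool),
      ((Finset.univ.filter P).card : ℝ) ≤ (Finset.univ.filter fun v => f v = b ∧ P v).card +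
        (Finset.univ.filter fun v => f v = !b).card := by
    intro f P b
    have h1 : Finset.univ.filter P ⊆ (Finset.univ.filter fun v => f v = b ∧ P v) ∪
        Finset.univ.filter fun v => f v = !b := by
      intro v hv
      have hv' : P v := by simpa using hv
      cases hf : f v <;> cases b <;> simp [hf, hv']
    have h2 := (Finset.card_le_card h1).trans (Finset.card_union_le _ _)
    exact_mod_cast h2
  have u1 := (card_bool_classes τ h).2.2
  rify at u1
  rcases le_total (((Finset.univ.filter fun v => h v = false).card : ℝ) + d / 2) (n / 2) with hc | hc
  · refine le_trans ?_ (mul_le_card_filter_fst (fun v => τ v = false)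
      (fun v w => h w = true ∧ D i v w) (c := d / 2) fun v _ => ?_)
    · have := mul_le_mul_of_nonneg_right hs (by positivity : 0 ≤ d / 2)
      linarith
    · have h1 := hsplit h (fun w => D i v w) true
      have h2 := hD.out i v
      simp only [Bool.not_true] at h1
      linarith
  · have h3 := mul_le_card_filter_snd (fun w => h w = true)
      (fun v w => τ v = false ∧ D i v w) (c := d / 2) fun w _ => by
        have h1 := hsplit τ (fun v => D i v w) false
        have h2 := hD.inn i w
        simp only [Bool.not_false] at h1
        linarith
    refine le_trans ?_ (h3.trans (le_of_eq ?_))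
    · have := mul_le_mul_of_nonneg_right hs' (by positivity : 0 ≤ d / 2)
      linarith
    · simp only [and_left_comm]

theorem card_triples_le (F : Finset (Fin n × Fin n × Fin n)) (B : Finset (Fin n)) {c : ℝ}
    (hF : ∀ x ∈ F, x.1 ∈ B ∨ x.2.1 ∈ B)
    (h1 : ∀ v, ((F.filter fun x => x.1 = v).card : ℝ) ≤ c)
    (h2 : ∀ v, ((F.filter fun x => x.2.1 = v).card : ℝ) ≤ c) :
    (F.card : ℝ) ≤ 2 * B.card * c := by
  have h3 : F ⊆ B.biUnion (fun v => F.filter fun x => x.1 = v) ∪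
      B.biUnion (fun v => F.filter fun x => x.2.1 = v) := by
    intro x hx
    simp only [Finset.mem_union, Finset.mem_biUnion, Finset.mem_filter]
    rcases hF x hx with h | h
    · exact Or.inl ⟨_, h, hx, rfl⟩
    · exact Or.inr ⟨_, h, hx, rfl⟩
  have h4 := (Finset.card_le_card h3).trans (Finset.card_union_le _ _)
  have h5 : ((B.biUnion (fun v => F.filter fun x => x.1 = v)).card : ℝ) ≤ B.card * c := by
    have := Finset.card_biUnion_le (s := B) (t := fun v => F.filter fun x => x.1 = v)
    calc _ ≤ ((∑ v ∈ B, (F.filter fun x => x.1 = v).card : ℕ) : ℝ) := by exact_mod_cast this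
      _ = ∑ v ∈ B, ((F.filter fun x => x.1 = v).card : ℝ) := by push_cast; rfl
      _ ≤ ∑ v ∈ B, c := Finset.sum_le_sum fun v _ => h1 v
      _ = _ := by rw [Finset.sum_const, nsmul_eq_mul]
  have h6 : ((B.biUnion (fun v => F.filter fun x => x.2.1 = v)).card : ℝ) ≤ B.card * c := by
    have := Finset.card_biUnion_le (s := B) (t := fun v => F.filter fun x => x.2.1 = v)
    calc _ ≤ ((∑ v ∈ B, (F.filter fun x => x.2.1 = v).card : ℕ) : ℝ) := by exact_mod_cast this
      _ = ∑ v ∈ B, ((F.filter fun x => x.2.1 = v).card : ℝ) := by push_cast; rfl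
      _ ≤ ∑ v ∈ B, c := Finset.sum_le_sum fun v _ => h2 v
      _ = _ := by rw [Finset.sum_const, nsmul_eq_mul]
  have h7 : (F.card : ℝ) ≤ (B.biUnion (fun v => F.filter fun x => x.1 = v)).card +
    (B.biUnion (fun v => F.filter fun x => x.2.1 = v)).card := by exact_mod_cast h4
  linarith

theorem exists_low_matching {D : Fin n → Fin n → Fin n → Prop} (hD : DegHyp D)
    (τ h t : Fin n → Bool) (hn : 10 ≤ n) {d : ℕ} (hdn : (d : ℝ) ≤ n / 100)
    (hdd : (d : ℝ) ≤ ((Finset.univ.filter fun v => τ v = false).card : ℝ) -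
      (Finset.univ.filter fun v => h v = false).card)
    (hs : 2 / 5 * (n : ℝ) ≤ (Finset.univ.filter fun v => τ v = false).card)
    (hs' : 2 / 5 * (n : ℝ) ≤ (Finset.univ.filter fun v => h v = true).card)
    (hC : (n : ℝ) / 3 ≤ (Finset.univ.filter fun i => t i = false).card)
    (lowT : ∀ v, τ v = false → ((Finset.univ.filter fun p : Fin n × Fin n =>
      h p.1 = true ∧ t p.2 = false ∧ D p.2 v p.1).card : ℝ) ≤ 1 / 200 * (n : ℝ) ^ 2)
    (lowH : ∀ w, h w = true → ((Finset.univ.filter fun p : Fin n × Fin n =>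
      τ p.1 = false ∧ t p.2 = false ∧ D p.2 p.1 w).card : ℝ) ≤ 1 / 200 * (n : ℝ) ^ 2)
    (x₀ : Fin n) (k : ℕ) (hk : k ≤ d) :
    ∃ O, Mat D O ∧ O.card = k ∧ (∀ x ∈ O, τ x.1 = false ∧ h x.2.1 = true ∧ t x.2.2 = false) ∧
      (∀ x ∈ O, ∀ y ∈ O, x.2.1 ≠ y.1) ∧ ∀ x ∈ O, x.1 ≠ x₀ ∧ x.2.1 ≠ x₀ := by
  have hnR : (10 : ℝ) ≤ n := by exact_mod_cast hn
  induction k with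
  | zero => exact ⟨∅, Mat.empty D, by simp, by simp, by simp, by simp⟩
  | succ k ih =>
    obtain ⟨O, hO, hOc, hOt, hOd, hO0⟩ := ih (by omega)
    obtain ⟨B, hB⟩ : ∃ B, B = insert x₀ ((O.image fun x => x.1) ∪ O.image fun x => x.2.1) :=
      ⟨_, rfl⟩
    have hBc : (B.card : ℝ) ≤ 2 * k + 1 := by
      have e1 := Finset.card_insert_le x₀ ((O.image fun x => x.1) ∪ O.image fun x => x.2.1)
      have e2 := Finset.card_union_le (O.image fun x => x.1) (O.image fun x => x.2.1)
      have e5 := Finset.card_image_le (s := O) (f := fun x => x.1)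
      have e6 := Finset.card_image_le (s := O) (f := fun x => x.2.1)
      rw [hB]
      exact_mod_cast (by omega)
    obtain ⟨S, hS⟩ : ∃ S, S = (Finset.univ.filter fun i => t i = false) \ O.image fun x => x.2.2 :=
      ⟨_, rfl⟩
    have hSc : (n : ℝ) / 3 - k ≤ S.card := by
      have e1 := Finset.le_card_sdiff (O.image fun x => x.2.2)
        (Finset.univ.filter fun i => t i = false)
      have e6 := Finset.card_image_le (s := O) (f := fun x => x.2.2)
      rw [← hS] at e1
      have : ((Finset.univ.filter fun i => t i = false).card : ℝ) ≤ S.card + k := by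
        exact_mod_cast (by omega)
      linarith
    have hkd : (k : ℝ) + 1 ≤ d := by exact_mod_cast hk
    obtain ⟨x, hxe, hx1, hx2, hxS, hxB, hxB'⟩ : ∃ x : Fin n × Fin n × Fin n, D x.2.2 x.1 x.2.1 ∧
        τ x.1 = false ∧ h x.2.1 = true ∧ x.2.2 ∈ S ∧ x.1 ∉ B ∧ x.2.1 ∉ B := by
      by_contra! hno
      obtain ⟨F, hF⟩ : ∃ F : Finset (Fin n × Fin n × Fin n), F = Finset.univ.filter fun x =>
        D x.2.2 x.1 x.2.1 ∧ τ x.1 = false ∧ h x.2.1 = true ∧ x.2.2 ∈ S := ⟨_, rfl⟩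
      have hmem : ∀ x, x ∈ F ↔ D x.2.2 x.1 x.2.1 ∧ τ x.1 = false ∧ h x.2.1 = true ∧ x.2.2 ∈ S :=
        fun x => by simp [hF]
      have hSt : ∀ i ∈ S, t i = false := fun i hi => by
        rw [hS, Finset.mem_sdiff] at hi; simpa using hi.1
      have f1 := card_triples_le F B (c := 1 / 200 * (n : ℝ) ^ 2) (by
          intro x hx
          rw [hmem] at hx
          by_contra! h1
          exact h1.2 (hno x hx.1 hx.2.1 hx.2.2.1 hx.2.2.2 h1.1)) (by
          intro v
          by_cases hv : τ v = false
          · refine le_trans ?_ (lowT v hv)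
            rw [Nat.cast_le]
            refine Finset.card_le_card_of_injOn (fun x => x.2) ?_ ?_
            · rintro ⟨u, w, i⟩ hx
              simp only [Finset.coe_filter, hmem, Set.mem_ofPred_eq] at hx
              simp only [Finset.coe_filter, Finset.mem_univ, true_and, Set.mem_ofPred_eq]
              obtain ⟨⟨h1, h2, h3, h4⟩, rfl⟩ := hx
              exact ⟨h3, hSt i h4, h1⟩
            · rintro ⟨u, w, i⟩ hx ⟨u', w', i'⟩ hx' e
              simp only [Finset.coe_filter, Set.mem_ofPred_eq] at hx hx'
              simp only [Prod.mk.injEq] at e ⊢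
              exact ⟨hx.2.trans hx'.2.symm, e⟩
          · rw [Finset.filter_eq_empty_iff.2 (fun x hx e => hv (by rw [← e]; exact ((hmem x).1 hx).2.1)),
              Finset.card_empty]
            push_cast
            positivity) (by
          intro v
          by_cases hv : h v = true
          · refine le_trans ?_ (lowH v hv)
            rw [Nat.cast_le]
            refine Finset.card_le_card_of_injOn (fun x => (x.1, x.2.2)) ?_ ?_
            · rintro ⟨u, w, i⟩ hx
              simp only [Finset.coe_filter, hmem, Set.mem_ofPred_eq] at hx
              simp only [Finset.coe_filter, Finset.mem_univ, true_and, Set.mem_ofPred_eq]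
              obtain ⟨⟨h1, h2, h3, h4⟩, rfl⟩ := hx
              exact ⟨h2, hSt i h4, h1⟩
            · rintro ⟨u, w, i⟩ hx ⟨u', w', i'⟩ hx' e
              simp only [Finset.coe_filter, Set.mem_ofPred_eq] at hx hx'
              simp only [Prod.mk.injEq] at e ⊢
              exact ⟨e.1, hx.2.trans hx'.2.symm, e.2⟩
          · rw [Finset.filter_eq_empty_iff.2 (fun x hx e => hv (by rw [← e]; exact ((hmem x).1 hx).2.2.1)),
              Finset.card_empty]
            push_cast
            positivity)
      have f2 : (S.card : ℝ) * (d / 2 * (2 / 5 * n)) ≤ F.card := by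
        have e1 : F.card = ∑ i ∈ S, (F.filter fun x => x.2.2 = i).card :=
          Finset.card_eq_sum_card_fiberwise fun x hx => ((hmem x).1 hx).2.2.2
        rw [e1, ← nsmul_eq_mul, ← Finset.sum_const]
        push_cast
        refine Finset.sum_le_sum fun i hi => ?_
        refine (hD.crossing_card τ h (by positivity) hdd hs hs' i).trans ?_
        rw [Nat.cast_le]
        refine Finset.card_le_card_of_injOn (fun p => (p.1, p.2, i)) ?_ ?_
        · intro p hp
          simp only [Finset.coe_filter, Finset.mem_univ, true_and, Set.mem_ofPred_eq] at hp
          simp only [Finset.coe_filter, hmem, Set.mem_ofPred_eq]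
          simp [hp, hi]
        · rintro ⟨u, w⟩ - ⟨u', w'⟩ - e
          simp only [Prod.mk.injEq] at e ⊢
          exact ⟨e.1, e.2.1⟩
      have hk0 : (0 : ℝ) ≤ k := by positivity
      have f3 : (3 : ℝ) / 10 * n ≤ S.card := by linarith
      have f4 : (3 : ℝ) / 10 * n * (d / 2 * (2 / 5 * n)) ≤ S.card * (d / 2 * (2 / 5 * n)) :=
        mul_le_mul_of_nonneg_right f3 (by positivity)
      have f5 : 2 * (B.card : ℝ) * (1 / 200 * n ^ 2) ≤ 2 * (2 * d) * (1 / 200 * n ^ 2) :=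
        mul_le_mul_of_nonneg_right (by linarith) (by positivity)
      have f6 : (0 : ℝ) < d * n ^ 2 := mul_pos (by linarith) (by positivity)
      nlinarith
    rw [hS, Finset.mem_sdiff] at hxS
    simp only [Finset.mem_image, not_exists, not_and, Finset.mem_filter, Finset.mem_univ,
      true_and] at hxS
    rw [hB] at hxB hxB'
    simp only [Finset.mem_insert, Finset.mem_union, Finset.mem_image, not_or, not_exists,
      not_and] at hxB hxB'
    refine ⟨insert x O, hO.insert hxe (fun y hy => hxB.2.1 y hy) (fun y hy => hxB'.2.2 y hy)
      (fun y hy => hxS.2 y hy), ?_, ?_, ?_, ?_⟩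
    · rw [Finset.card_insert_of_notMem fun h => hxB.2.1 x h rfl, hOc]
    · intro y hy
      rcases Finset.mem_insert.1 hy with rfl | hy'
      exacts [⟨hx1, hx2, hxS.1⟩, hOt y hy']
    · intro y hy z hz e
      rcases Finset.mem_insert.1 hy with rfl | hy' <;> rcases Finset.mem_insert.1 hz with rfl | hz'
      · exact hD.loopless _ _ (e ▸ hxe)
      · exact hxB'.2.1 z hz' e.symm
      · exact hxB.2.2 y hy' e
      · exact hOd y hy' z hz' e
    · intro y hy
      rcases Finset.mem_insert.1 hy with rfl | hyO
      exacts [⟨hxB.1, hxB'.1⟩, hO0 y hyO]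

/-- The case in which the imbalance exceeds the number of colours with `t i = true`, and no vertex
of the two larger classes sends many edges to the other larger class. -/
theorem Str.hasTHC_of_low {a l : ℝ} {D : Fin n → Fin n → Fin n → Prop} {τ h t : Fin n → Bool}
    {ET EH EC : Finset (Fin n)} (hS : Str a l D τ h t ET EH EC) (hn : 10 ^ 16 ≤ n)
    (hD : DegHyp D) (ha : a ≤ 1 / 10 ^ 6) (hl : 1 / 10 ^ 3 ≤ l)
    (hd : ((Finset.univ.filter fun i => t i = true).card : ℤ) <
      (Finset.univ.filter fun v => τ v = false).card -
      (Finset.univ.filter fun v => h v = false).card)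
    (lowT : ∀ v, τ v = false → ((Finset.univ.filter fun p : Fin n × Fin n =>
      h p.1 = true ∧ t p.2 = false ∧ D p.2 v p.1).card : ℝ) ≤ 1 / 200 * (n : ℝ) ^ 2)
    (lowH : ∀ w, h w = true → ((Finset.univ.filter fun p : Fin n × Fin n =>
      τ p.1 = false ∧ t p.2 = false ∧ D p.2 p.1 w).card : ℝ) ≤ 1 / 200 * (n : ℝ) ^ 2) :
    HasTHC D := by
  have hnR : (10 : ℝ) ^ 16 ≤ n := by exact_mod_cast hn
  have han : a * n ≤ 1 / 10 ^ 6 * n := mul_le_mul_of_nonneg_right ha (by linarith)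
  obtain ⟨c1, c2, c3, c4⟩ := hS.exists_class hn ha
  obtain ⟨m, hm⟩ : ∃ m, m = (Finset.univ.filter fun i => t i = true).card := ⟨_, rfl⟩
  obtain ⟨X, hX⟩ : ∃ X, X = (Finset.univ.filter fun v => τ v = false).card := ⟨_, rfl⟩
  obtain ⟨Y, hY⟩ : ∃ Y, Y = (Finset.univ.filter fun v => h v = false).card := ⟨_, rfl⟩
  rw [← hX, ← hY, ← hm] at hd
  obtain ⟨d, hdd⟩ : ∃ d : ℕ, X = Y + d := ⟨X - Y, by omega⟩
  have r1 := abs_le.1 hS.sizeT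
  have r2 := abs_le.1 hS.sizeH
  rw [← hX] at r1
  rw [← hY] at r2
  have hXY : (X : ℝ) = Y + d := by exact_mod_cast hdd
  have hdn : (d : ℝ) ≤ 2 / 10 ^ 6 * n := by linarith
  have hmd : (m : ℝ) ≤ d := by exact_mod_cast (by omega : m ≤ d)
  obtain ⟨x₀, hx₀, hx₀'⟩ : ∃ x₀, τ x₀ ≠ h x₀ ∧
      ((n : ℝ) / 10 ^ 4 < (Finset.univ.filter fun v => τ v ≠ h v).card → x₀ ∉ ET ∧ x₀ ∉ EH) := by
    by_cases h1 : (n : ℝ) / 10 ^ 4 < (Finset.univ.filter fun v => τ v ≠ h v).card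
    · obtain ⟨x₀, h2, h3, -, h4⟩ := hS.exists_ne hn ha ∅
          (by rw [Finset.card_empty]; push_cast; positivity) h1
      exact ⟨x₀, h4, fun _ => ⟨h2, h3⟩⟩
    · by_contra! hno
      have : τ = h := funext fun v => by
        by_contra hv
        exact absurd (hno v hv).1 h1
      rw [this, ← hY] at hX
      omega
  obtain ⟨O, hO, hOc, hOt, hOd, hO0⟩ := exists_low_matching hD τ h t (by omega) (d := d)
    (by linarith) (by rw [← hX, ← hY]; linarith) (by linarith [c1 false]) (by linarith [c2 true])
    hS.sizeC lowT lowH x₀ (d - m) (by omega)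
  refine hS.hasTHC_small hn hD.loopless ha hl (by rw [← hm]; linarith) hO hOd ?_ (fun _ => false)
    ?_ ?_
  · have : (O.card : ℝ) ≤ d := by exact_mod_cast (by omega : O.card ≤ d)
    linarith
  · have e1 : ∑ x ∈ O, imb τ h x = O.card := by
      rw [Finset.card_eq_sum_ones]
      push_cast
      refine Finset.sum_congr rfl fun x hx => ?_
      simp [imb, (hOt x hx).1, (hOt x hx).2.1]
    have e2 : (Finset.univ.filter fun i => t i = true ∧ i ∉ O.image fun x => x.2.2) =
        Finset.univ.filter fun i => t i = true := by
      refine Finset.filter_congr fun i _ => ⟨fun h => h.1, fun h => ⟨h, fun hi => ?_⟩⟩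
      obtain ⟨x, hx, rfl⟩ := Finset.mem_image.1 hi
      rw [(hOt x hx).2.2] at h
      cases h
    rw [e1, e2, hOc, ← hX, ← hY]
    simp only [Bool.false_eq_true, if_false, Finset.sum_const, nsmul_eq_mul, mul_one, ← hm]
    omega
  · by_cases h1 : (n : ℝ) / 10 ^ 4 < (Finset.univ.filter fun v => τ v ≠ h v).card
    · exact Or.inl ⟨x₀, (hx₀' h1).1, (hx₀' h1).2, hO0, hx₀⟩
    · exact Or.inr ⟨not_lt.1 h1, Or.inr (Or.inl ⟨x₀, hO0, hx₀⟩)⟩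

theorem card_filter_le_add {P Q : Fin n × Fin n → Prop} [DecidablePred P] [DecidablePred Q]
    (A B : Finset (Fin n)) (hPQ : ∀ p, P p → Q p ∨ p.1 ∈ A ∨ p.2 ∈ B) :
    ((Finset.univ.filter P).card : ℝ) ≤ (Finset.univ.filter Q).card + (A.card + B.card) * n := by
  have h1 : Finset.univ.filter P ⊆ Finset.univ.filter Q ∪
      (A ×ˢ Finset.univ ∪ Finset.univ ×ˢ B) := by
    intro p hp
    have := hPQ p (by simpa using hp)
    simpa using this
  have h2 := (Finset.card_le_card h1).trans ((Finset.card_union_le _ _).trans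
    (Nat.add_le_add_left (Finset.card_union_le _ _) _))
  rw [Finset.card_product, Finset.card_product, Finset.card_univ, Fintype.card_fin] at h2
  have h3 : ((Finset.univ.filter P).card : ℝ) ≤
    (Finset.univ.filter Q).card + (A.card * n + n * B.card) := by exact_mod_cast h2
  linarith

theorem card_filter_not_eq (f : Fin n → Bool) :
    ((Finset.univ.filter fun v => (!f v) = false).card : ℝ) =
      n - (Finset.univ.filter fun v => f v = false).card := by
  have u := (card_bool_classes f f).2.2
  rify at u
  simp only [Bool.not_eq_false']
  linarith

theorem card_update_true {τ : Fin n → Bool} {v : Fin n} (hv : τ v = false) :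
    (Finset.univ.filter fun u => Function.update τ v true u = false).card + 1 =
      (Finset.univ.filter fun u => τ u = false).card := by
  have e : (Finset.univ.filter fun u => Function.update τ v true u = false) =
      (Finset.univ.filter fun u => τ u = false).erase v := by
    ext u
    by_cases huv : u = v
    · simp [huv]
    · simp [huv]
  rw [e, Finset.card_erase_add_one (by simpa using hv)]

theorem Str.rev {a l : ℝ} {D : Fin n → Fin n → Fin n → Prop} {τ h t : Fin n → Bool}
    {ET EH EC : Finset (Fin n)} (hS : Str a l D τ h t ET EH EC) :
    Str a l (fun i v w => D i w v) h τ t EH ET EC := by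
  have hE : ∀ v w i, Even h τ t v w i ↔ Even τ h t w v i := fun v w i => by
    unfold Even; rw [Bool.xor_comm]
  refine ⟨hS.cardH, hS.cardT, hS.cardC, ?_, ?_, ?_, hS.capH, hS.capT, ?_, ?_, hS.sizeH, hS.sizeT,
    hS.sizeC⟩
  · simpa only [hE] using hS.head
  · simpa only [hE] using hS.tail
  · intro i hi
    rw [card_filter_swap]
    refine le_trans (le_of_eq ?_) (hS.col i hi)
    congr 2
    ext p
    simp only [Finset.mem_filter, hE]
    tauto
  · intro i hi hti
    rw [card_filter_swap]
    refine (hS.capC i hi hti).trans (le_of_eq ?_)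
    congr 2
    ext p
    simp only [Finset.mem_filter, eq_comm]
  · intro i b hti
    rw [card_filter_swap]
    refine (hS.capC' i (!b) hti).trans (le_of_eq ?_)
    congr 2
    ext p
    simp only [Finset.mem_filter, Bool.not_not]
    tauto

theorem Str.neg {a l : ℝ} {D : Fin n → Fin n → Fin n → Prop} {τ h t : Fin n → Bool}
    {ET EH EC : Finset (Fin n)} (hS : Str a l D τ h t ET EH EC) :
    Str a l D (fun v => !τ v) (fun v => !h v) t ET EH EC := by
  have hE : ∀ v w i, Even (fun v => !τ v) (fun v => !h v) t v w i ↔ Even τ h t v w i :=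
    fun v w i => by unfold Even; simp
  refine ⟨hS.cardT, hS.cardH, hS.cardC, ?_, ?_, ?_, ?_, ?_, ?_, ?_, ?_, ?_, hS.sizeC⟩
  · simpa only [hE] using hS.tail
  · simpa only [hE] using hS.head
  · simpa only [hE] using hS.col
  · simpa using hS.capT
  · simpa using hS.capH
  · simpa using hS.capC
  · intro i b hti
    refine (hS.capC' i (!b) hti).trans (le_of_eq ?_)
    congr 2
    ext p
    simp only [Finset.mem_filter]
    cases b <;> simp
  · rw [card_filter_not_eq, abs_sub_comm]
    refine le_trans (le_of_eq ?_) hS.sizeT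
    congr 1
    ring
  · rw [card_filter_not_eq, abs_sub_comm]
    refine le_trans (le_of_eq ?_) hS.sizeH
    congr 1
    ring

/-- Moving a tail with many edges into the other class. -/
theorem Str.flip {a l : ℝ} {D : Fin n → Fin n → Fin n → Prop} {τ h t : Fin n → Bool}
    {ET EH EC : Finset (Fin n)} (hS : Str a l D τ h t ET EH EC) (hn : 0 < n) {v : Fin n}
    (hv : τ v = false) (hc : l * (n : ℝ) ^ 2 ≤ (Finset.univ.filter fun p : Fin n × Fin n =>
      h p.1 = true ∧ t p.2 = false ∧ D p.2 v p.1).card) :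
    Str (a + 1 / n) (l - 1 / n) D (Function.update τ v true) h t (insert v ET) EH EC := by
  have hnR : (0 : ℝ) < n := by exact_mod_cast hn
  have ean : (a + 1 / n) * n = a * n + 1 := by field_simp
  have eln : (l - 1 / n) * (n : ℝ) ^ 2 = l * (n : ℝ) ^ 2 - n := by field_simp
  obtain ⟨τ', hτ'⟩ : ∃ τ', τ' = Function.update τ v true := ⟨_, rfl⟩
  have hne : ∀ u, u ≠ v → τ' u = τ u := fun u hu => by rw [hτ', Function.update_of_ne hu]
  have hvv : τ' v = true := by rw [hτ', Function.update_self]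
  have key : ∀ (P Q : Fin n × Fin n → Prop) [DecidablePred P] [DecidablePred Q],
      (∀ p, p.1 ≠ v → P p → Q p) → l * (n : ℝ) ^ 2 ≤ (Finset.univ.filter P).card →
      l * (n : ℝ) ^ 2 - n ≤ (Finset.univ.filter Q).card := by
    intro P Q _ _ hPQ hP
    have h1 := card_filter_le_add (P := P) (Q := Q) {v} ∅ fun p hp => by
      by_cases hpv : p.1 = v
      · exact Or.inr (Or.inl (by simp [hpv]))
      · exact Or.inl (hPQ p hpv hp)
    rw [Finset.card_singleton, Finset.card_empty] at h1
    push_cast at h1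
    linarith
  have mono : ∀ (P Q : Fin n × Fin n → Prop) [DecidablePred P] [DecidablePred Q],
      (∀ p, P p → Q p) → ∀ {c : ℝ}, ((Finset.univ.filter Q).card : ℝ) ≤ c →
      ((Finset.univ.filter P).card : ℝ) ≤ c := by
    intro P Q _ _ hPQ c hc
    refine le_trans ?_ hc
    rw [Nat.cast_le]
    exact Finset.card_le_card fun p hp => by
      simp only [Finset.mem_filter, Finset.mem_univ, true_and] at hp ⊢
      exact hPQ p hp
  rw [← hτ']
  refine ⟨?_, ?_, ?_, ?_, ?_, ?_, ?_, ?_, ?_, ?_, ?_, ?_, hS.sizeC⟩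
  · rw [ean]
    have : ((insert v ET).card : ℝ) ≤ ET.card + 1 := by
      exact_mod_cast Finset.card_insert_le v ET
    linarith [hS.cardT]
  · rw [ean]; linarith [hS.cardH]
  · rw [ean]; linarith [hS.cardC]
  · intro u hu
    rw [Finset.mem_insert, not_or] at hu
    refine mono _ _ (fun p hp => ?_) (hS.tail u hu.2)
    unfold Even at hp ⊢
    rwa [hne u hu.1] at hp
  · intro w hw
    refine mono _ _ (fun p hp => ?_) (hS.head w hw)
    unfold Even at hp ⊢
    rw [Finset.mem_insert, not_or] at hp
    rw [hne p.1 hp.1.1] at hp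
    exact ⟨hp.1.2, hp.2⟩
  · intro i hi
    refine mono _ _ (fun p hp => ?_) (hS.col i hi)
    unfold Even at hp ⊢
    rw [Finset.mem_insert, not_or] at hp
    rw [hne p.1 hp.1.1] at hp
    exact ⟨hp.1.2, hp.2⟩
  · intro u hu
    rw [eln]
    by_cases huv : u = v
    · rw [huv, hvv]; linarith
    · rw [hne u huv]
      linarith [hS.capT u ((Finset.mem_insert.1 hu).resolve_left huv)]
  · intro w hw
    rw [eln]
    refine key _ _ (fun p hp h1 => ?_) (hS.capH w hw)
    rwa [hne p.1 hp]
  · intro i hi hti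
    rw [eln]
    refine key _ _ (fun p hp h1 => ?_) (hS.capC i hi hti)
    rwa [hne p.1 hp]
  · intro i b hti
    rw [eln]
    refine key _ _ (fun p hp h1 => ?_) (hS.capC' i b hti)
    rwa [hne p.1 hp]
  · rw [ean]
    have e := card_update_true hv
    rw [← hτ'] at e
    rify at e
    have h1 := abs_le.1 hS.sizeT
    rw [abs_le]
    constructor <;> linarith
  · rw [ean]; linarith [hS.sizeH]

theorem Str.hasTHC_of_le_add (hn : 10 ^ 16 ≤ n) {t : Fin n → Bool} {EC : Finset (Fin n)} (k : ℕ) :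
    ∀ {a l : ℝ} {D : Fin n → Fin n → Fin n → Prop} {τ h : Fin n → Bool} {ET EH : Finset (Fin n)},
    Str a l D τ h t ET EH EC → DegHyp D → a + k / n ≤ 1 / 10 ^ 6 → 1 / 10 ^ 3 ≤ l - k / n →
    l ≤ 1 / 200 → (0 : ℤ) ≤ (Finset.univ.filter fun v => τ v = false).card -
      (Finset.univ.filter fun v => h v = false).card →
    ((Finset.univ.filter fun v => τ v = false).card : ℤ) -
      (Finset.univ.filter fun v => h v = false).card ≤
      (Finset.univ.filter fun i => t i = true).card + k → HasTHC D := by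
  have hnR : (10 : ℝ) ^ 16 ≤ n := by exact_mod_cast hn
  induction k with
  | zero =>
    intro a l D τ h ET EH hS hD ha hl _ h0 h1
    norm_num at ha hl h1
    exact hS.hasTHC_of_le hn hD (by linarith) (by linarith) (by rw [abs_of_nonneg h0]; omega)
  | succ k ih =>
    intro a l D τ h ET EH hS hD ha hl hl' h0 h1
    have ek : ((k + 1 : ℕ) : ℝ) / n = 1 / n + k / n := by push_cast; ring
    rw [ek] at ha hl
    have p1 : (0 : ℝ) ≤ 1 / n := by positivity
    have p2 : (0 : ℝ) ≤ k / n := by positivity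
    by_cases hm : ((Finset.univ.filter fun v => τ v = false).card : ℤ) -
      (Finset.univ.filter fun v => h v = false).card ≤ (Finset.univ.filter fun i => t i = true).card
    · exact hS.hasTHC_of_le hn hD (by linarith) (by linarith) (by rwa [abs_of_nonneg h0])
    have hln : l * (n : ℝ) ^ 2 ≤ 1 / 200 * (n : ℝ) ^ 2 :=
      mul_le_mul_of_nonneg_right hl' (by positivity)
    by_cases lowT : ∀ v, τ v = false → ((Finset.univ.filter fun p : Fin n × Fin n =>
      h p.1 = true ∧ t p.2 = false ∧ D p.2 v p.1).card : ℝ) ≤ 1 / 200 * (n : ℝ) ^ 2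
    · by_cases lowH : ∀ w, h w = true → ((Finset.univ.filter fun p : Fin n × Fin n =>
        τ p.1 = false ∧ t p.2 = false ∧ D p.2 p.1 w).card : ℝ) ≤ 1 / 200 * (n : ℝ) ^ 2
      · exact hS.hasTHC_of_low hn hD (by linarith) (by linarith) (by omega) lowT lowH
      · push Not at lowH
        obtain ⟨w, hw, hwc⟩ := lowH
        have hS' := hS.rev.neg.flip (v := w) (by omega) (by simpa using hw)
          (hln.trans (hwc.le.trans (le_of_eq (by simp))))
        have hw' : (!h w) = false := by simp [hw]
        have e := card_update_true (τ := fun v => !h v) hw'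
        have e1 := card_filter_not_eq h
        have e2 := card_filter_not_eq τ
        have e1' : ((Finset.univ.filter fun v => (!h v) = false).card : ℤ) =
          n - (Finset.univ.filter fun v => h v = false).card := by exact_mod_cast e1
        have e2' : ((Finset.univ.filter fun v => (!τ v) = false).card : ℤ) =
          n - (Finset.univ.filter fun v => τ v = false).card := by exact_mod_cast e2
        zify at e
        refine HasTHC.of_reverse (ih hS' hD.reverse (by linarith) (by linarith) (by linarith) ?_ ?_)
        · linarith
        · push_cast at h1
          linarith
    · push Not at lowT
      obtain ⟨v, hv, hvc⟩ := lowT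
      have hS' := hS.flip (by omega) hv (hln.trans hvc.le)
      have e := card_update_true hv
      zify at e
      refine ih hS' hD (by linarith) (by linarith) (by linarith) ?_ ?_
      · linarith
      · push_cast at h1
        linarith

theorem Str.hasTHC {a l : ℝ} {D : Fin n → Fin n → Fin n → Prop} {τ h t : Fin n → Bool}
    {ET EH EC : Finset (Fin n)} (hS : Str a l D τ h t ET EH EC) (hn : 10 ^ 16 ≤ n)
    (hD : DegHyp D) (ha : a ≤ 1 / 10 ^ 7) (hl : 1 / 500 ≤ l) (hl' : l ≤ 1 / 200) : HasTHC D := by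
  have hnR : (10 : ℝ) ^ 16 ≤ n := by exact_mod_cast hn
  wlog hd : (0 : ℤ) ≤ (Finset.univ.filter fun v => τ v = false).card -
      (Finset.univ.filter fun v => h v = false).card generalizing D τ h ET EH
  · exact HasTHC.of_reverse (this hS.rev hD.reverse (by linarith))
  have han : a * n ≤ 1 / 10 ^ 7 * n := mul_le_mul_of_nonneg_right ha (by linarith)
  obtain ⟨k, hk⟩ := Int.eq_ofNat_of_zero_le hd
  have hkR : ((Finset.univ.filter fun v => τ v = false).card : ℝ) -
      (Finset.univ.filter fun v => h v = false).card = k := by exact_mod_cast hk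
  have r1 := abs_le.1 hS.sizeT
  have r2 := abs_le.1 hS.sizeH
  have hkn : (k : ℝ) / n ≤ 2 / 10 ^ 7 := by
    rw [div_le_iff₀ (by linarith)]
    linarith
  exact hS.hasTHC_of_le_add hn k hD (by linarith) (by linarith) hl' hd (by rw [hk]; omega)

theorem card_mul_le_of_injective {β γ : Type*} [Fintype β] (ι : Fin n × β → γ)
    (hι : Function.Injective ι) (F : Finset γ) {c : ℝ} (A : Finset (Fin n))
    (hA : ∀ v ∈ A, c ≤ (Finset.univ.filter fun p => ι (v, p) ∈ F).card) :
    (A.card : ℝ) * c ≤ F.card := by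
  have h1 := mul_le_card_filter_fst (fun v => v ∈ A) (fun v p => ι (v, p) ∈ F) hA
  rw [Finset.filter_univ_mem] at h1
  refine h1.trans ?_
  rw [Nat.cast_le]
  refine Finset.card_le_card_of_injOn ι (fun p hp => ?_) hι.injOn
  simp only [Finset.coe_filter, Finset.mem_univ, true_and, Set.mem_ofPred_eq] at hp
  exact hp.2

theorem abs_card_sub_card_le {f g : Fin n → Bool} {E : Finset (Fin n)}
    (hfg : ∀ v ∉ E, g v = f v) :
    |((Finset.univ.filter fun v => g v = false).card : ℝ) -
      (Finset.univ.filter fun v => f v = false).card| ≤ E.card := by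
  have key : ∀ f g : Fin n → Bool, (∀ v ∉ E, g v = f v) →
      ((Finset.univ.filter fun v => g v = false).card : ℝ) ≤
      (Finset.univ.filter fun v => f v = false).card + E.card := by
    intro f g hfg
    have h1 : (Finset.univ.filter fun v => g v = false) ⊆
        (Finset.univ.filter fun v => f v = false) ∪ E := by
      intro v hv
      by_cases hE : v ∈ E
      · simp [hE]
      · rw [Finset.mem_filter, hfg v hE] at hv
        simp [hv.2]
    exact_mod_cast (Finset.card_le_card h1).trans (Finset.card_union_le _ _)
  have h1 := key f g hfg
  have h2 := key g f fun v hv => (hfg v hv).symm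
  rw [abs_le]
  constructor <;> linarith

theorem exists_half (P : Fin n × Fin n → Prop) [DecidablePred P] (f : Fin n → Bool) :
    ∃ b, ((Finset.univ.filter P).card : ℝ) / 2 ≤
      (Finset.univ.filter fun p : Fin n × Fin n => f p.1 = b ∧ P p).card := by
  by_contra! h
  have h1 := h false
  have h2 := h true
  have e : Finset.univ.filter P ⊆ (Finset.univ.filter fun p : Fin n × Fin n => f p.1 = false ∧ P p)
      ∪ Finset.univ.filter fun p : Fin n × Fin n => f p.1 = true ∧ P p := by
    intro p hp
    have hp' : P p := by simpa using hp
    cases hf : f p.1 <;> simp [hf, hp']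
  have e1 := (Finset.card_le_card e).trans (Finset.card_union_le _ _)
  rify at e1
  linarith

/-- A partition with few missing even edges can be corrected on few vertices and colours. -/
theorem exists_str {D : Fin n → Fin n → Fin n → Prop} (hD : DegHyp D) (hn : 0 < n)
    (τ h t : Fin n → Bool)
    (hτ : |((Finset.univ.filter fun v => τ v = false).card : ℝ) - n / 2| ≤ 1 / 10 ^ 25 * n)
    (hh : |((Finset.univ.filter fun v => h v = false).card : ℝ) - n / 2| ≤ 1 / 10 ^ 25 * n)
    (ht : (n : ℝ) / 2 ≤ (Finset.univ.filter fun i => t i = false).card)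
    (hB : ((Finset.univ.filter fun x : Fin n × Fin n × Fin n => Even τ h t x.1 x.2.1 x.2.2 ∧
      ¬ D x.2.2 x.1 x.2.1).card : ℝ) ≤ 1 / 10 ^ 25 * (n : ℝ) ^ 3) :
    ∃ τ' h' t' ET EH EC, Str (1 / 10 ^ 7) (1 / 500) D τ' h' t' ET EH EC := by
  have hnR : (0 : ℝ) < n := by exact_mod_cast hn
  obtain ⟨F, hF⟩ : ∃ F : Finset (Fin n × Fin n × Fin n), F = Finset.univ.filter fun x =>
    Even τ h t x.1 x.2.1 x.2.2 ∧ ¬ D x.2.2 x.1 x.2.1 := ⟨_, rfl⟩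
  have hmem : ∀ v w i, (v, w, i) ∈ F ↔ Even τ h t v w i ∧ ¬ D i v w := fun v w i => by simp [hF]
  rw [← hF] at hB
  have exc : ∀ ι : Fin n × Fin n × Fin n → Fin n × Fin n × Fin n, Function.Injective ι →
      ∃ E : Finset (Fin n), (E.card : ℝ) ≤ 1 / 10 ^ 9 * n ∧
      ∀ v ∉ E, ((Finset.univ.filter fun p => ι (v, p) ∈ F).card : ℝ) ≤ 1 / 10 ^ 16 * (n : ℝ) ^ 2 := by
    intro ι hι
    refine ⟨Finset.univ.filter fun v => 1 / 10 ^ 16 * (n : ℝ) ^ 2 <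
      ((Finset.univ.filter fun p => ι (v, p) ∈ F).card : ℝ), ?_, fun v hv => ?_⟩
    · have h1 := card_mul_le_of_injective ι hι F (c := 1 / 10 ^ 16 * (n : ℝ) ^ 2) (Finset.univ.filter
        fun v => 1 / 10 ^ 16 * (n : ℝ) ^ 2 < ((Finset.univ.filter fun p => ι (v, p) ∈ F).card : ℝ))
        (fun v hv => by
          simp only [Finset.mem_filter, Finset.mem_univ, true_and] at hv
          refine hv.le.trans (le_of_eq ?_)
          congr)
      have h2 := h1.trans hB
      have h3 : 1 / 10 ^ 25 * (n : ℝ) ^ 3 = 1 / 10 ^ 9 * n * (1 / 10 ^ 16 * (n : ℝ) ^ 2) := by ring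
      rw [h3] at h2
      exact le_of_mul_le_mul_right h2 (by positivity)
    · simpa using hv
  obtain ⟨ET, hET, hET'⟩ := exc id Function.injective_id
  obtain ⟨EH, hEH, hEH'⟩ := exc (fun x => (x.2.1, x.1, x.2.2)) (by
    rintro ⟨a, b, c⟩ ⟨a', b', c'⟩ e
    simp only [Prod.mk.injEq] at e ⊢
    tauto)
  obtain ⟨EC, hEC, hEC'⟩ := exc (fun x => (x.2.1, x.2.2, x.1)) (by
    rintro ⟨a, b, c⟩ ⟨a', b', c'⟩ e
    simp only [Prod.mk.injEq] at e ⊢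
    tauto)
  simp only [id, hmem] at hET' hEH' hEC'
  have degT : ∀ v, (n : ℝ) ^ 2 / 4 ≤
      (Finset.univ.filter fun p : Fin n × Fin n => t p.2 = false ∧ D p.2 v p.1).card := by
    intro v
    have h1 := mul_le_card_filter_snd (fun i => t i = false) (fun w i => D i v w)
      (fun i _ => hD.out i v)
    have h2 := mul_le_mul_of_nonneg_right ht (by positivity : (0 : ℝ) ≤ n / 2)
    linarith
  have degH : ∀ w, (n : ℝ) ^ 2 / 4 ≤
      (Finset.univ.filter fun p : Fin n × Fin n => t p.2 = false ∧ D p.2 p.1 w).card := by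
    intro w
    have h1 := mul_le_card_filter_snd (fun i => t i = false) (fun v i => D i v w)
      (fun i _ => hD.inn i w)
    have h2 := mul_le_mul_of_nonneg_right ht (by positivity : (0 : ℝ) ≤ n / 2)
    linarith
  choose bT hbT using fun v => exists_half
    (fun p : Fin n × Fin n => t p.2 = false ∧ D p.2 v p.1) h
  choose bH hbH using fun w => exists_half
    (fun p : Fin n × Fin n => t p.2 = false ∧ D p.2 p.1 w) τ
  obtain ⟨τ', hτ'⟩ : ∃ τ' : Fin n → Bool, ∀ v, τ' v = if v ∈ ET then bT v else τ v :=
    ⟨_, fun _ => rfl⟩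
  obtain ⟨h', hh'⟩ : ∃ h' : Fin n → Bool, ∀ v, h' v = if v ∈ EH then bH v else h v :=
    ⟨_, fun _ => rfl⟩
  obtain ⟨t', ht'⟩ : ∃ t' : Fin n → Bool, ∀ i, t' i = if i ∈ EC then
    (if 1 / 400 * (n : ℝ) ^ 2 ≤ (Finset.univ.filter fun p : Fin n × Fin n =>
      τ p.1 = h p.2 ∧ D i p.1 p.2).card then false else true) else t i := ⟨_, fun _ => rfl⟩
  have eτ : ∀ v ∉ ET, τ' v = τ v := fun v hv => by rw [hτ', if_neg hv]
  have eh : ∀ v ∉ EH, h' v = h v := fun v hv => by rw [hh', if_neg hv]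
  have et : ∀ v ∉ EC, t' v = t v := fun v hv => by rw [ht', if_neg hv]
  have key : ∀ (P Q : Fin n × Fin n → Prop) [DecidablePred P] [DecidablePred Q]
      (A B : Finset (Fin n)), (A.card : ℝ) ≤ 1 / 10 ^ 9 * n → (B.card : ℝ) ≤ 1 / 10 ^ 9 * n →
      (∀ p, p.1 ∉ A → p.2 ∉ B → P p → Q p) → 1 / 400 * (n : ℝ) ^ 2 ≤ (Finset.univ.filter P).card →
      1 / 500 * (n : ℝ) ^ 2 ≤ (Finset.univ.filter Q).card := by
    intro P Q _ _ A B hA hB hPQ hP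
    have h1 := card_filter_le_add (P := P) (Q := Q) A B fun p hp => by
      by_cases hA : p.1 ∈ A
      · exact Or.inr (Or.inl hA)
      · by_cases hB : p.2 ∈ B
        · exact Or.inr (Or.inr hB)
        · exact Or.inl (hPQ p hA hB hp)
    have h2 : ((A.card : ℝ) + B.card) * n ≤ (1 / 10 ^ 9 * n + 1 / 10 ^ 9 * n) * n :=
      mul_le_mul_of_nonneg_right (by linarith) hnR.le
    have h3 : (0 : ℝ) ≤ (n : ℝ) ^ 2 := by positivity
    linarith
  have mono : ∀ (P Q : Fin n × Fin n → Prop) [DecidablePred P] [DecidablePred Q],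
      (∀ p, P p → Q p) → ∀ {c : ℝ}, ((Finset.univ.filter Q).card : ℝ) ≤ c →
      ((Finset.univ.filter P).card : ℝ) ≤ c := by
    intro P Q _ _ hPQ c hc
    refine le_trans ?_ hc
    rw [Nat.cast_le]
    exact Finset.card_le_card fun p hp => by
      simp only [Finset.mem_filter, Finset.mem_univ, true_and] at hp ⊢
      exact hPQ p hp
  have hEx : ∀ {x : ℝ}, x ≤ 1 / 10 ^ 9 * n → x ≤ 1 / 10 ^ 7 * n := fun hx => by linarith
  refine ⟨τ', h', t', ET, EH, EC, hEx hET, hEx hEH, hEx hEC, ?_, ?_, ?_, ?_, ?_, ?_, ?_, ?_, ?_, ?_⟩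
  · intro v hv
    refine mono _ _ (fun p hp => ?_) (hET' v hv)
    unfold Even at hp ⊢
    rw [eτ v hv, eh p.1 hp.1, et p.2 hp.2.1] at hp
    exact hp.2.2
  · intro v hv
    refine mono _ _ (fun p hp => ?_) (hEH' v hv)
    unfold Even at hp ⊢
    rw [eh v hv, eτ p.1 hp.1, et p.2 hp.2.1] at hp
    exact hp.2.2
  · intro i hi
    refine mono _ _ (fun p hp => ?_) (hEC' i hi)
    unfold Even at hp ⊢
    rw [et i hi, eτ p.1 hp.1, eh p.2 hp.2.1] at hp
    exact hp.2.2
  · intro v hv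
    refine key _ _ EH EC hEH hEC (fun p h1 h2 hp => ?_) ((hbT v).trans' ?_)
    · rw [hτ', if_pos hv, eh _ h1, et _ h2]
      exact hp
    · linarith [degT v, sq_nonneg (n : ℝ)]
  · intro v hv
    refine key _ _ ET EC hET hEC (fun p h1 h2 hp => ?_) ((hbH v).trans' ?_)
    · rw [hh', if_pos hv, eτ _ h1, et _ h2]
      exact hp
    · linarith [degH v, sq_nonneg (n : ℝ)]
  · intro i hi hti
    rw [ht', if_pos hi] at hti
    refine key _ _ ET EH hET hEH (fun p h1 h2 hp => ?_) (by
      by_contra h3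
      rw [if_neg (by convert h3)] at hti
      cases hti)
    rw [eτ _ h1, eh _ h2]
    exact hp
  · intro i b hti
    refine key (fun p => τ p.1 = b ∧ h p.2 = !b ∧ D i p.1 p.2) _ ET EH hET hEH
      (fun p h1 h2 hp => ?_) ?_
    · rw [eτ _ h1, eh _ h2]
      exact hp
    have cls : ∀ (f : Fin n → Bool),
        |((Finset.univ.filter fun v => f v = false).card : ℝ) - n / 2| ≤ 1 / 10 ^ 25 * n →
        ∀ b, 49 / 100 * (n : ℝ) ≤ (Finset.univ.filter fun v => f v = b).card := by
      intro f hf b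
      have u := (card_bool_classes f f).2.2
      have r := abs_le.1 hf
      rify at u
      cases b <;> linarith
    have add : ∀ (P Q R : Fin n × Fin n → Prop) [DecidablePred P] [DecidablePred Q]
        [DecidablePred R], (∀ p, P p → Q p ∨ R p) → ((Finset.univ.filter P).card : ℝ) ≤
        (Finset.univ.filter Q).card + (Finset.univ.filter R).card := by
      intro P Q R _ _ _ hPQ
      have h1 : Finset.univ.filter P ⊆ Finset.univ.filter Q ∪ Finset.univ.filter R := by
        intro p hp
        have := hPQ p (by simpa using hp)
        simpa using this
      exact_mod_cast (Finset.card_le_card h1).trans (Finset.card_union_le _ _)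
    have hn2 : (0 : ℝ) < (n : ℝ) ^ 2 := by positivity
    by_cases hi : i ∈ EC
    · have h3 : ((Finset.univ.filter fun p : Fin n × Fin n =>
          τ p.1 = h p.2 ∧ D i p.1 p.2).card : ℝ) < 1 / 400 * (n : ℝ) ^ 2 := by
        by_contra h3
        rw [ht', if_pos hi, if_pos (not_lt.1 h3)] at hti
        cases hti
      have h4 := mul_le_card_filter_fst (fun v => τ v = b) (fun v w => D i v w)
        (fun v _ => hD.out i v)
      have h5 := mul_le_mul_of_nonneg_right (cls τ hτ b) (by positivity : (0 : ℝ) ≤ n / 2)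
      have h6 := add (fun p => τ p.1 = b ∧ D i p.1 p.2)
        (fun p => τ p.1 = b ∧ h p.2 = !b ∧ D i p.1 p.2) (fun p => τ p.1 = h p.2 ∧ D i p.1 p.2)
        (fun p hp => by
          obtain ⟨hp1, hp2⟩ := hp
          by_cases hh : h p.2 = b
          · exact Or.inr ⟨hp1.trans hh.symm, hp2⟩
          · exact Or.inl ⟨hp1, by cases b <;> simpa using hh, hp2⟩)
      linarith
    · have h3 := hEC' i hi
      rw [et i hi] at hti
      have h4 := mul_le_card_filter_fst (fun v => τ v = b) (fun _ w => h w = !b)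
        (fun v _ => cls h hh (!b))
      have h5 := mul_le_mul_of_nonneg_right (cls τ hτ b) (by positivity : 0 ≤ 49 / 100 * (n : ℝ))
      have h6 := add (fun p => τ p.1 = b ∧ h p.2 = !b)
        (fun p => τ p.1 = b ∧ h p.2 = !b ∧ D i p.1 p.2)
        (fun p => Even τ h t p.1 p.2 i ∧ ¬ D i p.1 p.2) (fun p hp => by
          obtain ⟨hp1, hp2⟩ := hp
          by_cases hD : D i p.1 p.2
          · exact Or.inl ⟨hp1, hp2, hD⟩
          · refine Or.inr ⟨?_, hD⟩
            unfold Even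
            rw [hp1, hp2, hti]
            cases b <;> rfl)
      linarith
  · have h1 := abs_le.1 (abs_card_sub_card_le eτ)
    have h2 := abs_le.1 hτ
    rw [abs_le]
    constructor <;> linarith
  · have h1 := abs_le.1 (abs_card_sub_card_le eh)
    have h2 := abs_le.1 hh
    rw [abs_le]
    constructor <;> linarith
  · have h1 := abs_le.1 (abs_card_sub_card_le et)
    linarith

end Correction

theorem exists_hasTHC : ∃ n₀ : ℕ, ∀ n : ℕ, n₀ ≤ n → ∀ D : Fin n → Fin n → Fin n → Prop,
    DegHyp D → HasTHC D := by
  obtain ⟨n₀, h₀⟩ := hasTHC_or_structure (ε := 1 / 10 ^ 25) (by norm_num) (by norm_num)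
  refine ⟨max n₀ (10 ^ 16), fun n hn D hD => ?_⟩
  rcases h₀ n ((le_max_left _ _).trans hn) D hD with h1 | ⟨τ, h, t, hτ, hh, hB⟩
  · exact h1
  have hn' : 10 ^ 16 ≤ n := (le_max_right _ _).trans hn
  wlog ht : (n : ℝ) / 2 ≤ (Finset.univ.filter fun i => t i = false).card generalizing h t
  · refine this (fun w => !h w) (fun i => !t i) ?_ ?_ ?_
    · rw [card_filter_not_eq, abs_sub_comm]
      refine le_trans (le_of_eq ?_) hh
      congr 1
      ring
    · have hE : ∀ v w i, Even τ (fun w => !h w) (fun i => !t i) v w i ↔ Even τ h t v w i := by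
        intro v w i
        simp [Even]
      simpa only [hE] using hB
    · rw [card_filter_not_eq]
      linarith
  obtain ⟨τ', h', t', ET, EH, EC, hS⟩ := exists_str hD (by omega) τ h t hτ hh ht hB
  exact hS.hasTHC hn' hD le_rfl le_rfl (by norm_num)

theorem HasTHC.exists_cyclic_order {n : ℕ} {D : Fin n → Fin n → Fin n → Prop} (hD : HasTHC D) :
    ∃ σ φ : Fin n ≃ Fin n, ∀ k, D (φ k) (σ k) (σ (finRotate n k)) := by
  obtain ⟨π, ψ, hπ, hψ⟩ := hD
  rcases n with _ | n
  · exact ⟨Equiv.refl _, Equiv.refl _, fun k => k.elim0⟩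
  have hc : π.IsCycleOn (Finset.univ : Finset (Fin (n + 1))) :=
    ⟨by simp, fun x _ y _ => hπ x y⟩
  have hs : Function.Surjective fun k : Fin (n + 1) => (π ^ (k : ℕ)) 0 := by
    intro y
    obtain ⟨i, hi, e⟩ := hc.exists_pow_eq (Finset.mem_univ 0) (Finset.mem_univ y)
    exact ⟨⟨i, by simpa using hi⟩, e⟩
  have hb : Function.Bijective fun k : Fin (n + 1) => (π ^ (k : ℕ)) 0 :=
    Finite.injective_iff_bijective.1 (Finite.injective_iff_surjective.2 hs)
  refine ⟨Equiv.ofBijective _ hb, (Equiv.ofBijective _ hb).trans ψ, fun k => ?_⟩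
  have e : (π ^ (finRotate (n + 1) k : ℕ)) 0 = π ((π ^ (k : ℕ)) 0) := by
    rw [← Perm.mul_apply, ← pow_succ']
    by_cases hk : k = Fin.last n
    · have := hc.pow_card_apply (Finset.mem_univ 0)
      rw [Finset.card_univ, Fintype.card_fin] at this
      simp [hk, this]
    · rw [coe_finRotate_of_ne_last hk]
  simp only [Equiv.trans_apply, Equiv.ofBijective_apply, e]
  exact hψ _

end TGH

/-- **Transversal Ghouila-Houri theorem.** There is `n0` such that for every `n ≥ n0`,
every collection `D 1, …, D n` of loopless digraphs on a common vertex set of size `n`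
with minimum semi-degree at least `n/2` contains a transversal directed Hamilton cycle:
a cyclic ordering `σ` of the vertices and a bijection `φ` assigning a distinct colour to
each edge of the cycle so that each edge lies in the digraph of its colour. -/
theorem transversal_ghouila_houri :
    ∃ n0 : ℕ, ∀ n : ℕ, n0 ≤ n →
      ∀ D : Fin n → Fin n → Fin n → Prop,
        (∀ i v, ¬ D i v v) →
        (∀ i v, (n : ℝ) / 2 ≤ outDeg (D i) v ∧ (n : ℝ) / 2 ≤ inDeg (D i) v) →
        ∃ σ φ : Fin n ≃ Fin n, ∀ k : Fin n, D (φ k) (σ k) (σ (finRotate n k)) := by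
  classical
  obtain ⟨n₀, h₀⟩ := TGH.exists_hasTHC
  refine ⟨n₀, fun n hn D hl hd => (h₀ n hn D ⟨hl, fun i v => ?_, fun i v => ?_⟩).exists_cyclic_order⟩
  · refine (hd i v).1.trans (le_of_eq ?_)
    rw [outDeg, Nat.card_eq_fintype_card, Fintype.card_subtype]
  · refine (hd i v).2.trans (le_of_eq ?_)
    rw [inDeg, Nat.card_eq_fintype_card, Fintype.card_subtype]
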